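/- arXiv:2203.05165 — 4 statements merged into one kernel-verified Lean document; each statement's English description precedes it below -/
import Mathlib

section
/- Suppose Assumption A holds. Then for every (x₀, u) ∈ ℝⁿ × 𝒰ᵖ[0,T] the state equation admits a unique solution x(·;x₀,u) belonging to C([0,T];ℝⁿ), and there is a constant C ≥ 0, independent of (x₀,u), such that ‖x(·;x₀,u)‖_{Lᵖ([0,T];ℝⁿ)} ≤ C(1 + |x₀| + ‖ρ(u(·),u₀)‖_{Lᵖ([0,T];ℝ)}). -/
open MeasureTheory Set

noncomputable section

/-- Euclidean space `ℝ^k`. -/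
abbrev Euc (k : ℕ) := EuclideanSpace ℝ (Fin k)

/-- Admissible controls in `𝒰ᵖ[0,T]`: measurable, `U`-valued, with `ρ(u(·),u₀) ∈ Lᵖ`. -/
def Admissible {d : ℕ} (T p : ℝ) (U : Set (Euc d)) (u₀ : Euc d) (u : ℝ → Euc d) : Prop :=
  Measurable u ∧ (∀ t, u t ∈ U) ∧ IntegrableOn (fun t => ‖u t - u₀‖ ^ p) (Set.Ioc 0 T)

/-- `x` solves the Volterra integral equation with singular and nonsingular kernels for the
initial condition `x₀` and control `u`, a.e. on `[0,T]`. -/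
def IsSolution {n d : ℕ} (T α : ℝ) (f g : ℝ → ℝ → Euc n → Euc d → Euc n)
    (x₀ : Euc n) (u : ℝ → Euc d) (x : ℝ → Euc n) : Prop :=
  ∀ᵐ t ∂(volume.restrict (Set.Ioc 0 T)),
    x t = x₀ + (∫ s in Set.Ioc 0 t, ((t - s) ^ (α - 1)) • f t s (x s) (u s))
        + ∫ s in Set.Ioc 0 t, g t s (x s) (u s)


theorem vw_holder {E : Type*} [NormedAddCommGroup E] [NormedSpace ℝ E] {q r : ENNReal} [ENNReal.HolderConjugate q r] {T t : ℝ} (ht : t ≤ T)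
    {φ H : ℝ → ℝ} (hφ : MemLp φ q (volume.restrict (Ioo 0 T)))
    (hH : MemLp H r (volume.restrict (Ioo 0 T))) {F : ℝ → E}
    (hF : AEStronglyMeasurable F (volume.restrict (Ioo 0 t))) (hFH : ∀ s ∈ Ioo 0 t, ‖F s‖ ≤ H s) :
    IntegrableOn (fun s => φ (t - s) • F s) (Ioo 0 t) ∧
    ‖∫ s in Ioo 0 t, φ (t - s) • F s‖ ≤ (eLpNorm φ q (volume.restrict (Ioo 0 T))).toReal *
      (eLpNorm H r (volume.restrict (Ioo 0 T))).toReal := by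
  have hsub : volume.restrict (Ioo 0 t) ≤ volume.restrict (Ioo 0 T) :=
    Measure.restrict_mono (Ioo_subset_Ioo le_rfl ht) le_rfl
  have mp : MeasurePreserving (fun s : ℝ => t - s) (volume.restrict (Ioo 0 t)) (volume.restrict (Ioo 0 t)) := by
    have h := (Measure.measurePreserving_sub_left (volume : Measure ℝ) t).restrict_preimage
      (measurableSet_Ioo (a := (0:ℝ)) (b := t))
    have e : (fun s : ℝ => t - s) ⁻¹' (Ioo 0 t) = Ioo 0 t := by ext s; simp [and_comm]
    rwa [e] at h
  have hφ' := hφ.mono_measure hsub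
  have hφc : MemLp (fun s => φ (t - s)) q (volume.restrict (Ioo 0 t)) := hφ'.comp_measurePreserving mp
  have hH' := hH.mono_measure hsub
  have hle : ∀ᵐ s ∂(volume.restrict (Ioo 0 t)), ‖F s‖ ≤ H s :=
    (ae_restrict_iff' measurableSet_Ioo).2 (ae_of_all _ hFH)
  have hFm : MemLp F r (volume.restrict (Ioo 0 t)) := hH'.mono' hF hle
  have h1 : MemLp ((fun s => φ (t - s)) • F) 1 (volume.restrict (Ioo 0 t)) := hFm.smul hφc
  have hn : eLpNorm ((fun s => φ (t - s)) • F) 1 (volume.restrict (Ioo 0 t)) ≤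
      eLpNorm φ q (volume.restrict (Ioo 0 T)) * eLpNorm H r (volume.restrict (Ioo 0 T)) := by
    refine (eLpNorm_smul_le_mul_eLpNorm (p := q) (q := r) hF hφc.1).trans ?_
    have := eLpNorm_comp_measurePreserving (p := q) hφ'.1 mp
    gcongr
    · exact this.le.trans (eLpNorm_mono_measure _ hsub)
    · exact (eLpNorm_mono_ae_real hle).trans (eLpNorm_mono_measure _ hsub)
  refine ⟨memLp_one_iff_integrable.1 h1, ?_⟩
  refine (norm_integral_le_integral_norm _).trans ?_
  rw [← ENNReal.toReal_mul]
  change ∫ s in Ioo 0 t, ‖((fun s => φ (t - s)) • F) s‖ ≤ _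
  rw [integral_norm_eq_lintegral_enorm h1.1, ← eLpNorm_one_eq_lintegral_enorm]
  exact ENNReal.toReal_mono (ENNReal.mul_ne_top hφ.2.ne hH.2.ne) hn

theorem vw_decay {q : ENNReal} (hq0 : q ≠ 0) (hqt : q ≠ ⊤) {T : ℝ} {k : ℝ → ℝ}
    (hk : MemLp k q (volume.restrict (Ioo 0 T))) :
    (∀ m : ℕ, MemLp (fun τ => k τ * Real.exp (-(m * τ))) q (volume.restrict (Ioo 0 T))) ∧
    Filter.Tendsto (fun m : ℕ => (eLpNorm (fun τ => k τ * Real.exp (-(m * τ))) q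
      (volume.restrict (Ioo 0 T))).toReal) Filter.atTop (nhds 0) := by
  have hm : ∀ m : ℕ, AEStronglyMeasurable (fun τ => k τ * Real.exp (-(m * τ))) (volume.restrict (Ioo 0 T)) :=
    fun m => hk.1.mul (by fun_prop)
  have hb : ∀ m : ℕ, ∀ᵐ τ ∂(volume.restrict (Ioo 0 T)), ‖k τ * Real.exp (-(m * τ))‖ ≤ ‖k τ‖ := by
    intro m
    refine (ae_restrict_iff' measurableSet_Ioo).2 (ae_of_all _ fun τ hτ => ?_)
    rw [norm_mul, Real.norm_of_nonneg (Real.exp_nonneg _)]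
    refine mul_le_of_le_one_right (norm_nonneg _) (Real.exp_le_one_iff.2 ?_)
    have := mul_nonneg (Nat.cast_nonneg (α := ℝ) m) hτ.1.le
    linarith
  refine ⟨fun m => hk.mono (hm m) (hb m), ?_⟩
  have hq := ENNReal.toReal_pos hq0 hqt
  rw [← ENNReal.toReal_zero]
  refine (ENNReal.tendsto_toReal ENNReal.zero_ne_top).comp ?_
  have key : Filter.Tendsto (fun m : ℕ => ∫⁻ τ in Ioo 0 T, ‖k τ * Real.exp (-(m * τ))‖ₑ ^ q.toReal) Filter.atTop
      (nhds (∫⁻ τ in Ioo 0 T, 0)) := by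
    refine tendsto_lintegral_of_dominated_convergence' (fun τ => ‖k τ‖ₑ ^ q.toReal) (fun m => (hm m).enorm.pow_const _) ?_ ?_ ?_
    · intro m
      filter_upwards [hb m] with τ h
      gcongr
      exact enorm_le_iff_norm_le.2 h
    · exact (lintegral_rpow_enorm_lt_top_of_eLpNorm_lt_top hq0 hqt hk.2).ne
    · refine (ae_restrict_iff' measurableSet_Ioo).2 (ae_of_all _ fun τ hτ => ?_)
      have h1 : Filter.Tendsto (fun m : ℕ => k τ * Real.exp (-(m * τ))) Filter.atTop (nhds (k τ * 0)) := by
        refine Filter.Tendsto.const_mul _ (Real.tendsto_exp_neg_atTop_nhds_zero.comp ?_)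
        exact tendsto_natCast_atTop_atTop.atTop_mul_const hτ.1
      have h2 := ((ENNReal.continuous_rpow_const (y := q.toReal)).tendsto _).comp h1.enorm
      simpa [hq, Function.comp_def] using h2
  have h3 := ((ENNReal.continuous_rpow_const (y := 1 / q.toReal)).tendsto _).comp key
  simp only [lintegral_zero, ENNReal.zero_rpow_of_pos (one_div_pos.2 hq)] at h3
  refine h3.congr fun m => ?_
  simp [eLpNorm_eq_lintegral_rpow_enorm_toReal hq0 hqt]

theorem vw_cont {E : Type*} [NormedAddCommGroup E] [NormedSpace ℝ E] {q r : ENNReal} [ENNReal.HolderConjugate q r]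
    (hq0 : q ≠ 0) (hqt : q ≠ ⊤) (hr1 : 1 ≤ r) {T : ℝ} {k : ℝ → ℝ}
    (hk : MemLp k q (volume.restrict (Ioo 0 T))) (hkc : ContinuousOn k (Ioi 0)) (hkm : Measurable k)
    (hk0 : ∀ τ, 0 < τ → 0 ≤ k τ) {M : ℝ} (hkM : ∀ τ ∈ Ioo 0 T, τ * k τ ≤ M)
    {H : ℝ → ℝ} (hH0 : ∀ s, 0 ≤ H s) (hH : MemLp H r (volume.restrict (Ioo 0 T)))
    {F : ℝ → ℝ → E} (hF : ∀ t, StronglyMeasurable (F t))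
    (hFH : ∀ t s, 0 ≤ s → s ≤ t → t ≤ T → ‖F t s‖ ≤ H s)
    (hFc : ∀ s t, 0 < s → s < t → t ≤ T → ContinuousWithinAt (fun t => F t s) (Icc s T) t) :
    ContinuousOn (fun t => ∫ s in Ioc 0 t, k (t - s) • F t s) (Icc 0 T) := by
  simp only [integral_Ioc_eq_integral_Ioo]
  obtain ⟨hd, hlim⟩ := vw_decay hq0 hqt hk
  have hkd : ∀ m : ℕ, MemLp (fun τ => k τ * (1 - Real.exp (-(m * τ)))) q (volume.restrict (Ioo 0 T)) := by
    intro m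
    have := hk.sub (hd m)
    refine this.ae_eq (ae_of_all _ fun τ => ?_)
    simp; ring
  have hU : TendstoUniformlyOn (fun (m : ℕ) t => ∫ s in Ioo 0 t, (k (t - s) * (1 - Real.exp (-(m * (t - s))))) • F t s)
      (fun t => ∫ s in Ioo 0 t, k (t - s) • F t s) Filter.atTop (Icc 0 T) := by
    rw [Metric.tendstoUniformlyOn_iff]
    intro ε hε
    have h0 := hlim.mul_const ((eLpNorm H r (volume.restrict (Ioo 0 T))).toReal)
    rw [zero_mul] at h0
    filter_upwards [h0.eventually (gt_mem_nhds hε)] with m hm t ht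
    have hFH' : ∀ s ∈ Ioo 0 t, ‖F t s‖ ≤ H s := fun s hs => hFH t s hs.1.le hs.2.le ht.2
    have A := vw_holder ht.2 (hd m) hH (hF t).aestronglyMeasurable hFH'
    have B := vw_holder ht.2 hk hH (hF t).aestronglyMeasurable hFH'
    have C := vw_holder ht.2 (hkd m) hH (hF t).aestronglyMeasurable hFH'
    rw [dist_eq_norm, ← integral_sub B.1 C.1]
    refine lt_of_le_of_lt (le_trans (le_of_eq ?_) A.2) hm
    congr 2
    ext s
    rw [← sub_smul]
    congr 1
    ring
  refine hU.continuousOn (Filter.Frequently.of_forall fun m => ?_)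
  intro t₀ ht₀
  have hi : ∀ t ∈ Icc 0 T, ∫ s in Ioo 0 t, (k (t - s) * (1 - Real.exp (-(m * (t - s))))) • F t s =
      ∫ s in Ioo 0 T, (Ioo 0 t).indicator (fun s => (k (t - s) * (1 - Real.exp (-(m * (t - s))))) • F t s) s := by
    intro t ht
    rw [setIntegral_indicator measurableSet_Ioo]
    congr 2
    exact (inter_eq_right.2 (Ioo_subset_Ioo le_rfl ht.2)).symm
  refine ContinuousWithinAt.congr ?_ hi (hi t₀ ht₀)
  refine continuousWithinAt_of_dominated (bound := fun s => m * M * H s) ?_ ?_ ?_ ?_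
  · refine Filter.Eventually.of_forall fun t => ?_
    refine (StronglyMeasurable.indicator ?_ measurableSet_Ioo).aestronglyMeasurable
    refine StronglyMeasurable.smul ?_ (hF t)
    refine Measurable.stronglyMeasurable ?_
    have : Measurable fun s => k (t - s) := hkm.comp (by fun_prop)
    fun_prop
  · filter_upwards [self_mem_nhdsWithin] with t ht
    refine (ae_restrict_iff' measurableSet_Ioo).2 (ae_of_all _ fun s hs => ?_)
    have hTs : 0 < s ∧ s < T := hs
    have hM0 : 0 ≤ M := (mul_nonneg hs.1.le (hk0 s hs.1)).trans (hkM s hs)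
    have hmM : 0 ≤ m * M := mul_nonneg (Nat.cast_nonneg _) hM0
    by_cases hst : s ∈ Ioo 0 t
    · rw [indicator_of_mem hst, norm_smul]
      have hτ : 0 < t - s := sub_pos.2 hst.2
      refine mul_le_mul ?_ (hFH t s hst.1.le hst.2.le ht.2) (norm_nonneg _) hmM
      have e1 : Real.exp (-(m * (t - s))) ≤ 1 := by
        rw [Real.exp_le_one_iff]
        have := mul_nonneg (Nat.cast_nonneg (α := ℝ) m) hτ.le
        linarith
      have e2 := Real.add_one_le_exp (-(m * (t - s)))
      have e3 := hk0 _ hτ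
      rw [Real.norm_of_nonneg (mul_nonneg e3 (by linarith))]
      calc k (t - s) * (1 - Real.exp (-(m * (t - s)))) ≤ k (t - s) * (m * (t - s)) := by
            gcongr; linarith
        _ = m * ((t - s) * k (t - s)) := by ring
        _ ≤ m * M := by
            gcongr
            exact hkM _ ⟨hτ, by linarith [ht.2, hst.1]⟩
    · rw [indicator_of_notMem hst, norm_zero]
      exact mul_nonneg hmM (hH0 s)
  · exact (hH.integrable hr1).const_mul _
  · have hne : ∀ᵐ s ∂(volume.restrict (Ioo 0 T)), s ≠ t₀ := ae_restrict_of_ae (Measure.ae_ne volume t₀)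
    filter_upwards [hne, ae_restrict_mem measurableSet_Ioo] with s hs hsT
    rcases lt_or_gt_of_ne hs with h | h
    · have hev : ∀ᶠ t in nhdsWithin t₀ (Icc 0 T), t ∈ Icc s T ∧ s < t := by
        filter_upwards [self_mem_nhdsWithin, mem_nhdsWithin_of_mem_nhds (lt_mem_nhds h)] with t h1 h2
        exact ⟨⟨h2.le, h1.2⟩, h2⟩
      have hc : ContinuousWithinAt (fun t => (k (t - s) * (1 - Real.exp (-(m * (t - s))))) • F t s) (Icc 0 T) t₀ := by
        refine ContinuousWithinAt.smul (ContinuousWithinAt.mul ?_ (by fun_prop)) ?_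
        · have : ContinuousAt k (t₀ - s) := hkc.continuousAt (Ioi_mem_nhds (sub_pos.2 h))
          exact (ContinuousAt.comp (f := fun t => t - s) this (by fun_prop)).continuousWithinAt
        · refine (hFc s t₀ hsT.1 h ht₀.2).mono_of_mem_nhdsWithin ?_
          exact hev.mono fun t h => h.1
      refine hc.congr_of_eventuallyEq ?_ ?_
      · filter_upwards [hev] with t ht
        exact indicator_of_mem (show s ∈ Ioo 0 t from ⟨hsT.1, ht.2⟩) _
      · exact indicator_of_mem (show s ∈ Ioo 0 t₀ from ⟨hsT.1, h⟩) _
    · refine (continuousWithinAt_const (b := (0:E))).congr_of_eventuallyEq ?_ ?_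
      · filter_upwards [mem_nhdsWithin_of_mem_nhds (gt_mem_nhds h)] with t ht
        exact indicator_of_notMem (fun h' => absurd h'.2 (not_lt.2 ht.le)) _
      · exact indicator_of_notMem (fun h' => absurd h'.2 (not_lt.2 h.le)) _

theorem vw_diff {E : Type*} [NormedAddCommGroup E] [NormedSpace ℝ E] {q r : ENNReal} [ENNReal.HolderConjugate q r]
    {T t : ℝ} (ht : t ≤ T) {k : ℝ → ℝ} (m : ℕ)
    (hk : MemLp k q (volume.restrict (Ioo 0 T)))
    (hkm : MemLp (fun τ => k τ * Real.exp (-(m * τ))) q (volume.restrict (Ioo 0 T)))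
    {H K : ℝ → ℝ} (hH : MemLp H r (volume.restrict (Ioo 0 T))) (hK : MemLp K r (volume.restrict (Ioo 0 T)))
    {h₁ h₂ : ℝ → E} (hm1 : StronglyMeasurable h₁) (hm2 : StronglyMeasurable h₂)
    (hH1 : ∀ s ∈ Ioo 0 t, ‖h₁ s‖ ≤ H s) (hH2 : ∀ s ∈ Ioo 0 t, ‖h₂ s‖ ≤ H s)
    {D : ℝ} (hD : 0 ≤ D)
    (hd : ∀ s ∈ Ioo 0 t, ‖h₁ s - h₂ s‖ ≤ Real.exp (m * s) * (D * K s)) :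
    ‖(∫ s in Ioc 0 t, k (t - s) • h₁ s) - ∫ s in Ioc 0 t, k (t - s) • h₂ s‖ ≤
      Real.exp (m * t) * ((eLpNorm (fun τ => k τ * Real.exp (-(m * τ))) q (volume.restrict (Ioo 0 T))).toReal *
        (eLpNorm K r (volume.restrict (Ioo 0 T))).toReal * D) := by
  simp only [integral_Ioc_eq_integral_Ioo]
  have A := vw_holder ht hk hH hm1.aestronglyMeasurable hH1
  have B := vw_holder ht hk hH hm2.aestronglyMeasurable hH2
  have C := vw_holder ht hkm (hK.const_mul D) (F := fun s => Real.exp (-(m * s)) • (h₁ s - h₂ s))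
    (StronglyMeasurable.smul (Measurable.stronglyMeasurable (by fun_prop)) (hm1.sub hm2)).aestronglyMeasurable (by
      intro s hs
      rw [norm_smul, Real.norm_of_nonneg (Real.exp_nonneg _)]
      calc _ ≤ Real.exp (-(m * s)) * (Real.exp (m * s) * (D * K s)) := by gcongr; exact hd s hs
        _ = D * K s := by rw [← mul_assoc, ← Real.exp_add]; simp)
  rw [← integral_sub A.1 B.1]
  have e : (fun s => k (t - s) • h₁ s - k (t - s) • h₂ s) = fun s => Real.exp (m * t) •
      ((k (t - s) * Real.exp (-(m * (t - s)))) • Real.exp (-(m * s)) • (h₁ s - h₂ s)) := by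
    ext s
    rw [← smul_sub, smul_smul, smul_smul]
    congr 1
    have : Real.exp (m * t) * Real.exp (-(m * (t - s))) * Real.exp (-(m * s)) = 1 := by
      rw [← Real.exp_add, ← Real.exp_add]; simp; ring
    linear_combination (-k (t - s)) * this
  rw [e, integral_smul, norm_smul, Real.norm_of_nonneg (Real.exp_nonneg _)]
  refine mul_le_mul_of_nonneg_left (C.2.trans (le_of_eq ?_)) (Real.exp_nonneg _)
  have : (eLpNorm (fun s => D * K s) r (volume.restrict (Ioo 0 T))).toReal = D * (eLpNorm K r (volume.restrict (Ioo 0 T))).toReal := by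
    have := eLpNorm_const_smul D K r (volume.restrict (Ioo 0 T))
    rw [show (fun s => D * K s) = D • K from rfl, this, ENNReal.toReal_mul]
    simp [abs_of_nonneg hD]
  rw [this]; ring

theorem vw_fixed {E : Type*} [NormedAddCommGroup E] [NormedSpace ℝ E] [CompleteSpace E] {T : ℝ} (hT : 0 < T)
    (Φ : (ℝ → E) → ℝ → E) (m : ℕ) {B : ℝ}
    (P1 : ∀ x, Continuous x → ContinuousOn (Φ x) (Icc 0 T))
    (P2 : ∀ x y D, Continuous x → Continuous y → 0 ≤ D → (∀ s ∈ Icc 0 T, ‖x s - y s‖ ≤ Real.exp (m * s) * D) →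
      ∀ t ∈ Icc 0 T, ‖Φ x t - Φ y t‖ ≤ Real.exp (m * t) * (1 / 2 * D))
    (P3 : ∀ t ∈ Icc 0 T, ‖Φ 0 t‖ ≤ B)
    (P4 : ∀ x y, EqOn x y (Icc 0 T) → EqOn (Φ x) (Φ y) (Icc 0 T)) :
    ∃ x : ℝ → E, ContinuousOn x (Icc 0 T) ∧ EqOn x (Φ x) (Icc 0 T) ∧
      (∀ y, ContinuousOn y (Icc 0 T) → y =ᵐ[volume.restrict (Ioc 0 T)] Φ y → EqOn y x (Icc 0 T)) ∧
      ∀ t ∈ Icc 0 T, ‖x t‖ ≤ Real.exp (m * T) * (2 * B) := by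
  let ext : C(Icc 0 T, E) → ℝ → E := fun z s => Real.exp (m * s) • z (projIcc 0 T hT.le s)
  have hext : ∀ z, Continuous (ext z) := fun z => by
    have : Continuous fun s => z (projIcc 0 T hT.le s) := z.continuous.comp continuous_projIcc
    exact Continuous.smul (by fun_prop) this
  let Ψ : C(Icc 0 T, E) → C(Icc 0 T, E) := fun z =>
    ⟨fun t => Real.exp (-(m * t)) • Φ (ext z) t,
      Continuous.smul (by fun_prop) (P1 _ (hext z)).domRestrict⟩
  have hΨ : ∀ z z', dist (Ψ z) (Ψ z') ≤ 1 / 2 * dist z z' := by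
    intro z z'
    rw [ContinuousMap.dist_le (by positivity)]
    intro t
    change dist (Real.exp (-(m * t)) • Φ (ext z) t) (Real.exp (-(m * t)) • Φ (ext z') t) ≤ _
    rw [dist_eq_norm, ← smul_sub, norm_smul, Real.norm_of_nonneg (Real.exp_nonneg _)]
    have := P2 (ext z) (ext z') (dist z z') (hext z) (hext z') dist_nonneg (by
      intro s hs
      change ‖Real.exp (m * s) • _ - Real.exp (m * s) • _‖ ≤ _
      rw [← smul_sub, norm_smul, Real.norm_of_nonneg (Real.exp_nonneg _), ← dist_eq_norm]
      gcongr
      exact ContinuousMap.dist_apply_le_dist _) t t.2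
    calc _ ≤ Real.exp (-(m * t)) * (Real.exp (m * t) * (1 / 2 * dist z z')) := by gcongr
      _ = _ := by rw [← mul_assoc, ← Real.exp_add]; simp
  have hc : ContractingWith (1 / 2) Ψ := by
    refine ⟨by rw [← NNReal.coe_lt_coe]; norm_num, LipschitzWith.of_dist_le_mul fun z z' => ?_⟩
    simpa using hΨ z z'
  let z := hc.fixedPoint Ψ
  have hz : Ψ z = z := hc.fixedPoint_isFixedPt
  have hzt : ∀ t : Icc 0 T, Real.exp (-(m * t)) • Φ (ext z) t = z t := fun t => congrArg (fun w : C(Icc 0 T, E) => w t) hz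
  have hsol : EqOn (ext z) (Φ (ext z)) (Icc 0 T) := by
    intro t ht
    change Real.exp (m * t) • z (projIcc 0 T hT.le t) = _
    rw [projIcc_of_mem _ ht, ← hzt ⟨t, ht⟩, smul_smul, ← Real.exp_add]
    simp
  refine ⟨ext z, (hext z).continuousOn, hsol, ?_, ?_⟩
  · intro y hy hyΦ
    let w : C(Icc 0 T, E) := ⟨fun t => Real.exp (-(m * t)) • y t, Continuous.smul (by fun_prop) hy.domRestrict⟩
    have hwy : EqOn (ext w) y (Icc 0 T) := by
      intro t ht
      change Real.exp (m * t) • w (projIcc 0 T hT.le t) = _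
      rw [projIcc_of_mem _ ht]
      change Real.exp (m * t) • Real.exp (-(m * t)) • y t = _
      rw [smul_smul, ← Real.exp_add]
      simp
    have hΦ := P4 _ _ hwy
    have hyc : ContinuousOn (Φ y) (Icc 0 T) := (P1 _ (hext w)).congr fun t ht => (hΦ ht).symm
    have hyE : EqOn y (Φ y) (Icc 0 T) := by
      refine Measure.eqOn_Icc_of_ae_eq volume hT.ne ?_ hy hyc
      rwa [Measure.restrict_congr_set Ioc_ae_eq_Icc] at hyΦ
    have hw : Ψ w = w := by
      ext1 t
      change Real.exp (-(m * t)) • Φ (ext w) t = Real.exp (-(m * t)) • y t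
      rw [hΦ t.2, ← hyE t.2]
    have : w = z := hc.fixedPoint_unique hw
    intro t ht
    rw [← this, hwy ht]
  · intro t ht
    have hB : 0 ≤ B := (norm_nonneg _).trans (P3 t ht)
    have h0 : ext 0 = 0 := by ext s; simp [ext]
    have hΨ0 : ‖Ψ 0‖ ≤ B := by
      rw [ContinuousMap.norm_le _ hB]
      intro s
      change ‖Real.exp (-(m * s)) • Φ (ext 0) s‖ ≤ B
      rw [h0, norm_smul, Real.norm_of_nonneg (Real.exp_nonneg _)]
      have e1 : Real.exp (-(m * (s:ℝ))) ≤ 1 := by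
        rw [Real.exp_le_one_iff]
        have := mul_nonneg (Nat.cast_nonneg (α := ℝ) m) s.2.1
        linarith
      exact (mul_le_of_le_one_left (norm_nonneg _) e1).trans (P3 s s.2)
    have hzB : ‖z‖ ≤ 2 * B := by
      have h1 := hΨ z 0
      rw [hz, dist_eq_norm, dist_zero_right] at h1
      have h2 := norm_sub_norm_le z (Ψ 0)
      linarith
    change ‖Real.exp (m * t) • z (projIcc 0 T hT.le t)‖ ≤ _
    rw [norm_smul, Real.norm_of_nonneg (Real.exp_nonneg _)]
    gcongr
    · exact ht.2
    · exact (z.norm_coe_le_norm _).trans hzB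

theorem vw_single {E : Type*} [NormedAddCommGroup E] [NormedSpace ℝ E] [MeasurableSpace E] [BorelSpace E]
    [SecondCountableTopology E] {q r : ENNReal} [ENNReal.HolderConjugate q r]
    (hq0 : q ≠ 0) (hqt : q ≠ ⊤) (hr1 : 1 ≤ r) {T : ℝ} {k : ℝ → ℝ}
    (hk : MemLp k q (volume.restrict (Ioo 0 T))) (hkc : ContinuousOn k (Ioi 0)) (hkm : Measurable k)
    (hk0 : ∀ τ, 0 < τ → 0 ≤ k τ) {M : ℝ} (hkM : ∀ τ ∈ Ioo 0 T, τ * k τ ≤ M)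
    {K₀ K : ℝ → ℝ} (hK₀0 : ∀ s, 0 ≤ K₀ s) (hK0 : ∀ s, 0 ≤ K s)
    (hK₀ : MemLp K₀ r (volume.restrict (Ioo 0 T))) (hK : MemLp K r (volume.restrict (Ioo 0 T)))
    {K' : ℝ} (hK' : 0 ≤ K') {ω : ℝ → ℝ} (hω_nonneg : ∀ r, 0 ≤ ω r)
    (hω0 : ω 0 = 0) (hω_cont : ContinuousWithinAt ω (Set.Ici 0) 0)
    {h : ℝ → ℝ → E → E} (hmeas : Measurable fun q : ℝ × ℝ × E => h q.1 q.2.1 q.2.2)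
    (hlip : ∀ t s x x', 0 ≤ s → s ≤ t → t ≤ T → ‖h t s x - h t s x'‖ ≤ K s * ‖x - x'‖)
    (hzero : ∀ t s, 0 ≤ s → s ≤ t → t ≤ T → ‖h t s 0‖ ≤ K₀ s)
    (ht : ∀ t t' s x, 0 ≤ s → s ≤ t → t ≤ T → s ≤ t' → t' ≤ T →
      ‖h t s x - h t' s x‖ ≤ K' * ω |t - t'| * (1 + ‖x‖)) (m : ℕ) :
    (∀ x : ℝ → E, Continuous x → ContinuousOn (fun t => ∫ s in Ioc 0 t, k (t - s) • h t s (x s)) (Icc 0 T)) ∧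
    (∀ (x y : ℝ → E) (D : ℝ), Continuous x → Continuous y → 0 ≤ D →
      (∀ s ∈ Icc 0 T, ‖x s - y s‖ ≤ Real.exp (m * s) * D) → ∀ t ∈ Icc 0 T,
      ‖(∫ s in Ioc 0 t, k (t - s) • h t s (x s)) - ∫ s in Ioc 0 t, k (t - s) • h t s (y s)‖ ≤
      Real.exp (m * t) * ((eLpNorm (fun τ => k τ * Real.exp (-(m * τ))) q (volume.restrict (Ioo 0 T))).toReal *
        (eLpNorm K r (volume.restrict (Ioo 0 T))).toReal * D)) ∧
    (∀ t ∈ Icc 0 T, ‖∫ s in Ioc 0 t, k (t - s) • h t s 0‖ ≤ (eLpNorm k q (volume.restrict (Ioo 0 T))).toReal *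
        (eLpNorm K₀ r (volume.restrict (Ioo 0 T))).toReal) := by
  have hsm : ∀ (x : ℝ → E), Continuous x → ∀ t, StronglyMeasurable fun s => h t s (x s) := by
    intro x hx t
    exact (hmeas.comp (measurable_const.prodMk (measurable_id.prodMk hx.measurable))).stronglyMeasurable
  have hbd : ∀ (x : ℝ → E), Continuous x → ∃ B, 0 ≤ B ∧ ∀ s ∈ Icc 0 T, ‖x s‖ ≤ B := by
    intro x hx
    obtain ⟨B, hB⟩ := isCompact_Icc.exists_bound_of_continuousOn (s := Icc 0 T) hx.continuousOn
    exact ⟨max B 0, le_max_right _ _, fun s hs => (hB s hs).trans (le_max_left _ _)⟩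
  have hgr : ∀ (x : ℝ → E) (B : ℝ), (∀ s ∈ Icc 0 T, ‖x s‖ ≤ B) → ∀ t s, 0 ≤ s → s ≤ t → t ≤ T →
      ‖h t s (x s)‖ ≤ K₀ s + B * K s := by
    intro x B hB t s h1 h2 h3
    have a := hlip t s (x s) 0 h1 h2 h3
    have b := hzero t s h1 h2 h3
    have c := norm_le_norm_add_norm_sub (h t s 0) (h t s (x s))
    have e := mul_le_mul_of_nonneg_left (hB s ⟨h1, h2.trans h3⟩) (hK0 s)
    rw [sub_zero] at a
    rw [norm_sub_rev] at a
    first | linarith | (rw [norm_sub_rev] at c; linarith)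
  refine ⟨?_, ?_, ?_⟩
  · intro x hx
    obtain ⟨B, hB0, hB⟩ := hbd x hx
    refine vw_cont (H := fun s => K₀ s + B * K s) (F := fun t s => h t s (x s)) hq0 hqt hr1 hk hkc hkm hk0 hkM
      (fun s => add_nonneg (hK₀0 s) (mul_nonneg hB0 (hK0 s))) (hK₀.add (hK.const_mul B)) (hsm x hx) (hgr x B hB) ?_
    intro s t hs hst htT
    change Filter.Tendsto _ _ _
    rw [tendsto_iff_norm_sub_tendsto_zero]
    have h1 : Filter.Tendsto (fun t' => |t' - t|) (nhdsWithin t (Icc s T)) (nhdsWithin 0 (Ici 0)) := by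
      refine tendsto_nhdsWithin_iff.2 ⟨?_, Filter.Eventually.of_forall fun _ => mem_Ici.2 (abs_nonneg _)⟩
      have : Continuous fun t' => |t' - t| := by fun_prop
      have h := this.tendsto t
      rw [sub_self, abs_zero] at h
      exact h.mono_left nhdsWithin_le_nhds
    have h2 := hω_cont.tendsto.comp h1
    rw [hω0] at h2
    have h3 : Filter.Tendsto (fun t' => K' * ω |t' - t| * (1 + ‖x s‖)) (nhdsWithin t (Icc s T)) (nhds 0) := by
      simpa using (h2.const_mul K').mul_const (1 + ‖x s‖)
    refine squeeze_zero' (Filter.Eventually.of_forall fun _ => norm_nonneg _) ?_ h3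
    filter_upwards [self_mem_nhdsWithin] with t' ht'
    exact ht t' t s (x s) hs.le ht'.1 ht'.2 hst.le htT
  · intro x y D hx hy hD hxy t htT
    obtain ⟨B, hB0, hB⟩ := hbd x hx
    obtain ⟨B', hB0', hB'⟩ := hbd y hy
    refine vw_diff (H := fun s => K₀ s + max B B' * K s) htT.2 m hk ((vw_decay hq0 hqt hk).1 m)
      (hK₀.add (hK.const_mul _)) hK (hsm x hx t) (hsm y hy t) ?_ ?_ hD ?_
    · intro s hs
      exact hgr x _ (fun s hs => (hB s hs).trans (le_max_left _ _)) t s hs.1.le hs.2.le htT.2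
    · intro s hs
      exact hgr y _ (fun s hs => (hB' s hs).trans (le_max_right _ _)) t s hs.1.le hs.2.le htT.2
    · intro s hs
      refine (hlip t s (x s) (y s) hs.1.le hs.2.le htT.2).trans ?_
      have := mul_le_mul_of_nonneg_left (hxy s ⟨hs.1.le, hs.2.le.trans htT.2⟩) (hK0 s)
      linarith
  · intro t htT
    rw [integral_Ioc_eq_integral_Ioo]
    exact (vw_holder htT.2 hk hK₀ (hsm (fun _ => 0) continuous_const t).aestronglyMeasurable
      fun s hs => hzero t s hs.1.le hs.2.le htT.2).2

theorem vw_memLp {T r r' : ℝ} (hr : 0 < r) (hrr : r ≤ r') {K : ℝ → ℝ} (h0 : ∀ s, 0 ≤ K s) (hm : Measurable K)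
    (hK : IntegrableOn (fun s => K s ^ r') (Ioc 0 T)) :
    MemLp K (ENNReal.ofReal r) (volume.restrict (Ioo 0 T)) := by
  have hr' : 0 < r' := hr.trans_le hrr
  have h1 : MemLp K (ENNReal.ofReal r') (volume.restrict (Ioo 0 T)) := by
    rw [← integrable_norm_rpow_iff hm.aestronglyMeasurable (by simpa using hr') ENNReal.ofReal_ne_top,
      ENNReal.toReal_ofReal hr'.le]
    refine (hK.mono_set Ioo_subset_Ioc_self).congr (ae_of_all _ fun s => ?_)
    simp [abs_of_nonneg (h0 s)]
  exact h1.mono_exponent (ENNReal.ofReal_le_ofReal hrr)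

theorem vw_kernel {T α q : ℝ} (hq : 0 < q) (hαq : -1 < (α - 1) * q) :
    MemLp (fun τ : ℝ => τ ^ (α - 1)) (ENNReal.ofReal q) (volume.restrict (Ioo 0 T)) := by
  have hm : Measurable fun τ : ℝ => τ ^ (α - 1) := by fun_prop
  rw [← integrable_norm_rpow_iff hm.aestronglyMeasurable (by simpa using hq) ENNReal.ofReal_ne_top,
      ENNReal.toReal_ofReal hq.le]
  have h : IntegrableOn (fun τ : ℝ => τ ^ ((α - 1) * q)) (Ioo 0 T) :=
    ((intervalIntegral.intervalIntegrable_rpow' (a := 0) (b := T) hαq).1).mono_set Ioo_subset_Ioc_self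
  refine Integrable.congr h ?_
  filter_upwards [ae_restrict_mem measurableSet_Ioo] with τ hτ
  rw [Real.norm_of_nonneg (Real.rpow_nonneg hτ.1.le _), Real.rpow_mul hτ.1.le]

/-- under Assumption A, the state equation admits, for every
`(x₀,u) ∈ ℝⁿ × 𝒰ᵖ[0,T]`, a unique solution in `C([0,T];ℝⁿ)`, and there is a constant `C ≥ 0`
(independent of `(x₀,u)`) such that `‖x(·;x₀,u)‖_{Lᵖ} ≤ C (1 + |x₀| + ‖ρ(u(·),u₀)‖_{Lᵖ})`. -/
theorem volterra_wellposedness_and_estimate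
    {n d : ℕ} (T : ℝ) (hT : 0 < T) (α : ℝ) (hα : α ∈ Set.Ioo (0:ℝ) 1)
    (p : ℝ) (hp1 : 1 ≤ p) (hp : 1 / α < p)
    (U : Set (Euc d)) (u₀ : Euc d) (hu₀U : u₀ ∈ U)
    (f g : ℝ → ℝ → Euc n → Euc d → Euc n)
    (hf_meas : Measurable fun q : ℝ × ℝ × Euc n × Euc d => f q.1 q.2.1 q.2.2.1 q.2.2.2)
    (hg_meas : Measurable fun q : ℝ × ℝ × Euc n × Euc d => g q.1 q.2.1 q.2.2.1 q.2.2.2)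
    -- Assumption A: continuity in the outer time variable
    (K' : ℝ) (hK'0 : 0 ≤ K')
    (ω : ℝ → ℝ) (hω_incr : MonotoneOn ω (Set.Ici 0)) (hω_nonneg : ∀ r, 0 ≤ ω r)
    (hω0 : ω 0 = 0) (hω_cont : ContinuousWithinAt ω (Set.Ici 0) 0)
    (hA_t : ∀ t t' s : ℝ, 0 ≤ s → s ≤ t → t ≤ T → s ≤ t' → t' ≤ T →
      ∀ (x : Euc n) (u : Euc d), u ∈ U →
        ‖f t s x u - f t' s x u‖ + ‖g t s x u - g t' s x u‖ ≤ K' * ω |t - t'| * (1 + ‖x‖))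
    -- Assumption A: Lipschitz-type conditions
    (K₀ K : ℝ → ℝ) (hK₀_nonneg : ∀ s, 0 ≤ K₀ s) (hK_nonneg : ∀ s, 0 ≤ K s)
    (hK₀_meas : Measurable K₀) (hK_meas : Measurable K)
    (r₀ : ℝ) (hr₀ : 1 / α < r₀) (hK₀_L : IntegrableOn (fun s => K₀ s ^ r₀) (Set.Ioc 0 T))
    (r₁ : ℝ) (hr₁ : p / (α * p - 1) < r₁) (hK_L : IntegrableOn (fun s => K s ^ r₁) (Set.Ioc 0 T))
    (hA_lip : ∀ t s : ℝ, 0 ≤ s → s ≤ t → t ≤ T →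
      ∀ (x x' : Euc n) (u u' : Euc d), u ∈ U → u' ∈ U →
        ‖f t s x u - f t s x' u'‖ + ‖g t s x u - g t s x' u'‖ ≤ K s * (‖x - x'‖ + ‖u - u'‖))
    (hA_zero : ∀ t s : ℝ, 0 ≤ s → s ≤ t → t ≤ T → ∀ u : Euc d, u ∈ U →
      ‖f t s 0 u‖ + ‖g t s 0 u‖ ≤ K₀ s) :
    ∃ C : ℝ, 0 ≤ C ∧
      ∀ (x₀ : Euc n) (u : ℝ → Euc d), Admissible T p U u₀ u →
        ∃ x : ℝ → Euc n,
          ContinuousOn x (Set.Icc 0 T) ∧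
          IsSolution T α f g x₀ u x ∧
          (∀ y : ℝ → Euc n, ContinuousOn y (Set.Icc 0 T) → IsSolution T α f g x₀ u y →
            Set.EqOn y x (Set.Icc 0 T)) ∧
          (∫ t in Set.Ioc 0 T, ‖x t‖ ^ p) ^ (1 / p)
            ≤ C * (1 + ‖x₀‖ + (∫ t in Set.Ioc 0 T, ‖u t - u₀‖ ^ p) ^ (1 / p)) := by
  obtain ⟨hα0, hα1⟩ := hα
  have hαp : 1 < α * p := by
    rw [div_lt_iff₀ hα0] at hp; linarith
  have hr₁' : 1 / α < r₁ := by
    refine lt_trans ?_ hr₁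
    rw [div_lt_div_iff₀ hα0 (by linarith)]
    linarith
  obtain ⟨r, hr, hrr0, hrr1⟩ : ∃ r, 1 / α < r ∧ r ≤ r₀ ∧ r ≤ r₁ :=
    ⟨min r₀ r₁, lt_min hr₀ hr₁', min_le_left _ _, min_le_right _ _⟩
  have h1α : 1 < 1 / α := by rw [lt_div_iff₀ hα0]; linarith
  have hr1 : 1 < r := h1α.trans hr
  have hr0 : 0 < r := by linarith
  have hconj : Real.HolderConjugate (Real.conjExponent r) r := (Real.HolderConjugate.conjExponent hr1).symm
  obtain ⟨q, hqdef⟩ : ∃ q, q = Real.conjExponent r := ⟨_, rfl⟩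
  rw [← hqdef] at hconj
  have hq0 : 0 < q := hconj.pos
  have hαq : -1 < (α - 1) * q := by
    have e := hconj.inv_add_inv_eq_one
    have e2 : r⁻¹ < α := by
      rw [inv_lt_comm₀ hr0 hα0]; simpa using hr
    have e3 : (1 - α) < q⁻¹ := by linarith
    have e4 := mul_lt_mul_of_pos_right e3 hq0
    rw [inv_mul_cancel₀ hq0.ne'] at e4
    linarith
  haveI : ENNReal.HolderConjugate (ENNReal.ofReal q) (ENNReal.ofReal r) := hconj.ennrealOfReal
  have hQ0 : ENNReal.ofReal q ≠ 0 := by simpa using hq0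
  have hQt : ENNReal.ofReal q ≠ ⊤ := ENNReal.ofReal_ne_top
  have hR1 : 1 ≤ ENNReal.ofReal r := by simpa using hr1.le
  have hK₀L := vw_memLp hr0 hrr0 hK₀_nonneg hK₀_meas hK₀_L
  have hKL := vw_memLp hr0 hrr1 hK_nonneg hK_meas hK_L
  have hk1 := vw_kernel (T := T) hq0 hαq
  have hk2 : MemLp (fun _ : ℝ => (1 : ℝ)) (ENNReal.ofReal q) (volume.restrict (Ioo 0 T)) := memLp_const 1
  have l1 := (vw_decay hQ0 hQt hk1).2
  have l2 := (vw_decay hQ0 hQt hk2).2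
  have l3 := ((l1.add l2).mul_const ((eLpNorm K (ENNReal.ofReal r) (volume.restrict (Ioo 0 T))).toReal))
  rw [add_zero, zero_mul] at l3
  obtain ⟨m, hm⟩ := (l3.eventually (gt_mem_nhds (show (0 : ℝ) < 1 / 2 by norm_num))).exists
  obtain ⟨C₀, hC₀⟩ : ∃ C₀, C₀ = (eLpNorm (fun τ : ℝ => τ ^ (α - 1)) (ENNReal.ofReal q) (volume.restrict (Ioo 0 T))).toReal *
        (eLpNorm K₀ (ENNReal.ofReal r) (volume.restrict (Ioo 0 T))).toReal +
      (eLpNorm (fun _ : ℝ => (1 : ℝ)) (ENNReal.ofReal q) (volume.restrict (Ioo 0 T))).toReal *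
        (eLpNorm K₀ (ENNReal.ofReal r) (volume.restrict (Ioo 0 T))).toReal := ⟨_, rfl⟩
  have hC₀0 : 0 ≤ C₀ := by rw [hC₀]; positivity
  have hp0 : 0 < p := by linarith
  refine ⟨T ^ (1 / p) * (Real.exp (m * T) * (2 * (1 + C₀))), by positivity, ?_⟩
  rintro x₀ u ⟨hum, huU, -⟩
  obtain ⟨f1, f2, f3⟩ := vw_single (h := fun t s x => f t s x (u s)) hQ0 hQt hR1 hk1
    (fun τ hτ => (Real.continuousAt_rpow_const τ _ (Or.inl (ne_of_gt hτ))).continuousWithinAt)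
    (by fun_prop) (fun τ hτ => Real.rpow_nonneg hτ.le _) (M := T ^ α) (by
      intro τ hτ
      have : τ * τ ^ (α - 1) = τ ^ α := by
        rw [Real.rpow_sub_one hτ.1.ne']; field_simp [hτ.1.ne']
      rw [this]
      exact Real.rpow_le_rpow hτ.1.le hτ.2.le hα0.le)
    hK₀_nonneg hK_nonneg hK₀L hKL hK'0 hω_nonneg hω0 hω_cont
    (hf_meas.comp (measurable_fst.prodMk (measurable_snd.fst.prodMk
      (measurable_snd.snd.prodMk (hum.comp measurable_snd.fst)))))
    (fun t s x x' h1 h2 h3 => by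
      have a := hA_lip t s h1 h2 h3 x x' (u s) (u s) (huU s) (huU s)
      rw [sub_self, norm_zero, add_zero] at a
      exact (le_add_of_nonneg_right (norm_nonneg _)).trans a)
    (fun t s h1 h2 h3 => (le_add_of_nonneg_right (norm_nonneg _)).trans (hA_zero t s h1 h2 h3 (u s) (huU s)))
    (fun t t' s x h1 h2 h3 h4 h5 => (le_add_of_nonneg_right (norm_nonneg _)).trans
      (hA_t t t' s h1 h2 h3 h4 h5 x (u s) (huU s))) m
  obtain ⟨g1, g2, g3⟩ := vw_single (h := fun t s x => g t s x (u s)) hQ0 hQt hR1 hk2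
    continuousOn_const measurable_const (fun τ hτ => zero_le_one) (M := T) (by
      intro τ hτ
      simpa using hτ.2.le)
    hK₀_nonneg hK_nonneg hK₀L hKL hK'0 hω_nonneg hω0 hω_cont
    (hg_meas.comp (measurable_fst.prodMk (measurable_snd.fst.prodMk
      (measurable_snd.snd.prodMk (hum.comp measurable_snd.fst)))))
    (fun t s x x' h1 h2 h3 => by
      have a := hA_lip t s h1 h2 h3 x x' (u s) (u s) (huU s) (huU s)
      rw [sub_self, norm_zero, add_zero] at a
      exact (le_add_of_nonneg_left (norm_nonneg _)).trans a)
    (fun t s h1 h2 h3 => (le_add_of_nonneg_left (norm_nonneg _)).trans (hA_zero t s h1 h2 h3 (u s) (huU s)))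
    (fun t t' s x h1 h2 h3 h4 h5 => (le_add_of_nonneg_left (norm_nonneg _)).trans
      (hA_t t t' s h1 h2 h3 h4 h5 x (u s) (huU s))) m
  simp only [one_smul] at g1 g2 g3
  obtain ⟨x, hxc, hxs, hxu, hxb⟩ := vw_fixed hT
    (fun (x : ℝ → Euc n) (t : ℝ) => x₀ + (∫ s in Set.Ioc 0 t, ((t - s) ^ (α - 1)) • f t s (x s) (u s))
        + ∫ s in Set.Ioc 0 t, g t s (x s) (u s)) m (B := ‖x₀‖ + C₀)
    (fun x hx => (continuousOn_const.add (f1 x hx)).add (g1 x hx))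
    (by
      intro x y D hx hy hD hxy t ht
      have a := f2 x y D hx hy hD hxy t ht
      have b := g2 x y D hx hy hD hxy t ht
      rw [add_sub_add_comm, add_sub_add_left_eq_sub]
      refine (norm_add_le _ _).trans ((add_le_add a b).trans ?_)
      rw [← mul_add, ← add_mul, ← add_mul]
      gcongr)
    (by
      intro t ht
      have a := f3 t ht
      have b := g3 t ht
      refine (norm_add₃_le).trans ?_
      rw [hC₀, add_assoc]
      exact add_le_add le_rfl (add_le_add a b))
    (by
      intro x y hxy t ht
      have hs : ∀ s ∈ Ioc 0 t, x s = y s := fun s hs => hxy ⟨hs.1.le, hs.2.trans ht.2⟩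
      have a : ∫ s in Set.Ioc 0 t, ((t - s) ^ (α - 1)) • f t s (x s) (u s) =
          ∫ s in Set.Ioc 0 t, ((t - s) ^ (α - 1)) • f t s (y s) (u s) :=
        setIntegral_congr_fun measurableSet_Ioc fun s h => by simp only [hs s h]
      have b : ∫ s in Set.Ioc 0 t, g t s (x s) (u s) = ∫ s in Set.Ioc 0 t, g t s (y s) (u s) :=
        setIntegral_congr_fun measurableSet_Ioc fun s h => by simp only [hs s h]
      simp only [a, b])
  refine ⟨x, hxc, ?_, hxu, ?_⟩
  · refine (ae_restrict_iff' measurableSet_Ioc).2 (ae_of_all _ fun t ht => ?_)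
    exact hxs ⟨ht.1.le, ht.2⟩
  · obtain ⟨A, hA⟩ : ∃ A, A = Real.exp (m * T) * (2 * (‖x₀‖ + C₀)) := ⟨_, rfl⟩
    rw [← hA] at hxb
    have hA0 : 0 ≤ A := by rw [hA]; positivity
    have hI : ∫ t in Set.Ioc 0 T, ‖x t‖ ^ p ≤ T * A ^ p := by
      have h := norm_setIntegral_le_of_norm_le_const (μ := volume) (s := Ioc 0 T) (C := A ^ p)
        (f := fun t => ‖x t‖ ^ p) (by simp) (by
          intro t ht
          rw [Real.norm_of_nonneg (by positivity)]
          exact Real.rpow_le_rpow (norm_nonneg _) (hxb t ⟨ht.1.le, ht.2⟩) hp0.le)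
      refine (le_abs_self _).trans (h.trans (le_of_eq ?_))
      simp [hT.le, mul_comm]
    have hI0 : 0 ≤ ∫ t in Set.Ioc 0 T, ‖x t‖ ^ p := integral_nonneg fun t => by positivity
    have hV0 : 0 ≤ (∫ t in Set.Ioc 0 T, ‖u t - u₀‖ ^ p) ^ (1 / p) :=
      Real.rpow_nonneg (integral_nonneg fun t => by positivity) _
    calc (∫ t in Set.Ioc 0 T, ‖x t‖ ^ p) ^ (1 / p) ≤ (T * A ^ p) ^ (1 / p) :=
          Real.rpow_le_rpow hI0 hI (by positivity)
      _ = T ^ (1 / p) * A := by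
          rw [Real.mul_rpow hT.le (by positivity), ← Real.rpow_mul hA0, mul_one_div_cancel hp0.ne', Real.rpow_one]
      _ ≤ T ^ (1 / p) * (Real.exp (m * T) * (2 * (1 + C₀))) * (1 + ‖x₀‖ + (∫ t in Set.Ioc 0 T, ‖u t - u₀‖ ^ p) ^ (1 / p)) := by
          rw [hA]
          obtain ⟨V, hV⟩ : ∃ V, V = (∫ t in Set.Ioc 0 T, ‖u t - u₀‖ ^ p) ^ (1 / p) := ⟨_, rfl⟩
          rw [← hV] at hV0 ⊢
          have hN := norm_nonneg x₀
          have : ‖x₀‖ + C₀ ≤ (1 + C₀) * (1 + ‖x₀‖ + V) := by nlinarith [mul_nonneg hC₀0 hN, mul_nonneg hC₀0 hV0]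
          calc _ ≤ T ^ (1 / p) * (Real.exp (m * T) * (2 * ((1 + C₀) * (1 + ‖x₀‖ + V)))) := by gcongr
            _ = _ := by ring
end
end

section
/- (Lemma B.1, existence, uniqueness and growth estimate.) Let p ≥ 1 and α ∈ (0,1), and suppose Assumption B holds. Then for every x₀ ∈ Lᵖ([0,T];ℝⁿ) and every u ∈ 𝒰ᵖ[0,T], the generalized Volterra equation x(t) = x₀(t) + ∫₀ᵗ f(t,s,x(s),u(s))/(t−s)^{1−α} ds + ∫₀ᵗ g(t,s,x(s),u(s)) ds, a.e. t ∈ [0,T], admits a unique solution x(·;x₀,u) in Lᵖ([0,T];ℝⁿ), and there is a constant C ≥ 0, independent of (x₀,u), such that ‖x(·;x₀,u)‖_{Lᵖ([0,T];ℝⁿ)} ≤ C(1 + ‖x₀‖_{Lᵖ([0,T];ℝⁿ)} + ‖ρ(u(·),u₀)‖_{Lᵖ([0,T];ℝ)}). -/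
open MeasureTheory Set

noncomputable section

/-- `x` is an `Lᵖ`-solution of the generalized Volterra equation with time-dependent
initial condition `x₀`, control `u`. -/
def IsLpSolution {n d : ℕ} (T α p : ℝ) (f g : ℝ → ℝ → Euc n → Euc d → Euc n)
    (x₀ : ℝ → Euc n) (u : ℝ → Euc d) (x : ℝ → Euc n) : Prop :=
  AEStronglyMeasurable x (volume.restrict (Set.Ioc 0 T)) ∧
  IntegrableOn (fun t => ‖x t‖ ^ p) (Set.Ioc 0 T) ∧
  ∀ᵐ t ∂(volume.restrict (Set.Ioc 0 T)),
    x t = x₀ t + (∫ s in Set.Ioc 0 t, ((t - s) ^ (α - 1)) • f t s (x s) (u s))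
        + ∫ s in Set.Ioc 0 t, g t s (x s) (u s)

section aux
open Filter Topology
open scoped ENNReal

/-- kernel -/
def vker (T α τ : ℝ) : ℝ≥0∞ := (Icc 0 T).indicator (fun τ => ENNReal.ofReal (τ ^ (α - 1) + 1)) τ

/-- weighted kernel -/
def kerW (T α : ℝ) (N : ℕ) (τ : ℝ) : ℝ≥0∞ := ENNReal.ofReal (Real.exp (-(N * τ))) * vker T α τ

/-- Volterra majorant -/
def Vop (T α : ℝ) (K z : ℝ → ℝ≥0∞) (t : ℝ) : ℝ≥0∞ :=
  ∫⁻ s in Ioc 0 T, vker T α (t - s) * (K s * z s)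

def wt (N : ℕ) (t : ℝ) : ℝ≥0∞ := ENNReal.ofReal (Real.exp (-(N * t)))

def wm (T p : ℝ) (N : ℕ) : Measure ℝ :=
  (volume.restrict (Ioc 0 T)).withDensity (fun t => wt N t ^ p)

def GoodK (T α p : ℝ) (K : ℝ → ℝ≥0∞) : Prop :=
  ∃ B : ℕ → ℝ≥0∞, (∀ N, B N ≠ ∞) ∧ Tendsto B atTop (𝓝 0) ∧
    ∀ N, ∀ z : ℝ → ℝ≥0∞, Measurable z →
      ∫⁻ t, (Vop T α K z t) ^ p ∂(wm T p N) ≤ B N * ∫⁻ t, (z t) ^ p ∂(wm T p N)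

lemma measurable_ker (T α : ℝ) : Measurable (vker T α) := by
  unfold vker
  exact Measurable.indicator (by fun_prop) measurableSet_Icc

lemma measurable_kerW (T α : ℝ) (N : ℕ) : Measurable (kerW T α N) := by
  unfold kerW
  exact Measurable.mul (by fun_prop) (measurable_ker T α)

lemma measurable_wt (N : ℕ) : Measurable (wt N) := by
  unfold wt
  fun_prop

lemma measurable_Vop (T α : ℝ) {K z : ℝ → ℝ≥0∞} (hK : Measurable K) (hz : Measurable z) :
    Measurable (Vop T α K z) := by
  unfold Vop
  apply Measurable.lintegral_prod_right' (f := fun q : ℝ × ℝ => vker T α (q.1 - q.2) * (K q.2 * z q.2))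
  exact ((measurable_ker T α).comp (by fun_prop)).mul (by fun_prop)

lemma lintegral_wm (T p : ℝ) (hp : 0 ≤ p) (N : ℕ) {h : ℝ → ℝ≥0∞} (hh : Measurable h) :
    ∫⁻ t, h t ^ p ∂(wm T p N) = ∫⁻ t in Ioc 0 T, (wt N t * h t) ^ p := by
  unfold wm
  rw [lintegral_withDensity_eq_lintegral_mul _ ((measurable_wt N).pow_const p) (hh.pow_const p)]
  refine lintegral_congr fun t => ?_
  simp [ENNReal.mul_rpow_of_nonneg _ _ hp]

lemma wt_ker (T α : ℝ) (N : ℕ) (t s : ℝ) :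
    wt N t * vker T α (t - s) = kerW T α N (t - s) * wt N s := by
  unfold wt kerW
  have : Real.exp (-(N * t)) = Real.exp (-(N * (t - s))) * Real.exp (-(N * s)) := by
    rw [← Real.exp_add]; ring_nf
  rw [this, ENNReal.ofReal_mul (Real.exp_pos _).le]
  ring

lemma wt_Vop (T α : ℝ) (N : ℕ) {K z : ℝ → ℝ≥0∞} (hK : Measurable K) (hz : Measurable z) (t : ℝ) :
    wt N t * Vop T α K z t
      = ∫⁻ s in Ioc 0 T, kerW T α N (t - s) * (K s * (wt N s * z s)) := by
  unfold Vop
  rw [← lintegral_const_mul]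
  · refine lintegral_congr fun s => ?_
    rw [← mul_assoc, wt_ker]
    ring
  · exact ((measurable_ker T α).comp (by fun_prop)).mul (by fun_prop)

lemma ker_le (T α : ℝ) (hα : α ∈ Ioo (0:ℝ) 1) (τ : ℝ) (hτ : τ ∈ Ioc 0 T) :
    τ ^ (α - 1) + 1 ≤ (1 + T ^ (1 - α)) * τ ^ (α - 1) := by
  have h1 : τ ^ (1 - α) ≤ T ^ (1 - α) :=
    Real.rpow_le_rpow hτ.1.le hτ.2 (by linarith [hα.2])
  have h2 : τ ^ (1 - α) * τ ^ (α - 1) = 1 := by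
    rw [← Real.rpow_add hτ.1]; simp
  have h3 := Real.rpow_nonneg hτ.1.le (α - 1)
  nlinarith

lemma ker_fin (T α : ℝ) (hT : 0 < T) (hα : α ∈ Ioo (0:ℝ) 1) (m : ℝ) (hm : 0 < m)
    (hm' : -1 < m * (α - 1)) : ∫⁻ τ, vker T α τ ^ m ≠ ∞ := by
  have hI : IntegrableOn (fun τ : ℝ => ((1 + T ^ (1 - α)) ^ m) * τ ^ (m * (α - 1))) (Ioc 0 T) := by
    have := (intervalIntegral.intervalIntegrable_rpow' (a := 0) (b := T) hm').const_mul
      ((1 + T ^ (1 - α)) ^ m)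
    exact (intervalIntegrable_iff_integrableOn_Ioc_of_le hT.le).1 this
  have hle : ∫⁻ τ, vker T α τ ^ m ≤ ∫⁻ τ in Ioc 0 T,
      ENNReal.ofReal (((1 + T ^ (1 - α)) ^ m) * τ ^ (m * (α - 1))) := by
    rw [← lintegral_indicator measurableSet_Ioc]
    apply lintegral_mono_ae
    have : ∀ᵐ τ : ℝ, τ ≠ 0 := by
      simp [ae_iff, measure_singleton]
    filter_upwards [this] with τ hτ
    by_cases h : τ ∈ Icc 0 T
    · have h' : τ ∈ Ioc 0 T := ⟨lt_of_le_of_ne h.1 (Ne.symm hτ), h.2⟩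
      rw [vker, indicator_of_mem h, indicator_of_mem h', ENNReal.ofReal_rpow_of_nonneg _ hm.le]
      · apply ENNReal.ofReal_le_ofReal
        have hT' := Real.rpow_nonneg hT.le (1 - α)
        have h3 := Real.rpow_nonneg h.1 (α - 1)
        calc (τ ^ (α - 1) + 1) ^ m ≤ ((1 + T ^ (1 - α)) * τ ^ (α - 1)) ^ m :=
              Real.rpow_le_rpow (by positivity) (ker_le T α hα τ h') hm.le
          _ = _ := by
              rw [Real.mul_rpow (by positivity) (by positivity), ← Real.rpow_mul h.1, mul_comm m]
      · have h3 := Real.rpow_nonneg h.1 (α - 1)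
        positivity
    · rw [vker, indicator_of_notMem h]
      simp [hm]
  refine ne_top_of_le_ne_top ?_ hle
  exact hI.lintegral_lt_top.ne

lemma kerW_le (T α : ℝ) (N : ℕ) (τ : ℝ) : kerW T α N τ ≤ vker T α τ := by
  unfold kerW
  by_cases h : τ ∈ Icc 0 T
  · have : ENNReal.ofReal (Real.exp (-(N * τ))) ≤ 1 := by
      rw [ENNReal.ofReal_le_one, Real.exp_le_one_iff]
      have := h.1
      have : 0 ≤ N * τ := by positivity
      linarith
    calc _ ≤ 1 * vker T α τ := by gcongr
      _ = _ := one_mul _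
  · simp [vker, h]

lemma kerW_tendsto (T α : ℝ) (hT : 0 < T) (hα : α ∈ Ioo (0:ℝ) 1) (m : ℝ) (hm : 0 < m)
    (hm' : -1 < m * (α - 1)) :
    Tendsto (fun N : ℕ => ∫⁻ τ, kerW T α N τ ^ m) atTop (𝓝 0) := by
  have : (0 : ℝ≥0∞) = ∫⁻ τ : ℝ, 0 := by simp
  rw [this]
  apply tendsto_lintegral_of_dominated_convergence (fun τ => vker T α τ ^ m)
  · intro N; exact (measurable_kerW T α N).pow_const m
  · intro N; filter_upwards with τ
    exact ENNReal.rpow_le_rpow (kerW_le T α N τ) hm.le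
  · exact ker_fin T α hT hα m hm hm'
  · have : ∀ᵐ τ : ℝ, τ ≠ 0 := by
      simp [ae_iff, measure_singleton]
    filter_upwards [this] with τ hτ
    by_cases h : τ ∈ Icc 0 T
    · have h' : 0 < τ := lt_of_le_of_ne h.1 (Ne.symm hτ)
      have h1 : Tendsto (fun N : ℕ => Real.exp (-(N * τ))) atTop (𝓝 0) := by
        apply Real.tendsto_exp_neg_atTop_nhds_zero.comp
        exact tendsto_natCast_atTop_atTop.atTop_mul_const h'
      have h2 := ENNReal.tendsto_ofReal h1
      have h3 : Tendsto (fun N : ℕ => kerW T α N τ) atTop (𝓝 (ENNReal.ofReal 0 * vker T α τ)) := by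
        unfold kerW
        apply ENNReal.Tendsto.mul_const h2
        right
        simp [vker, h]
      have h4 := (ENNReal.continuous_rpow_const (y := m)).tendsto _ |>.comp h3
      simpa [Function.comp_def, hm] using h4
    · simp [kerW, vker, h, hm]

/-- Tonelli bound -/
lemma tonelli_bound (T : ℝ) (k Z : ℝ → ℝ≥0∞) (hk : Measurable k) (hZ : Measurable Z) :
    ∫⁻ t in Ioc 0 T, ∫⁻ s in Ioc 0 T, k (t - s) * Z s ≤ (∫⁻ τ, k τ) * ∫⁻ s in Ioc 0 T, Z s := by
  rw [lintegral_lintegral_swap]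
  · rw [← lintegral_const_mul _ hZ]
    apply lintegral_mono
    intro s
    dsimp only
    rw [lintegral_mul_const]
    · have : ∫⁻ t in Ioc 0 T, k (t - s) ≤ ∫⁻ τ, k τ := by
        calc _ ≤ ∫⁻ t, k (t - s) := setLIntegral_le_lintegral _ _
          _ = _ := lintegral_sub_right_eq_self k s
      exact mul_le_mul' this le_rfl
    · exact hk.comp (by fun_prop)
  · apply Measurable.aemeasurable
    exact Measurable.mul (hk.comp (by fun_prop)) (hZ.comp (by fun_prop))

/-- three-function Hölder, pointwise -/
lemma holder_pt (T p r m : ℝ) (hp : 1 < p) (hr : 1 < r) (hrp : 1 / p + 1 / r ≤ 1)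
    (hm : m * (1 - 1 / r) = 1) (hm0 : 0 < m) (k K z : ℝ → ℝ≥0∞) (hk : Measurable k)
    (hK : Measurable K) (hz : Measurable z) (t : ℝ) :
    (∫⁻ s in Ioc 0 T, k (t - s) * (K s * z s)) ^ p ≤
      (∫⁻ s in Ioc 0 T, k (t - s) ^ m * z s ^ p) * (∫⁻ s in Ioc 0 T, K s ^ r) ^ (p / r) *
        (∫⁻ τ, k τ ^ m) ^ (p * (1 - 1 / p - 1 / r)) := by
  have hp0 : 0 < p := by linarith
  have hr0 : 0 < r := by linarith
  have hθ : 0 ≤ 1 - 1 / p - 1 / r := by linarith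
  set θ := 1 - 1 / p - 1 / r with hθd
  have hkm : Measurable fun s => k (t - s) := hk.comp (by fun_prop)
  have key := ENNReal.lintegral_prod_norm_pow_le (μ := volume.restrict (Ioc 0 T)) (Finset.univ : Finset (Fin 3))
    (f := ![fun s => k (t - s) ^ m * z s ^ p, fun s => K s ^ r, fun s => k (t - s) ^ m])
    (by
      intro i _
      fin_cases i
      · exact ((hkm.pow_const m).mul (hz.pow_const p)).aemeasurable
      · exact (hK.pow_const r).aemeasurable
      · exact (hkm.pow_const m).aemeasurable)
    (p := ![1 / p, 1 / r, θ])
    (by simp [Fin.sum_univ_three, hθd])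
    (by
      intro i _
      fin_cases i
      · simp; positivity
      · simp; positivity
      · exact hθ)
  simp only [Fin.prod_univ_three, Matrix.cons_val_zero, Matrix.cons_val_one, Matrix.cons_val] at key
  have e1 : ∀ s, (k (t - s) ^ m * z s ^ p) ^ (1 / p) * (K s ^ r) ^ (1 / r) * (k (t - s) ^ m) ^ θ
      = k (t - s) * (K s * z s) := by
    intro s
    rw [ENNReal.mul_rpow_of_nonneg _ _ (by positivity), ← ENNReal.rpow_mul, ← ENNReal.rpow_mul,
      ← ENNReal.rpow_mul, ← ENNReal.rpow_mul, mul_one_div_cancel hp0.ne', mul_one_div_cancel hr0.ne',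
      ENNReal.rpow_one, ENNReal.rpow_one]
    calc _ = (k (t - s) ^ (m * (1 / p)) * k (t - s) ^ (m * θ)) * (K s * z s) := by ring
      _ = _ := by
        rw [← ENNReal.rpow_add_of_nonneg _ _ (by positivity) (by positivity)]
        have : m * (1 / p) + m * θ = 1 := by rw [hθd]; linear_combination hm
        rw [this, ENNReal.rpow_one]
  simp_rw [e1] at key
  refine (ENNReal.rpow_le_rpow key hp0.le).trans ?_
  rw [ENNReal.mul_rpow_of_nonneg _ _ hp0.le, ENNReal.mul_rpow_of_nonneg _ _ hp0.le,
    ← ENNReal.rpow_mul, ← ENNReal.rpow_mul, ← ENNReal.rpow_mul, one_div_mul_cancel hp0.ne',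
    ENNReal.rpow_one, one_div_mul_eq_div, mul_comm θ p]
  have : ∫⁻ s in Ioc 0 T, k (t - s) ^ m ≤ ∫⁻ τ, k τ ^ m := by
    calc _ ≤ ∫⁻ s, k (t - s) ^ m := setLIntegral_le_lintegral _ _
      _ = _ := lintegral_sub_left_eq_self (fun τ => k τ ^ m) t
  exact mul_le_mul' le_rfl (ENNReal.rpow_le_rpow this (by positivity))

lemma goodK_of_Lr (T α p r : ℝ) (hT : 0 < T) (hα : α ∈ Ioo (0:ℝ) 1) (hp : 1 < p)
    (hr1 : 1 / α < r) (hr2 : p / (p - 1) < r) (K : ℝ → ℝ≥0∞) (hK : Measurable K)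
    (hKr : ∫⁻ s in Ioc 0 T, K s ^ r ≠ ∞) : GoodK T α p K := by
  have hα0 := hα.1
  have hr : 1 < r := lt_trans (by rw [lt_div_iff₀ hα0]; linarith [hα.2]) hr1
  have hp0 : 0 < p := by linarith
  have hir : 1 / r < α := by
    rw [div_lt_iff₀ (by linarith)]; rw [div_lt_iff₀ hα0] at hr1; linarith
  have hrp : 1 / p + 1 / r ≤ 1 := by
    rw [div_lt_iff₀ (by linarith)] at hr2
    rw [div_add_div _ _ (by positivity) (by positivity), div_le_one (by positivity)]
    nlinarith
  have hi1 : 0 < 1 - 1 / r := by linarith [hα.2]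
  set m := 1 / (1 - 1 / r) with hmd
  have hm0 : 0 < m := by positivity
  have hm : m * (1 - 1 / r) = 1 := by rw [hmd]; exact one_div_mul_cancel hi1.ne'
  have hm' : -1 < m * (α - 1) := by nlinarith
  have hI := kerW_tendsto T α hT hα m hm0 hm'
  have hIf : ∀ N, ∫⁻ τ, kerW T α N τ ^ m ≠ ∞ := fun N =>
    ne_top_of_le_ne_top (ker_fin T α hT hα m hm0 hm')
      (lintegral_mono fun τ => ENNReal.rpow_le_rpow (kerW_le T α N τ) hm0.le)
  have hθ : 0 ≤ p * (1 - 1 / p - 1 / r) := mul_nonneg hp0.le (by linarith)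
  set c := (∫⁻ s in Ioc 0 T, K s ^ r) ^ (p / r) with hc
  have hcf : c ≠ ∞ := ENNReal.rpow_ne_top_of_nonneg (by positivity) hKr
  set e := p * (1 - 1 / p - 1 / r) with he
  refine ⟨fun N => c * (∫⁻ τ, kerW T α N τ ^ m) ^ (e + 1), ?_, ?_, ?_⟩
  · intro N
    exact ENNReal.mul_ne_top hcf (ENNReal.rpow_ne_top_of_nonneg (by positivity) (hIf N))
  · have h1 := ((ENNReal.continuous_rpow_const (y := e + 1)).tendsto _).comp hI
    have h2 := ENNReal.Tendsto.const_mul (a := c) h1 (Or.inr hcf)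
    have : 0 < e + 1 := by positivity
    simpa [Function.comp_def, this] using h2
  · intro N z hz
    have hwz : Measurable fun s => wt N s * z s := (measurable_wt N).mul hz
    rw [lintegral_wm T p hp0.le N (measurable_Vop T α hK hz), lintegral_wm T p hp0.le N hz]
    simp_rw [wt_Vop T α N hK hz]
    have hkW := measurable_kerW T α N
    calc _ ≤ ∫⁻ t in Ioc 0 T, (∫⁻ s in Ioc 0 T, kerW T α N (t - s) ^ m * (wt N s * z s) ^ p) *
          (c * (∫⁻ τ, kerW T α N τ ^ m) ^ e) := by
          apply lintegral_mono
          intro t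
          have := holder_pt T p r m hp hr hrp hm hm0 (kerW T α N) K (fun s => wt N s * z s)
            hkW hK hwz t
          dsimp only
          rw [← mul_assoc]
          exact this
      _ = (∫⁻ t in Ioc 0 T, (∫⁻ s in Ioc 0 T, kerW T α N (t - s) ^ m * (wt N s * z s) ^ p)) *
          (c * (∫⁻ τ, kerW T α N τ ^ m) ^ e) := by
          rw [lintegral_mul_const]
          apply Measurable.lintegral_prod_right'
            (f := fun q : ℝ × ℝ => kerW T α N (q.1 - q.2) ^ m * (wt N q.2 * z q.2) ^ p)
          exact ((hkW.comp (by fun_prop : Measurable fun q : ℝ × ℝ => q.1 - q.2)).pow_const m).mul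
            ((hwz.comp measurable_snd).pow_const p)
      _ ≤ ((∫⁻ τ, kerW T α N τ ^ m) * ∫⁻ s in Ioc 0 T, (wt N s * z s) ^ p) *
          (c * (∫⁻ τ, kerW T α N τ ^ m) ^ e) := by
          gcongr
          exact tonelli_bound T (fun τ => kerW T α N τ ^ m) (fun s => (wt N s * z s) ^ p)
            (hkW.pow_const m) (hwz.pow_const p)
      _ = _ := by
          rw [ENNReal.rpow_add_of_nonneg _ _ hθ zero_le_one, ENNReal.rpow_one]
          ring

lemma goodK_of_bdd (T α p : ℝ) (hT : 0 < T) (hα : α ∈ Ioo (0:ℝ) 1) (hp : 1 ≤ p)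
    (K : ℝ → ℝ≥0∞) (hK : Measurable K) (M : ℝ≥0∞) (hM : M ≠ ∞)
    (hKM : ∀ s ∈ Ioc 0 T, K s ≤ M) : GoodK T α p K := by
  rcases hp.eq_or_lt with rfl | hp
  · have hm' : -1 < 1 * (α - 1) := by linarith [hα.1]
    have hI := kerW_tendsto T α hT hα 1 one_pos hm'
    have hIf : ∀ N, ∫⁻ τ, kerW T α N τ ^ (1:ℝ) ≠ ∞ := fun N =>
      ne_top_of_le_ne_top (ker_fin T α hT hα 1 one_pos hm')
        (lintegral_mono fun τ => ENNReal.rpow_le_rpow (kerW_le T α N τ) zero_le_one)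
    refine ⟨fun N => M * ∫⁻ τ, kerW T α N τ ^ (1:ℝ), fun N => ENNReal.mul_ne_top hM (hIf N), ?_, ?_⟩
    · simpa using ENNReal.Tendsto.const_mul (a := M) hI (Or.inr hM)
    · intro N z hz
      have hwz : Measurable fun s => wt N s * z s := (measurable_wt N).mul hz
      have hkW := measurable_kerW T α N
      rw [lintegral_wm T 1 zero_le_one N (measurable_Vop T α hK hz), lintegral_wm T 1 zero_le_one N hz]
      simp_rw [wt_Vop T α N hK hz, ENNReal.rpow_one]
      calc _ ≤ ∫⁻ t in Ioc 0 T, ∫⁻ s in Ioc 0 T, kerW T α N (t - s) * (M * (wt N s * z s)) := by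
            apply lintegral_mono
            intro t
            apply setLIntegral_mono' measurableSet_Ioc
            intro s hs
            gcongr
            exact hKM s hs
        _ ≤ _ := tonelli_bound T _ _ hkW (hwz.const_mul M)
        _ = _ := by
            rw [lintegral_const_mul _ hwz]; ring
  · set r := max (1 / α) (p / (p - 1)) + 1 with hr
    apply goodK_of_Lr T α p r hT hα hp _ _ K hK
    · have hr0 : 0 ≤ r := by
        have : 0 ≤ 1 / α := by have := hα.1; positivity
        linarith [le_max_left (1 / α) (p / (p - 1))]
      refine ne_top_of_le_ne_top (b := ∫⁻ s in Ioc 0 T, M ^ r) ?_ ?_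
      · rw [setLIntegral_const]
        exact ENNReal.mul_ne_top (ENNReal.rpow_ne_top_of_nonneg hr0 hM) (by simp)
      · apply setLIntegral_mono' measurableSet_Ioc
        intro s hs
        exact ENNReal.rpow_le_rpow (hKM s hs) hr0
    · linarith [le_max_left (1 / α) (p / (p - 1))]
    · linarith [le_max_right (1 / α) (p / (p - 1))]

lemma wt_le_one {T : ℝ} (N : ℕ) {t : ℝ} (ht : t ∈ Ioc 0 T) : wt N t ≤ 1 := by
  unfold wt
  rw [ENNReal.ofReal_le_one, Real.exp_le_one_iff]
  have := ht.1
  have : 0 ≤ N * t := by positivity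
  linarith

lemma lintegral_wm_le (T p : ℝ) (hp : 0 ≤ p) (N : ℕ) (h : ℝ → ℝ≥0∞) :
    ∫⁻ t, h t ∂(wm T p N) ≤ ∫⁻ t in Ioc 0 T, h t := by
  have : wm T p N ≤ volume.restrict (Ioc 0 T) := by
    unfold wm
    conv_rhs => rw [← withDensity_one (μ := volume.restrict (Ioc 0 T))]
    apply withDensity_mono
    filter_upwards [ae_restrict_mem measurableSet_Ioc] with t ht
    exact ENNReal.rpow_le_one (wt_le_one N ht) hp
  exact lintegral_mono' this le_rfl

lemma K0_bound (T α p r₀ : ℝ) (hT : 0 < T) (hα : α ∈ Ioo (0:ℝ) 1) (hp : 1 ≤ p)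
    (hr₀ : max (p / (1 + α * p)) 1 < r₀) (K₀ : ℝ → ℝ≥0∞) (hK₀ : Measurable K₀)
    (hf : ∫⁻ s in Ioc 0 T, K₀ s ^ r₀ ≠ ∞) (N : ℕ) :
    ∫⁻ t, (Vop T α K₀ 1 t) ^ p ∂(wm T p N) ≠ ∞ := by
  have hp0 : 0 < p := by linarith
  have hα0 := hα.1
  have h1 : p / (1 + α * p) < r₀ := (le_max_left _ _).trans_lt hr₀
  have h2 : 1 < r₀ := (le_max_right _ _).trans_lt hr₀
  have hr0 : 0 < r₀ := by linarith
  suffices h : ∃ K z : ℝ → ℝ≥0∞, Measurable z ∧ GoodK T α p K ∧ (∀ s, K₀ s * 1 = K s * z s) ∧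
      ∫⁻ s in Ioc 0 T, z s ^ p ≠ ∞ by
    obtain ⟨K, z, hz, ⟨B, hB, -, hV⟩, he, hzf⟩ := h
    have : Vop T α K₀ 1 = Vop T α K z := by
      funext t
      unfold Vop
      refine lintegral_congr fun s => ?_
      rw [← he s]; rfl
    rw [this]
    refine ne_top_of_le_ne_top ?_ (hV N z hz)
    exact ENNReal.mul_ne_top (hB N) (ne_top_of_le_ne_top hzf (lintegral_wm_le T p hp0.le N _))
  by_cases hc : p ≤ r₀
  · refine ⟨1, K₀, hK₀, goodK_of_bdd T α p hT hα hp 1 measurable_one 1 (by simp) (by simp), by simp, ?_⟩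
    refine ne_top_of_le_ne_top (b := ∫⁻ s in Ioc 0 T, (1 + K₀ s ^ r₀)) ?_ ?_
    · rw [lintegral_add_left measurable_const, setLIntegral_const]
      exact ENNReal.add_ne_top.2 ⟨by simp, hf⟩
    · apply lintegral_mono
      intro s
      rcases le_total (K₀ s) 1 with h | h
      · exact (ENNReal.rpow_le_one h hp0.le).trans le_self_add
      · exact (ENNReal.rpow_le_rpow_of_exponent_le h hc).trans le_add_self
  · push Not at hc
    have hq : 0 < 1 - r₀ / p := by
      have : r₀ / p < 1 := by rw [div_lt_one hp0]; exact hc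
      linarith
    refine ⟨fun s => K₀ s ^ (1 - r₀ / p), fun s => K₀ s ^ (r₀ / p), hK₀.pow_const _, ?_, ?_, ?_⟩
    · apply goodK_of_Lr T α p (r₀ / (1 - r₀ / p)) hT hα (by linarith) _ _ _ (hK₀.pow_const _)
      · simp_rw [← ENNReal.rpow_mul]
        rwa [mul_div_cancel₀ _ hq.ne']
      · rw [div_lt_div_iff₀ hα0 hq]
        rw [div_lt_iff₀ (by positivity)] at h1
        have : r₀ / p * p = r₀ := by field_simp
        nlinarith
      · have hpm : 0 < p - 1 := by linarith
        rw [div_lt_div_iff₀ hpm hq]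
        have : r₀ / p * p = r₀ := by field_simp
        nlinarith
    · intro s
      rw [← ENNReal.rpow_add_of_nonneg _ _ hq.le (by positivity)]
      simp
    · simp_rw [← ENNReal.rpow_mul]
      rwa [div_mul_cancel₀ _ hp0.ne']

section core

variable {E : Type*} [NormedAddCommGroup E] [NormedSpace ℝ E]

def Phi (α : ℝ) (f g : ℝ → ℝ → E → E) (x₀ x : ℝ → E) (t : ℝ) : E :=
  x₀ t + (∫ s in Ioc 0 t, ((t - s) ^ (α - 1)) • f t s (x s)) + ∫ s in Ioc 0 t, g t s (x s)

lemma vker_bound (T α : ℝ) {t : ℝ} (ht : t ∈ Ioc 0 T) (a b : ℝ → E) (h : ℝ → ℝ≥0∞)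
    (hab : ∀ s ∈ Ioc 0 t, ‖a s‖ₑ + ‖b s‖ₑ ≤ h s) :
    (∫⁻ s in Ioc 0 t, ‖((t - s) ^ (α - 1)) • a s‖ₑ) + ∫⁻ s in Ioc 0 t, ‖b s‖ₑ
      ≤ ∫⁻ s in Ioc 0 T, vker T α (t - s) * h s := by
  refine (le_lintegral_add _ _).trans ?_
  refine le_trans ?_ (lintegral_mono_set (Ioc_subset_Ioc_right ht.2))
  apply setLIntegral_mono' measurableSet_Ioc
  intro s hs
  have hmem : t - s ∈ Icc 0 T := ⟨by linarith [hs.2], by linarith [hs.1, ht.2]⟩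
  rw [vker, indicator_of_mem hmem]
  have h0 : 0 ≤ (t - s) ^ (α - 1) := Real.rpow_nonneg hmem.1 _
  rw [enorm_smul, Real.enorm_eq_ofReal h0]
  calc _ ≤ ENNReal.ofReal ((t - s) ^ (α - 1) + 1) * ‖a s‖ₑ
        + ENNReal.ofReal ((t - s) ^ (α - 1) + 1) * ‖b s‖ₑ := by
        gcongr
        · linarith
        · conv_lhs => rw [← one_mul ‖b s‖ₑ]
          gcongr
          rw [ENNReal.one_le_ofReal]
          linarith
    _ = ENNReal.ofReal ((t - s) ^ (α - 1) + 1) * (‖a s‖ₑ + ‖b s‖ₑ) := by ring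
    _ ≤ _ := by gcongr; exact hab s hs

lemma lintegral_vker_add (T α : ℝ) (t : ℝ) {K₀ K z : ℝ → ℝ≥0∞} (hK₀ : Measurable K₀) :
    ∫⁻ s in Ioc 0 T, vker T α (t - s) * (K₀ s * 1 + K s * z s)
      = Vop T α K₀ 1 t + Vop T α K z t := by
  unfold Vop
  rw [← lintegral_add_left]
  · refine lintegral_congr fun s => ?_
    rw [mul_add]; rfl
  · exact ((measurable_ker T α).comp (by fun_prop)).mul (by fun_prop)

lemma Phi_sub_le (T α : ℝ) (f g : ℝ → ℝ → E → E) (K₀ K : ℝ → ℝ≥0∞) (hK₀ : Measurable K₀)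
    (hG : ∀ t s, 0 < s → s ≤ t → t ≤ T → ∀ x,
      ‖f t s x‖ₑ + ‖g t s x‖ₑ ≤ K₀ s * 1 + K s * ‖x‖ₑ)
    (x₀ x : ℝ → E) {t : ℝ} (ht : t ∈ Ioc 0 T) :
    ‖Phi α f g x₀ x t - x₀ t‖ₑ ≤ Vop T α K₀ 1 t + Vop T α K (fun s => ‖x s‖ₑ) t := by
  have h := vker_bound T α ht (fun s => f t s (x s)) (fun s => g t s (x s)) _
    (fun s hs => hG t s hs.1 hs.2 ht.2 (x s))
  rw [lintegral_vker_add T α t hK₀] at h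
  refine le_trans ?_ h
  have e : Phi α f g x₀ x t - x₀ t = (∫ s in Ioc 0 t, ((t - s) ^ (α - 1)) • f t s (x s))
      + ∫ s in Ioc 0 t, g t s (x s) := by
    unfold Phi; abel
  rw [e]
  exact (enorm_add_le _ _).trans
    (add_le_add (enorm_integral_le_lintegral_enorm _) (enorm_integral_le_lintegral_enorm _))

variable [MeasurableSpace E] [BorelSpace E] [SecondCountableTopology E]

lemma Phi_integrable (T α : ℝ) (f g : ℝ → ℝ → E → E) (K₀ K : ℝ → ℝ≥0∞) (hK₀ : Measurable K₀)
    (hf : Measurable fun q : ℝ × ℝ × E => f q.1 q.2.1 q.2.2)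
    (hg : Measurable fun q : ℝ × ℝ × E => g q.1 q.2.1 q.2.2)
    (hG : ∀ t s, 0 < s → s ≤ t → t ≤ T → ∀ x,
      ‖f t s x‖ₑ + ‖g t s x‖ₑ ≤ K₀ s * 1 + K s * ‖x‖ₑ)
    (x : ℝ → E) (hx : Measurable x) {t : ℝ} (ht : t ∈ Ioc 0 T)
    (hfin : Vop T α K₀ 1 t + Vop T α K (fun s => ‖x s‖ₑ) t < ∞) :
    IntegrableOn (fun s => ((t - s) ^ (α - 1)) • f t s (x s)) (Ioc 0 t) ∧
      IntegrableOn (fun s => g t s (x s)) (Ioc 0 t) := by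
  have h := vker_bound T α ht (fun s => f t s (x s)) (fun s => g t s (x s)) _
    (fun s hs => hG t s hs.1 hs.2 ht.2 (x s))
  rw [lintegral_vker_add T α t hK₀] at h
  have hf' : Measurable fun s => f t s (x s) :=
    hf.comp (by fun_prop : Measurable fun s => (t, s, x s))
  have hg' : Measurable fun s => g t s (x s) :=
    hg.comp (by fun_prop : Measurable fun s => (t, s, x s))
  constructor
  · refine ⟨?_, (le_self_add.trans h).trans_lt hfin⟩
    apply Measurable.aestronglyMeasurable
    exact Measurable.smul (by fun_prop) hf'
  · exact ⟨hg'.aestronglyMeasurable, (le_add_self.trans h).trans_lt hfin⟩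

lemma Phi_diff_le (T α : ℝ) (f g : ℝ → ℝ → E → E) (K₀ K : ℝ → ℝ≥0∞) (hK₀ : Measurable K₀)
    (hf : Measurable fun q : ℝ × ℝ × E => f q.1 q.2.1 q.2.2)
    (hg : Measurable fun q : ℝ × ℝ × E => g q.1 q.2.1 q.2.2)
    (hG : ∀ t s, 0 < s → s ≤ t → t ≤ T → ∀ x,
      ‖f t s x‖ₑ + ‖g t s x‖ₑ ≤ K₀ s * 1 + K s * ‖x‖ₑ)
    (hL : ∀ t s, 0 < s → s ≤ t → t ≤ T → ∀ x x',
      ‖f t s x - f t s x'‖ₑ + ‖g t s x - g t s x'‖ₑ ≤ K s * ‖x - x'‖ₑ)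
    (x₀ x y : ℝ → E) (hx : Measurable x) (hy : Measurable y) {t : ℝ} (ht : t ∈ Ioc 0 T)
    (hfx : Vop T α K₀ 1 t + Vop T α K (fun s => ‖x s‖ₑ) t < ∞)
    (hfy : Vop T α K₀ 1 t + Vop T α K (fun s => ‖y s‖ₑ) t < ∞) :
    ‖Phi α f g x₀ x t - Phi α f g x₀ y t‖ₑ ≤ Vop T α K (fun s => ‖x s - y s‖ₑ) t := by
  obtain ⟨h1, h2⟩ := Phi_integrable T α f g K₀ K hK₀ hf hg hG x hx ht hfx
  obtain ⟨h3, h4⟩ := Phi_integrable T α f g K₀ K hK₀ hf hg hG y hy ht hfy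
  have h := vker_bound T α ht (fun s => f t s (x s) - f t s (y s))
    (fun s => g t s (x s) - g t s (y s)) _
    (fun s hs => hL t s hs.1 hs.2 ht.2 (x s) (y s))
  refine le_trans ?_ h
  have e : Phi α f g x₀ x t - Phi α f g x₀ y t
      = (∫ s in Ioc 0 t, ((t - s) ^ (α - 1)) • (f t s (x s) - f t s (y s)))
      + ∫ s in Ioc 0 t, (g t s (x s) - g t s (y s)) := by
    simp_rw [smul_sub]
    rw [integral_sub h1 h3, integral_sub h2 h4]
    unfold Phi; abel
  rw [e]
  exact (enorm_add_le _ _).trans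
    (add_le_add (enorm_integral_le_lintegral_enorm _) (enorm_integral_le_lintegral_enorm _))

lemma stronglyMeasurable_int (F : ℝ × ℝ → E) (hF : Measurable F) :
    StronglyMeasurable fun t : ℝ => ∫ s in Ioc 0 t, F (t, s) := by
  have : (fun t : ℝ => ∫ s in Ioc 0 t, F (t, s)) =
      fun t => ∫ s, ({q : ℝ × ℝ | 0 < q.2 ∧ q.2 ≤ q.1}.indicator F) (t, s) := by
    funext t
    rw [← integral_indicator measurableSet_Ioc]
    rfl
  rw [this]
  apply StronglyMeasurable.integral_prod_right'
  apply Measurable.stronglyMeasurable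
  apply hF.indicator
  exact (measurableSet_lt measurable_const measurable_snd).inter
    (measurableSet_le measurable_snd measurable_fst)

lemma Phi_meas (α : ℝ) (f g : ℝ → ℝ → E → E)
    (hf : Measurable fun q : ℝ × ℝ × E => f q.1 q.2.1 q.2.2)
    (hg : Measurable fun q : ℝ × ℝ × E => g q.1 q.2.1 q.2.2)
    (x₀ x : ℝ → E) (hx : Measurable x) (μ : Measure ℝ) (hx₀ : AEStronglyMeasurable x₀ μ) :
    AEStronglyMeasurable (Phi α f g x₀ x) μ := by
  unfold Phi
  refine (hx₀.add ?_).add ?_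
  · apply StronglyMeasurable.aestronglyMeasurable
    apply stronglyMeasurable_int (fun q => (q.1 - q.2) ^ (α - 1) • f q.1 q.2 (x q.2))
    exact Measurable.smul (by fun_prop)
      (hf.comp (by fun_prop : Measurable fun q : ℝ × ℝ => (q.1, q.2, x q.2)))
  · apply StronglyMeasurable.aestronglyMeasurable
    apply stronglyMeasurable_int (fun q => g q.1 q.2 (x q.2))
    exact hg.comp (by fun_prop : Measurable fun q : ℝ × ℝ => (q.1, q.2, x q.2))

lemma wm_le (T p : ℝ) (hp : 0 ≤ p) (N : ℕ) : wm T p N ≤ volume.restrict (Ioc 0 T) := by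
  unfold wm
  conv_rhs => rw [← withDensity_one (μ := volume.restrict (Ioc 0 T))]
  apply withDensity_mono
  filter_upwards [ae_restrict_mem measurableSet_Ioc] with t ht
  exact ENNReal.rpow_le_one (wt_le_one N ht) hp

lemma wt_pos (N : ℕ) (t : ℝ) : wt N t ≠ 0 := by
  unfold wt
  simp [Real.exp_pos]

lemma wt_fin (N : ℕ) (t : ℝ) : wt N t ≠ ∞ := by
  unfold wt
  simp

lemma le_wm (T p : ℝ) (hp : 0 ≤ p) (N : ℕ) :
    volume.restrict (Ioc 0 T) ≤ ((wt N T ^ p)⁻¹) • wm T p N := by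
  unfold wm
  rw [← withDensity_smul _ ((measurable_wt N).pow_const p)]
  conv_lhs => rw [← withDensity_one (μ := volume.restrict (Ioc 0 T))]
  apply withDensity_mono
  filter_upwards [ae_restrict_mem measurableSet_Ioc] with t ht
  have h1 : wt N T ≤ wt N t := by
    unfold wt
    apply ENNReal.ofReal_le_ofReal
    apply Real.exp_le_exp.2
    have := mul_le_mul_of_nonneg_left ht.2 (Nat.cast_nonneg (α := ℝ) N)
    linarith
  have h2 : wt N T ^ p ≠ 0 := by
    intro h
    rw [ENNReal.rpow_eq_zero_iff] at h
    rcases h with h | h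
    · exact wt_pos N T h.1
    · exact wt_fin N T h.1
  have h3 : wt N T ^ p ≠ ∞ := ENNReal.rpow_ne_top_of_nonneg hp (wt_fin N T)
  simp only [Pi.one_apply, Pi.smul_apply, smul_eq_mul]
  rw [← ENNReal.inv_mul_cancel h2 h3]
  gcongr

lemma core [CompleteSpace E] (T α p : ℝ) (hp : 1 ≤ p)
    (K₀ K : ℝ → ℝ≥0∞) (hK₀ : Measurable K₀) (hK : Measurable K) (hgood : GoodK T α p K)
    (hK₀f : ∀ N, ∫⁻ t, (Vop T α K₀ 1 t) ^ p ∂(wm T p N) ≠ ∞) :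
    ∃ C : ℝ≥0∞, C ≠ ∞ ∧ ∀ f g : ℝ → ℝ → E → E,
      (Measurable fun q : ℝ × ℝ × E => f q.1 q.2.1 q.2.2) →
      (Measurable fun q : ℝ × ℝ × E => g q.1 q.2.1 q.2.2) →
      (∀ t s, 0 < s → s ≤ t → t ≤ T → ∀ x,
        ‖f t s x‖ₑ + ‖g t s x‖ₑ ≤ K₀ s * 1 + K s * ‖x‖ₑ) →
      (∀ t s, 0 < s → s ≤ t → t ≤ T → ∀ x x',
        ‖f t s x - f t s x'‖ₑ + ‖g t s x - g t s x'‖ₑ ≤ K s * ‖x - x'‖ₑ) →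
      ∀ x₀ : ℝ → E, MemLp x₀ (ENNReal.ofReal p) (volume.restrict (Ioc 0 T)) →
      ∃ x : ℝ → E, MemLp x (ENNReal.ofReal p) (volume.restrict (Ioc 0 T)) ∧
        x =ᵐ[volume.restrict (Ioc 0 T)] Phi α f g x₀ x ∧
        (∀ y : ℝ → E, MemLp y (ENNReal.ofReal p) (volume.restrict (Ioc 0 T)) →
          y =ᵐ[volume.restrict (Ioc 0 T)] Phi α f g x₀ y →
          y =ᵐ[volume.restrict (Ioc 0 T)] x) ∧
        eLpNorm x (ENNReal.ofReal p) (volume.restrict (Ioc 0 T)) ≤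
          C * (1 + eLpNorm x₀ (ENNReal.ofReal p) (volume.restrict (Ioc 0 T))) := by
  have hp0 : 0 < p := by linarith
  obtain ⟨B, -, hB0, hV⟩ := hgood
  have hhalf : (0 : ℝ≥0∞) < (2⁻¹ : ℝ≥0∞) ^ p := ENNReal.rpow_pos (by simp) (by simp)
  obtain ⟨N, hN⟩ := (hB0.eventually (gt_mem_nhds hhalf)).exists
  set μ := volume.restrict (Ioc 0 T) with hμ
  set ν := wm T p N with hν
  set P := ENNReal.ofReal p with hP
  have hP0 : P ≠ 0 := by simp [hP, hp0]
  have hPt : P ≠ ∞ := by simp [hP]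
  have hP1 : 1 ≤ P := by simpa [hP] using hp
  have hPr : P.toReal = p := ENNReal.toReal_ofReal hp0.le
  have hνle : ν ≤ μ := wm_le T p hp0.le N
  have hleν : μ ≤ ((wt N T ^ p)⁻¹) • ν := le_wm T p hp0.le N
  have hνμ : ν ≪ μ := hνle.absolutelyContinuous
  have hμν : μ ≪ ν := hleν.absolutelyContinuous.trans (Measure.smul_absolutelyContinuous)
  have hc0 : wt N T ^ p ≠ 0 := by
    intro h
    rw [ENNReal.rpow_eq_zero_iff] at h
    rcases h with h | h
    · exact wt_pos N T h.1
    · exact wt_fin N T h.1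
  set D := ((wt N T ^ p)⁻¹) ^ (1 / P).toReal with hD
  have hDt : D ≠ ∞ := ENNReal.rpow_ne_top_of_nonneg (by positivity) (ENNReal.inv_ne_top.2 hc0)
  have hDle : ∀ h : ℝ → E, eLpNorm h P μ ≤ D * eLpNorm h P ν := by
    intro h
    refine (eLpNorm_mono_measure h hleν).trans ?_
    rw [eLpNorm_smul_measure_of_ne_top hPt, smul_eq_mul]
  have hVn : ∀ z : ℝ → ℝ≥0∞, Measurable z →
      eLpNorm (Vop T α K z) P ν ≤ 2⁻¹ * eLpNorm z P ν := by
    intro z hz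
    rw [eLpNorm_eq_lintegral_rpow_enorm_toReal hP0 hPt, eLpNorm_eq_lintegral_rpow_enorm_toReal hP0 hPt,
      hPr]
    simp only [enorm_eq_self]
    have h1 : ∫⁻ t, Vop T α K z t ^ p ∂ν ≤ (2⁻¹ : ℝ≥0∞) ^ p * ∫⁻ t, z t ^ p ∂ν :=
      (hV N z hz).trans (by gcongr)
    refine (ENNReal.rpow_le_rpow h1 (by positivity : 0 ≤ 1 / p)).trans ?_
    rw [ENNReal.mul_rpow_of_nonneg _ _ (by positivity), ← ENNReal.rpow_mul,
      mul_one_div_cancel hp0.ne', ENNReal.rpow_one]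
  set A := eLpNorm (Vop T α K₀ 1) P ν with hA
  have hAt : A ≠ ∞ := by
    rw [hA, eLpNorm_eq_lintegral_rpow_enorm_toReal hP0 hPt, hPr]
    simp only [enorm_eq_self]
    exact ENNReal.rpow_ne_top_of_nonneg (by positivity) (hK₀f N)
  have hV0m : Measurable (Vop T α K₀ 1) := measurable_Vop T α hK₀ measurable_one
  refine ⟨D * (2 * (1 + A)), ENNReal.mul_ne_top hDt (ENNReal.mul_ne_top (by simp)
    (ENNReal.add_ne_top.2 ⟨by simp, hAt⟩)), ?_⟩
  intro f g hf hg hG hL x₀ hx₀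
  have hx₀ν : MemLp x₀ P ν := hx₀.mono_measure hνle
  have hmemν : ∀ᵐ t ∂ν, t ∈ Ioc 0 T := hνμ.ae_le (ae_restrict_mem measurableSet_Ioc)
  -- norm bound
  have hnb : ∀ x : ℝ → E, Measurable x →
      eLpNorm (Phi α f g x₀ x) P ν ≤ eLpNorm x₀ P ν + (A + 2⁻¹ * eLpNorm x P ν) := by
    intro x hx
    have hm := Phi_meas α f g hf hg x₀ x hx ν hx₀ν.1
    have e : Phi α f g x₀ x = x₀ + (Phi α f g x₀ x - x₀) := by abel
    rw [e]
    refine (eLpNorm_add_le hx₀ν.1 (hm.sub hx₀ν.1) hP1).trans ?_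
    gcongr
    have hVm : Measurable (Vop T α K (fun s => ‖x s‖ₑ)) := measurable_Vop T α hK hx.enorm
    calc eLpNorm (Phi α f g x₀ x - x₀) P ν
        ≤ eLpNorm (Vop T α K₀ 1 + Vop T α K (fun s => ‖x s‖ₑ)) P ν := by
          apply eLpNorm_mono_enorm_ae
          filter_upwards [hmemν] with t ht
          exact Phi_sub_le T α f g K₀ K hK₀ hG x₀ x ht
      _ ≤ A + eLpNorm (Vop T α K (fun s => ‖x s‖ₑ)) P ν :=
          eLpNorm_add_le hV0m.aestronglyMeasurable hVm.aestronglyMeasurable hP1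
      _ ≤ _ := by
          gcongr
          refine (hVn _ hx.enorm).trans ?_
          rw [eLpNorm_enorm]
  have hfinae : ∀ x : ℝ → E, Measurable x → eLpNorm x P ν ≠ ∞ →
      ∀ᵐ t ∂ν, Vop T α K₀ 1 t + Vop T α K (fun s => ‖x s‖ₑ) t < ∞ := by
    intro x hx hxf
    have key : ∀ h : ℝ → ℝ≥0∞, Measurable h → eLpNorm h P ν ≠ ∞ → ∀ᵐ t ∂ν, h t < ∞ := by
      intro h hh hhf
      rw [eLpNorm_eq_lintegral_rpow_enorm_toReal hP0 hPt, hPr] at hhf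
      simp only [enorm_eq_self] at hhf
      have h1 : ∫⁻ t, h t ^ p ∂ν ≠ ∞ := by
        intro h2
        rw [h2, ENNReal.top_rpow_of_pos (by positivity)] at hhf
        exact hhf rfl
      filter_upwards [ae_lt_top (hh.pow_const p) h1] with t ht
      by_contra h3
      rw [not_lt, top_le_iff] at h3
      rw [h3, ENNReal.top_rpow_of_pos hp0] at ht
      exact lt_irrefl _ ht
    have h1 := key _ hV0m hAt
    have h2 := key _ (measurable_Vop T α hK hx.enorm)
      (ne_top_of_le_ne_top (ENNReal.mul_ne_top (by simp) (by rwa [eLpNorm_enorm])) (hVn _ hx.enorm))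
    filter_upwards [h1, h2] with t h1 h2
    exact ENNReal.add_lt_top.2 ⟨h1, h2⟩
  -- contraction
  have : Fact (1 ≤ P) := ⟨hP1⟩
  have hmeasLp : ∀ X : Lp E P ν, Measurable (X : ℝ → E) := fun X =>
    (Lp.stronglyMeasurable X).measurable
  have hPhiLp : ∀ X : Lp E P ν, MemLp (Phi α f g x₀ X) P ν := by
    intro X
    refine ⟨Phi_meas α f g hf hg x₀ X (hmeasLp X) ν hx₀ν.1, ?_⟩
    refine (hnb X (hmeasLp X)).trans_lt ?_
    exact ENNReal.add_lt_top.2 ⟨hx₀ν.2, ENNReal.add_lt_top.2 ⟨hAt.lt_top,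
      ENNReal.mul_lt_top (by simp) (Lp.memLp X).2⟩⟩
  let Ψ : Lp E P ν → Lp E P ν := fun X => (hPhiLp X).toLp _
  have hcontr : ContractingWith (2⁻¹ : NNReal) Ψ := by
    refine ⟨?_, ?_⟩
    · rw [← NNReal.coe_lt_coe]; push_cast; norm_num
    · intro X Y
      have h1 : edist (Ψ X) (Ψ Y) = eLpNorm (Phi α f g x₀ X - Phi α f g x₀ Y) P ν :=
        Lp.edist_toLp_toLp _ _ _ _
      rw [h1, Lp.edist_def]
      have hm : Measurable fun s => ‖(X : ℝ → E) s - (Y : ℝ → E) s‖ₑ :=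
        ((hmeasLp X).sub (hmeasLp Y)).enorm
      calc _ ≤ eLpNorm (Vop T α K (fun s => ‖(X : ℝ → E) s - (Y : ℝ → E) s‖ₑ)) P ν := by
            apply eLpNorm_mono_enorm_ae
            filter_upwards [hmemν, hfinae X (hmeasLp X) (Lp.memLp X).2.ne,
              hfinae Y (hmeasLp Y) (Lp.memLp Y).2.ne] with t ht h1 h2
            exact Phi_diff_le T α f g K₀ K hK₀ hf hg hG hL x₀ X Y (hmeasLp X) (hmeasLp Y) ht h1 h2
        _ ≤ _ := hVn _ hm
        _ = _ := by
            have e := eLpNorm_enorm (p := P) (μ := ν) ((X : ℝ → E) - (Y : ℝ → E))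
            simp only [Pi.sub_apply] at e
            rw [e]
            congr 1
            rw [ENNReal.coe_inv (by norm_num)]
            simp
  let X := ContractingWith.fixedPoint Ψ hcontr
  have hX : Ψ X = X := hcontr.fixedPoint_isFixedPt
  have hXν : (X : ℝ → E) =ᵐ[ν] Phi α f g x₀ X := by
    have h1 := (hPhiLp X).coeFn_toLp
    have h2 : (hPhiLp X).toLp _ = X := hX
    rw [h2] at h1
    exact h1
  have hsmall : eLpNorm X P ν ≤ 2 * (eLpNorm x₀ P ν + A) := by
    have h1 : eLpNorm X P ν ≤ eLpNorm x₀ P ν + (A + 2⁻¹ * eLpNorm X P ν) := by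
      conv_lhs => rw [eLpNorm_congr_ae hXν]
      exact hnb X (hmeasLp X)
    set a := eLpNorm X P ν
    have ha : a ≠ ∞ := (Lp.memLp X).2.ne
    have hh : 2⁻¹ * a ≠ ∞ := ENNReal.mul_ne_top (by simp) ha
    have h2 : 2⁻¹ * a + 2⁻¹ * a = a := by
      rw [← add_mul, ENNReal.inv_two_add_inv_two, one_mul]
    have h3 : 2⁻¹ * a + 2⁻¹ * a ≤ (eLpNorm x₀ P ν + A) + 2⁻¹ * a := by
      rw [h2, add_assoc]; exact h1
    have h4 := (ENNReal.add_le_add_iff_right hh).1 h3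
    calc a = 2 * (2⁻¹ * a) := by
          rw [← mul_assoc, ENNReal.mul_inv_cancel (by simp) (by simp), one_mul]
      _ ≤ _ := by gcongr
  refine ⟨X, ⟨(Lp.aestronglyMeasurable X).mono_ac hμν, ?_⟩, hμν.ae_le hXν, ?_, ?_⟩
  · exact (hDle X).trans_lt (ENNReal.mul_lt_top hDt.lt_top (Lp.memLp X).2)
  · intro y hy hye
    have hyν : MemLp y P ν := hy.mono_measure hνle
    have hY : hyν.toLp y =ᵐ[ν] y := hyν.coeFn_toLp
    have hYμ : hyν.toLp y =ᵐ[μ] y := hμν.ae_le hY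
    have hPe : ∀ᵐ t ∂ν, Phi α f g x₀ (hyν.toLp y) t = Phi α f g x₀ y t := by
      filter_upwards [hmemν] with t ht
      have hr : ∀ᵐ s ∂(volume.restrict (Ioc 0 t)), (hyν.toLp y : ℝ → E) s = y s :=
        ae_restrict_of_ae_restrict_of_subset (Ioc_subset_Ioc_right ht.2) hYμ
      unfold Phi
      congr 1
      · congr 1
        apply integral_congr_ae
        filter_upwards [hr] with s hs
        rw [hs]
      · apply integral_congr_ae
        filter_upwards [hr] with s hs
        rw [hs]
    have hfix : Ψ (hyν.toLp y) = hyν.toLp y := by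
      apply Lp.ext
      refine (hPhiLp (hyν.toLp y)).coeFn_toLp.trans ?_
      filter_upwards [hPe, hY, hνμ.ae_le hye] with t h1 h2 h3
      rw [h1, h2, h3]
    have hu : hyν.toLp y = X := hcontr.fixedPoint_unique hfix
    rw [← hu]
    exact hYμ.symm
  · refine (hDle X).trans ?_
    rw [mul_assoc]
    gcongr
    refine hsmall.trans ?_
    rw [mul_assoc]
    gcongr
    have hle : eLpNorm x₀ P ν ≤ eLpNorm x₀ P μ := eLpNorm_mono_measure _ hνle
    calc eLpNorm x₀ P ν + A ≤ eLpNorm x₀ P μ + A := by gcongr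
      _ ≤ eLpNorm x₀ P μ + A + (1 + A * eLpNorm x₀ P μ) := le_self_add
      _ = _ := by ring

end core

end aux

/-- Lemma B.1, existence, uniqueness and growth estimate: under Assumption B,
for every `x₀ ∈ Lᵖ([0,T];ℝⁿ)` and admissible `u`, the generalized Volterra equation admits a
unique `Lᵖ`-solution, with a growth estimate whose constant is independent of `(x₀,u)`. -/
theorem generalized_volterra_wellposedness
    {n d : ℕ} (T : ℝ) (hT : 0 < T) (α : ℝ) (hα : α ∈ Set.Ioo (0:ℝ) 1)
    (p : ℝ) (hp1 : 1 ≤ p)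
    (U : Set (Euc d)) (u₀ : Euc d) (hu₀U : u₀ ∈ U)
    (f g : ℝ → ℝ → Euc n → Euc d → Euc n)
    (hf_meas : Measurable fun q : ℝ × ℝ × Euc n × Euc d => f q.1 q.2.1 q.2.2.1 q.2.2.2)
    (hg_meas : Measurable fun q : ℝ × ℝ × Euc n × Euc d => g q.1 q.2.1 q.2.2.1 q.2.2.2)
    -- Assumption B
    (K₀ K : ℝ → ℝ) (hK₀_nonneg : ∀ s, 0 ≤ K₀ s) (hK_nonneg : ∀ s, 0 ≤ K s)
    (hK₀_meas : Measurable K₀) (hK_meas : Measurable K)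
    (r₀ : ℝ) (hr₀ : max (p / (1 + α * p)) 1 < r₀)
    (hK₀_L : IntegrableOn (fun s => K₀ s ^ r₀) (Set.Ioc 0 T))
    (hK_L : (1 < p ∧ ∃ r₁ : ℝ, max (1 / α) (p / (p - 1)) < r₁ ∧
              IntegrableOn (fun s => K s ^ r₁) (Set.Ioc 0 T)) ∨
            (p = 1 ∧ ∃ M : ℝ, ∀ s ∈ Set.Ioc (0:ℝ) T, K s ≤ M))
    (hA_lip : ∀ t s : ℝ, 0 ≤ s → s ≤ t → t ≤ T →
      ∀ (x x' : Euc n) (u u' : Euc d), u ∈ U → u' ∈ U →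
        ‖f t s x u - f t s x' u'‖ + ‖g t s x u - g t s x' u'‖ ≤ K s * (‖x - x'‖ + ‖u - u'‖))
    (hA_zero : ∀ t s : ℝ, 0 ≤ s → s ≤ t → t ≤ T → ∀ u : Euc d, u ∈ U →
      ‖f t s 0 u‖ + ‖g t s 0 u‖ ≤ K₀ s) :
    ∃ C : ℝ, 0 ≤ C ∧
      ∀ x₀ : ℝ → Euc n,
        AEStronglyMeasurable x₀ (volume.restrict (Set.Ioc 0 T)) →
        IntegrableOn (fun t => ‖x₀ t‖ ^ p) (Set.Ioc 0 T) →
        ∀ u : ℝ → Euc d, Admissible T p U u₀ u →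
          ∃ x : ℝ → Euc n,
            IsLpSolution T α p f g x₀ u x ∧
            (∀ y : ℝ → Euc n, IsLpSolution T α p f g x₀ u y →
              y =ᵐ[volume.restrict (Set.Ioc 0 T)] x) ∧
            (∫ t in Set.Ioc 0 T, ‖x t‖ ^ p) ^ (1 / p)
              ≤ C * (1 + (∫ t in Set.Ioc 0 T, ‖x₀ t‖ ^ p) ^ (1 / p)
                  + (∫ t in Set.Ioc 0 T, ‖u t - u₀‖ ^ p) ^ (1 / p)) := by
  classical
  have hp0 : 0 < p := by linarith
  have hP0 : ENNReal.ofReal p ≠ 0 := by simp [hp0]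
  have hPt : ENNReal.ofReal p ≠ ⊤ := by simp
  have hPr : (ENNReal.ofReal p).toReal = p := ENNReal.toReal_ofReal hp0.le
  have hconv : ∀ (h : ℝ → ℝ) (r : ℝ), 0 ≤ r → (∀ s, 0 ≤ h s) →
      IntegrableOn (fun s => h s ^ r) (Set.Ioc 0 T) →
      ∫⁻ s in Ioc 0 T, ENNReal.ofReal (h s) ^ r ≠ ⊤ := by
    intro h r hr hh hi
    have := hi.lintegral_lt_top.ne
    refine ne_top_of_le_ne_top this (lintegral_mono fun s => ?_)
    rw [ENNReal.ofReal_rpow_of_nonneg (hh s) hr]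
  have hr1 : 1 < r₀ := (le_max_right _ _).trans_lt hr₀
  have hKm : Measurable fun s => ENNReal.ofReal (K s) := hK_meas.ennreal_ofReal
  have hK₀m : Measurable fun s => ENNReal.ofReal (K₀ s) := hK₀_meas.ennreal_ofReal
  have hgood : GoodK T α p (fun s => ENNReal.ofReal (K s)) := by
    rcases hK_L with ⟨hp, r, hr, hi⟩ | ⟨hp, M, hM⟩
    · have h1 : 1 / α < r := (le_max_left _ _).trans_lt hr
      have hα0 := hα.1
      have hr0 : 0 ≤ r := by
        have : 0 < 1 / α := by positivity
        linarith
      exact goodK_of_Lr T α p r hT hα hp h1 ((le_max_right _ _).trans_lt hr) _ hKm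
        (hconv K r hr0 hK_nonneg hi)
    · exact goodK_of_bdd T α p hT hα hp1 _ hKm (ENNReal.ofReal M) (by simp)
        (fun s hs => ENNReal.ofReal_le_ofReal (hM s hs))
  have hK₀f := K0_bound T α p r₀ hT hα hp1 hr₀ _ hK₀m (hconv K₀ r₀ (by linarith) hK₀_nonneg hK₀_L)
  obtain ⟨C, hC, hcore⟩ := core (E := Euc n) T α p hp1 _ _ hK₀m hKm hgood hK₀f
  refine ⟨C.toReal, ENNReal.toReal_nonneg, ?_⟩
  intro x₀ hx₀m hx₀i u ⟨hum, huU, hui⟩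
  have hmemiff : ∀ y : ℝ → Euc n, AEStronglyMeasurable y (volume.restrict (Set.Ioc 0 T)) →
      (IntegrableOn (fun t => ‖y t‖ ^ p) (Set.Ioc 0 T) ↔
        MemLp y (ENNReal.ofReal p) (volume.restrict (Set.Ioc 0 T))) := by
    intro y hy
    have := integrable_norm_rpow_iff hy hP0 hPt
    rw [hPr] at this
    exact this
  have hx₀ : MemLp x₀ (ENNReal.ofReal p) (volume.restrict (Set.Ioc 0 T)) := (hmemiff x₀ hx₀m).1 hx₀i
  have hL : ∀ t s, 0 < s → s ≤ t → t ≤ T → ∀ x x' : Euc n,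
      ‖f t s x (u s) - f t s x' (u s)‖ₑ + ‖g t s x (u s) - g t s x' (u s)‖ₑ
        ≤ ENNReal.ofReal (K s) * ‖x - x'‖ₑ := by
    intro t s hs hst ht x x'
    have h := hA_lip t s hs.le hst ht x x' (u s) (u s) (huU s) (huU s)
    rw [sub_self, norm_zero, add_zero] at h
    rw [← ofReal_norm, ← ofReal_norm, ← ofReal_norm, ← ENNReal.ofReal_mul (hK_nonneg s),
      ← ENNReal.ofReal_add (norm_nonneg _) (norm_nonneg _)]
    exact ENNReal.ofReal_le_ofReal h
  have hG : ∀ t s, 0 < s → s ≤ t → t ≤ T → ∀ x : Euc n,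
      ‖f t s x (u s)‖ₑ + ‖g t s x (u s)‖ₑ
        ≤ ENNReal.ofReal (K₀ s) * 1 + ENNReal.ofReal (K s) * ‖x‖ₑ := by
    intro t s hs hst ht x
    have h1 := hA_lip t s hs.le hst ht x 0 (u s) (u s) (huU s) (huU s)
    have h2 := hA_zero t s hs.le hst ht (u s) (huU s)
    rw [sub_self, norm_zero, add_zero, sub_zero] at h1
    have h3 := norm_sub_norm_le (f t s x (u s)) (f t s 0 (u s))
    have h4 := norm_sub_norm_le (g t s x (u s)) (g t s 0 (u s))
    rw [← ofReal_norm, ← ofReal_norm, ← ofReal_norm, ← ENNReal.ofReal_mul (hK_nonneg s), mul_one,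
      ← ENNReal.ofReal_add (norm_nonneg _) (norm_nonneg _),
      ← ENNReal.ofReal_add (hK₀_nonneg s) (mul_nonneg (hK_nonneg s) (norm_nonneg _))]
    exact ENNReal.ofReal_le_ofReal (by linarith)
  obtain ⟨x, hxm, hxe, hxu, hxn⟩ := hcore (fun t s x => f t s x (u s)) (fun t s x => g t s x (u s))
    (hf_meas.comp (by fun_prop : Measurable fun q : ℝ × ℝ × Euc n => (q.1, q.2.1, q.2.2, u q.2.1)))
    (hg_meas.comp (by fun_prop : Measurable fun q : ℝ × ℝ × Euc n => (q.1, q.2.1, q.2.2, u q.2.1)))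
    hG hL x₀ hx₀
  refine ⟨x, ⟨hxm.1, (hmemiff x hxm.1).2 hxm, hxe⟩, ?_, ?_⟩
  · rintro y ⟨hy1, hy2, hy3⟩
    exact hxu y ((hmemiff y hy1).1 hy2) hy3
  · have hnorm : ∀ y : ℝ → Euc n, MemLp y (ENNReal.ofReal p) (volume.restrict (Set.Ioc 0 T)) →
        (∫ t in Set.Ioc 0 T, ‖y t‖ ^ p) ^ (1 / p)
          = (eLpNorm y (ENNReal.ofReal p) (volume.restrict (Set.Ioc 0 T))).toReal := by
      intro y hy
      rw [hy.eLpNorm_eq_integral_rpow_norm hP0 hPt, hPr, ENNReal.toReal_ofReal, one_div]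
      exact Real.rpow_nonneg (integral_nonneg fun t => Real.rpow_nonneg (norm_nonneg _) _) _
    have hu0 : 0 ≤ (∫ t in Set.Ioc 0 T, ‖u t - u₀‖ ^ p) ^ (1 / p) :=
      Real.rpow_nonneg (integral_nonneg fun t => Real.rpow_nonneg (norm_nonneg _) _) _
    rw [hnorm x hxm, hnorm x₀ hx₀]
    have h1 := ENNReal.toReal_mono
      (ENNReal.mul_ne_top hC (ENNReal.add_ne_top.2 ⟨by simp, hx₀.2.ne⟩)) hxn
    rw [ENNReal.toReal_mul, ENNReal.toReal_add (by simp) hx₀.2.ne, ENNReal.toReal_one] at h1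
    refine h1.trans ?_
    have := ENNReal.toReal_nonneg (a := C)
    exact mul_le_mul_of_nonneg_left (by linarith) this
end
end

section
/- (Lemma B.2, continuity of the solution.) Suppose Assumption A holds and let x₀ ∈ C([0,T];ℝⁿ). Then for every u ∈ 𝒰ᵖ[0,T] the generalized Volterra equation x(t) = x₀(t) + ∫₀ᵗ f(t,s,x(s),u(s))/(t−s)^{1−α} ds + ∫₀ᵗ g(t,s,x(s),u(s)) ds, a.e. t ∈ [0,T], admits a unique solution belonging to C([0,T];ℝⁿ). -/
open MeasureTheory Set

noncomputable section

/-- `x` solves the Volterra integral equation with singular and nonsingular kernels for the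
initial condition `x₀` and control `u`, a.e. on `[0,T]`. -/
def IsSolutionGen {n d : ℕ} (T α : ℝ) (f g : ℝ → ℝ → Euc n → Euc d → Euc n)
    (x₀ : ℝ → Euc n) (u : ℝ → Euc d) (x : ℝ → Euc n) : Prop :=
  ∀ᵐ t ∂(volume.restrict (Set.Ioc 0 T)),
    x t = x₀ t + (∫ s in Set.Ioc 0 t, ((t - s) ^ (α - 1)) • f t s (x s) (u s))
        + ∫ s in Set.Ioc 0 t, g t s (x s) (u s)


lemma volt_holder {T r q : ℝ} (hrq : r.HolderConjugate q) {κ h : ℝ → ℝ}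
    (hκ0 : ∀ τ, 0 ≤ τ → 0 ≤ κ τ)
    (hκ : MemLp κ (ENNReal.ofReal q) (volume.restrict (Ioc 0 T)))
    (hh0 : ∀ s, 0 ≤ h s) (hh : MemLp h (ENNReal.ofReal r) (volume.restrict (Ioc 0 T)))
    {t : ℝ} (ht : t ∈ Icc 0 T) :
    IntegrableOn (fun s => κ (t - s) * h s) (Ioc 0 t) ∧
    ∫ s in Ioc 0 t, κ (t - s) * h s ≤
      (∫ τ in Ioc 0 T, κ τ ^ q) ^ (1 / q) * (∫ s in Ioc 0 T, h s ^ r) ^ (1 / r) := by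
  have hsub : Ioc 0 t ⊆ Ioc 0 T := Ioc_subset_Ioc_right ht.2
  have hmp : MeasurePreserving (fun s => t - s) (volume.restrict (Ioc 0 t))
      (volume.restrict (Ico 0 t)) := by
    have := (Measure.measurePreserving_sub_left (volume : Measure ℝ) t).restrict_preimage
      (measurableSet_Ico (a := (0:ℝ)) (b := t))
    simpa using this
  have hemb : MeasurableEmbedding (fun s : ℝ => t - s) :=
    (MeasurableEquiv.subLeft t).measurableEmbedding
  have hIco : volume.restrict (Ico 0 t) = volume.restrict (Ioc (0:ℝ) t) :=
    Measure.restrict_congr_set Ico_ae_eq_Ioc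
  have hκt : MemLp κ (ENNReal.ofReal q) (volume.restrict (Ioc 0 t)) :=
    hκ.mono_measure (Measure.restrict_mono hsub le_rfl)
  have hht : MemLp h (ENNReal.ofReal r) (volume.restrict (Ioc 0 t)) :=
    hh.mono_measure (Measure.restrict_mono hsub le_rfl)
  have hκc : MemLp (fun s => κ (t - s)) (ENNReal.ofReal q) (volume.restrict (Ioc 0 t)) := by
    have : MemLp κ (ENNReal.ofReal q) (volume.restrict (Ico 0 t)) := by rwa [hIco]
    exact this.comp_measurePreserving hmp
  have hqr := hrq.symm
  refine ⟨?_, ?_⟩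
  · have : ENNReal.HolderConjugate (ENNReal.ofReal q) (ENNReal.ofReal r) := hqr.ennrealOfReal
    exact hκc.integrable_mul hht
  · have h1 := integral_mul_le_Lp_mul_Lq_of_nonneg hqr (μ := volume.restrict (Ioc 0 t))
      (f := fun s => κ (t - s)) (g := h)
      (by
        filter_upwards [ae_restrict_mem measurableSet_Ioc] with s hs
        exact hκ0 _ (by linarith [hs.2]))
      (Filter.Eventually.of_forall hh0) hκc hht
    refine h1.trans ?_
    have e1 : ∫ s in Ioc 0 t, κ (t - s) ^ q = ∫ s in Ioc 0 t, κ s ^ q := by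
      have := hmp.integral_comp hemb (fun s => κ s ^ q)
      rw [this, hIco]
    rw [e1]
    have i1 : IntegrableOn (fun s => κ s ^ q) (Ioc 0 T) := by
      have := hκ.integrable_norm_rpow (by simpa using hqr.pos) (by simp)
      rw [ENNReal.toReal_ofReal hqr.nonneg] at this
      refine this.congr ?_
      filter_upwards [ae_restrict_mem measurableSet_Ioc] with s hs
      rw [Real.norm_of_nonneg (hκ0 _ hs.1.le)]
    have i2 : IntegrableOn (fun s => h s ^ r) (Ioc 0 T) := by
      have := hh.integrable_norm_rpow (by simpa using hrq.pos) (by simp)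
      rw [ENNReal.toReal_ofReal hrq.nonneg] at this
      refine this.congr ?_
      filter_upwards [ae_restrict_mem measurableSet_Ioc] with s hs
      rw [Real.norm_of_nonneg (hh0 _)]
    have p1 : ∀ S : ℝ, 0 ≤ ∫ s in Ioc 0 S, κ s ^ q := fun S =>
      setIntegral_nonneg measurableSet_Ioc fun s hs => Real.rpow_nonneg (hκ0 _ hs.1.le) _
    have p2 : ∀ S : ℝ, 0 ≤ ∫ s in Ioc 0 S, h s ^ r := fun S =>
      setIntegral_nonneg measurableSet_Ioc fun s hs => Real.rpow_nonneg (hh0 _) _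
    have := hqr.pos
    have := hrq.pos
    gcongr
    · exact Real.rpow_nonneg (p2 _) _
    · exact Real.rpow_nonneg (p1 _) _
    · exact p1 _
    · filter_upwards [ae_restrict_mem measurableSet_Ioc] with s hs
      exact Real.rpow_nonneg (hκ0 _ hs.1.le) _
    · exact p2 _
    · filter_upwards with s 
      exact Real.rpow_nonneg (hh0 _) _

/-- truncations converge in `L^q` -/
lemma volt_trunc {T q : ℝ} (hq : 0 < q) {κ : ℝ → ℝ} (hκm : Measurable κ)
    (hκ0 : ∀ τ, 0 ≤ τ → 0 ≤ κ τ)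
    (hκ : MemLp κ (ENNReal.ofReal q) (volume.restrict (Ioc 0 T))) :
    Filter.Tendsto (fun m : ℕ => ∫ τ in Ioc 0 T, (κ τ - min (κ τ) m) ^ q) Filter.atTop
      (nhds 0) := by
  have i1 : IntegrableOn (fun s => κ s ^ q) (Ioc 0 T) := by
    have := hκ.integrable_norm_rpow (by simpa using hq) (by simp)
    rw [ENNReal.toReal_ofReal hq.le] at this
    refine this.congr ?_
    filter_upwards [ae_restrict_mem measurableSet_Ioc] with s hs
    rw [Real.norm_of_nonneg (hκ0 _ hs.1.le)]
  have := tendsto_integral_of_dominated_convergence (μ := volume.restrict (Ioc 0 T))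
    (F := fun (m : ℕ) τ => (κ τ - min (κ τ) m) ^ q) (f := fun _ => (0:ℝ))
    (fun s => κ s ^ q) (fun m => by
      have : Measurable (fun τ => (κ τ - min (κ τ) m) ^ q) := by fun_prop
      exact this.aestronglyMeasurable) i1 ?_ ?_
  · simpa using this
  · intro m
    filter_upwards [ae_restrict_mem measurableSet_Ioc] with s hs
    have h0 := hκ0 s hs.1.le
    have h1 : 0 ≤ κ s - min (κ s) m := sub_nonneg.2 (min_le_left _ _)
    rw [Real.norm_of_nonneg (Real.rpow_nonneg h1 _)]
    refine Real.rpow_le_rpow h1 ?_ hq.le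
    have : 0 ≤ min (κ s) (m:ℝ) := le_min h0 (by positivity)
    linarith
  · filter_upwards with s
    refine tendsto_const_nhds.congr' ?_
    obtain ⟨N, hN⟩ := exists_nat_ge (κ s)
    filter_upwards [Filter.eventually_ge_atTop N] with m hm
    have : κ s ≤ m := hN.trans (by exact_mod_cast hm)
    simp [min_eq_left this, hq.ne']

lemma volt_cont {E : Type*} [NormedAddCommGroup E] [NormedSpace ℝ E]
    {T r q : ℝ} (hrq : r.HolderConjugate q) {κ h : ℝ → ℝ} (hκm : Measurable κ)
    (hκc : ContinuousOn κ (Ioi 0))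
    (hκ0 : ∀ τ, 0 ≤ τ → 0 ≤ κ τ)
    (hκ : MemLp κ (ENNReal.ofReal q) (volume.restrict (Ioc 0 T)))
    (hh0 : ∀ s, 0 ≤ h s) (hh : MemLp h (ENNReal.ofReal r) (volume.restrict (Ioc 0 T)))
    {ψ : ℝ → ℝ → E} (hψm : ∀ t, StronglyMeasurable (ψ t))
    (hψh : ∀ t s, 0 ≤ s → s ≤ t → t ≤ T → ‖ψ t s‖ ≤ h s)
    {ω : ℝ → ℝ} (hω0 : ω 0 = 0) (hω_cont : ContinuousWithinAt ω (Set.Ici 0) 0)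
    {C : ℝ → ℝ} (hψω : ∀ t t' s, 0 ≤ s → s ≤ t → t ≤ T → s ≤ t' → t' ≤ T →
      ‖ψ t s - ψ t' s‖ ≤ C s * ω |t - t'|) :
    ContinuousOn (fun t => ∫ s in Ioc 0 t, κ (t - s) • ψ t s) (Icc 0 T) := by
  have hr1 : (1 : ENNReal) ≤ ENNReal.ofReal r := by
    simpa using hrq.lt.le
  have hint : IntegrableOn h (Ioc 0 T) := hh.integrable hr1
  have hI : ∀ t ∈ Icc 0 T, IntegrableOn (fun s => κ (t - s) • ψ t s) (Ioc 0 t) := by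
    intro t ht
    refine (volt_holder hrq hκ0 hκ hh0 hh ht).1.mono' ?_ ?_
    · exact ((hκm.comp (measurable_const.sub measurable_id)).stronglyMeasurable.smul
        (hψm t)).aestronglyMeasurable
    · filter_upwards [ae_restrict_mem measurableSet_Ioc] with s hs
      rw [norm_smul, Real.norm_of_nonneg (hκ0 _ (by linarith [hs.2]))]
      exact mul_le_mul_of_nonneg_left (hψh t s hs.1.le hs.2 ht.2) (hκ0 _ (by linarith [hs.2]))
  have hκmin : ∀ (m : ℕ) τ, 0 ≤ τ → 0 ≤ min (κ τ) (m:ℝ) := fun m τ hτ =>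
    le_min (hκ0 τ hτ) (by positivity)
  have hIm : ∀ m : ℕ, ∀ t ∈ Icc 0 T,
      IntegrableOn (fun s => min (κ (t - s)) (m:ℝ) • ψ t s) (Ioc 0 t) := by
    intro m t ht
    refine Integrable.mono (hI t ht) ?_ ?_
    · have : Measurable fun s => min (κ (t - s)) (m:ℝ) := by fun_prop
      exact (this.stronglyMeasurable.smul (hψm t)).aestronglyMeasurable
    · filter_upwards [ae_restrict_mem measurableSet_Ioc] with s hs
      have h0 : 0 ≤ t - s := by linarith [hs.2]
      rw [norm_smul, norm_smul, Real.norm_of_nonneg (hκ0 _ h0),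
        Real.norm_of_nonneg (hκmin m _ h0)]
      gcongr
      exact min_le_left _ _
  have hcont : ∀ m : ℕ, ContinuousOn
      (fun t => ∫ s in Ioc 0 t, min (κ (t - s)) (m:ℝ) • ψ t s) (Icc 0 T) := by
    intro m
    have key : ContinuousOn (fun t => ∫ s in Ioc 0 T,
        (Iic t).indicator (fun s => min (κ (t - s)) (m:ℝ) • ψ t s) s) (Icc 0 T) := by
      intro t₀ ht₀
      refine continuousWithinAt_of_dominated (bound := fun s => m * h s) ?_ ?_ ?_ ?_
      · filter_upwards with t
        have : Measurable fun s => min (κ (t - s)) (m:ℝ) := by fun_prop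
        exact ((this.stronglyMeasurable.smul (hψm t)).indicator
          measurableSet_Iic).aestronglyMeasurable
      · filter_upwards [self_mem_nhdsWithin] with t ht
        filter_upwards [ae_restrict_mem measurableSet_Ioc] with s hs
        by_cases hst : s ≤ t
        · have h0 : 0 ≤ t - s := by linarith
          rw [indicator_of_mem (by exact hst), norm_smul, Real.norm_of_nonneg (hκmin m _ h0)]
          exact mul_le_mul (min_le_right _ _) (hψh t s hs.1.le hst ht.2) (norm_nonneg _)
            (by positivity)
        · rw [indicator_of_notMem (by exact hst), norm_zero]
          exact mul_nonneg (by positivity) (hh0 s)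
      · exact hint.const_mul _
      · have hne : ∀ᵐ s ∂(volume.restrict (Ioc 0 T)), s ≠ t₀ := by
          refine ae_restrict_of_ae ?_
          simp [ae_iff]
        filter_upwards [ae_restrict_mem measurableSet_Ioc, hne] with s hs hst
        rcases lt_or_gt_of_ne hst with hlt | hgt
        · have hev : ∀ᶠ t in nhdsWithin t₀ (Icc 0 T), s < t :=
            nhdsWithin_le_nhds (lt_mem_nhds hlt)
          have hmain : ContinuousWithinAt (fun t => min (κ (t - s)) (m:ℝ) • ψ t s)
              (Icc 0 T) t₀ := by
            refine ContinuousWithinAt.smul ?_ ?_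
            · refine Filter.Tendsto.min ?_ tendsto_const_nhds
              have : ContinuousAt κ (t₀ - s) :=
                hκc.continuousAt (Ioi_mem_nhds (by linarith))
              have h2 : ContinuousAt (fun t => κ (t - s)) t₀ :=
                ContinuousAt.comp (f := fun t => t - s) this (by fun_prop)
              exact h2.continuousWithinAt
            · rw [ContinuousWithinAt, tendsto_iff_norm_sub_tendsto_zero]
              have hlim : Filter.Tendsto (fun t => C s * ω |t - t₀|)
                  (nhdsWithin t₀ (Icc 0 T)) (nhds 0) := by
                have h1 : Filter.Tendsto (fun t => |t - t₀|) (nhdsWithin t₀ (Icc 0 T))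
                    (nhdsWithin 0 (Ici 0)) := by
                  refine tendsto_nhdsWithin_iff.2 ⟨?_, ?_⟩
                  · have : Continuous fun t : ℝ => |t - t₀| := by fun_prop
                    have := (this.tendsto t₀).mono_left (nhdsWithin_le_nhds (s := Icc 0 T))
                    simpa using this
                  · filter_upwards with t
                    exact abs_nonneg (t - t₀)
                have h2 := (hω_cont.tendsto.comp h1).const_mul (C s)
                simpa [hω0, Function.comp_def] using h2
              refine squeeze_zero' (Filter.Eventually.of_forall fun _ => norm_nonneg _) ?_ hlim
              filter_upwards [hev, self_mem_nhdsWithin] with t h1 h2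
              exact hψω t t₀ s hs.1.le h1.le h2.2 hlt.le ht₀.2
          refine hmain.congr_of_eventuallyEq ?_ ?_
          · filter_upwards [hev] with t ht
            rw [indicator_of_mem (by exact ht.le)]
          · rw [indicator_of_mem (by exact hlt.le)]
        · have hev : ∀ᶠ t in nhdsWithin t₀ (Icc 0 T), t < s :=
            nhdsWithin_le_nhds (gt_mem_nhds hgt)
          refine (continuousWithinAt_const (b := (0:E))).congr_of_eventuallyEq ?_ ?_
          · filter_upwards [hev] with t ht
            rw [indicator_of_notMem (by simpa using ht)]
          · rw [indicator_of_notMem (by simpa using hgt)]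
    refine key.congr ?_
    intro t ht
    simp only
    rw [setIntegral_indicator measurableSet_Iic]
    congr 2
    ext s
    simp only [mem_Ioc, mem_inter_iff, mem_Iic]
    constructor
    · rintro ⟨a, b⟩; exact ⟨⟨a, b.trans ht.2⟩, b⟩
    · rintro ⟨⟨a, _⟩, b⟩; exact ⟨a, b⟩
  have hunif : TendstoUniformlyOn
      (fun (m : ℕ) t => ∫ s in Ioc 0 t, min (κ (t - s)) (m:ℝ) • ψ t s)
      (fun t => ∫ s in Ioc 0 t, κ (t - s) • ψ t s) Filter.atTop (Icc 0 T) := by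
    set H := (∫ s in Ioc 0 T, h s ^ r) ^ (1 / r)
    have hlim : Filter.Tendsto (fun m : ℕ =>
        (∫ τ in Ioc 0 T, (κ τ - min (κ τ) m) ^ q) ^ (1 / q) * H) Filter.atTop (nhds 0) := by
      have h1 := (volt_trunc hrq.symm.pos hκm hκ0 hκ).rpow_const (p := 1 / q)
        (Or.inr (by have := hrq.symm.pos; positivity))
      rw [Real.zero_rpow (by have := hrq.symm.pos; positivity)] at h1
      simpa using h1.mul_const H
    rw [Metric.tendstoUniformlyOn_iff]
    intro ε hε
    filter_upwards [hlim.eventually (gt_mem_nhds hε)] with m hm t ht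
    refine lt_of_le_of_lt ?_ hm
    rw [dist_eq_norm, ← integral_sub (hI t ht) (hIm m t ht)]
    have hd0 : ∀ τ, 0 ≤ τ → 0 ≤ κ τ - min (κ τ) (m:ℝ) := fun τ _ =>
      sub_nonneg.2 (min_le_left _ _)
    have hdL : MemLp (fun τ => κ τ - min (κ τ) (m:ℝ)) (ENNReal.ofReal q)
        (volume.restrict (Ioc 0 T)) := by
      refine hκ.mono (Measurable.aestronglyMeasurable (by fun_prop)) ?_
      filter_upwards [ae_restrict_mem measurableSet_Ioc] with s hs
      rw [Real.norm_of_nonneg (hd0 _ hs.1.le), Real.norm_of_nonneg (hκ0 _ hs.1.le)]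
      linarith [hκmin m s hs.1.le]
    obtain ⟨j1, j2⟩ := volt_holder hrq hd0 hdL hh0 hh ht
    refine le_trans ?_ j2
    refine norm_integral_le_of_norm_le j1 ?_
    filter_upwards [ae_restrict_mem measurableSet_Ioc] with s hs
    have h0 : 0 ≤ t - s := by linarith [hs.2]
    rw [← sub_smul, norm_smul, Real.norm_of_nonneg (hd0 _ h0)]
    exact mul_le_mul_of_nonneg_left (hψh t s hs.1.le hs.2 ht.2) (hd0 _ h0)
  exact hunif.continuousOn (Filter.Frequently.of_forall hcont)

/-- the Volterra operator -/
def voltOp {E : Type*} [NormedAddCommGroup E] [NormedSpace ℝ E] (κ : ℝ → ℝ)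
    (φ₁ φ₂ : ℝ → ℝ → E → E) (x₀ x : ℝ → E) (t : ℝ) : E :=
  x₀ t + (∫ s in Ioc 0 t, κ (t - s) • φ₁ t s (x s)) + ∫ s in Ioc 0 t, φ₂ t s (x s)

lemma volt_exp {T r q : ℝ} (hrq : r.HolderConjugate q) {κ : ℝ → ℝ} (hκm : Measurable κ)
    (hκ0 : ∀ τ, 0 ≤ τ → 0 ≤ κ τ)
    (hκ : MemLp κ (ENNReal.ofReal q) (volume.restrict (Ioc 0 T))) :
    Filter.Tendsto (fun m : ℕ => ∫ τ in Ioc 0 T, (Real.exp (-(m * τ)) * κ τ) ^ q) Filter.atTop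
      (nhds 0) := by
  have hq := hrq.symm.pos
  have i1 : IntegrableOn (fun s => κ s ^ q) (Ioc 0 T) := by
    have := hκ.integrable_norm_rpow (by simpa using hq) (by simp)
    rw [ENNReal.toReal_ofReal hq.le] at this
    refine this.congr ?_
    filter_upwards [ae_restrict_mem measurableSet_Ioc] with s hs
    rw [Real.norm_of_nonneg (hκ0 _ hs.1.le)]
  have := tendsto_integral_of_dominated_convergence (μ := volume.restrict (Ioc 0 T))
    (F := fun (m : ℕ) τ => (Real.exp (-(m * τ)) * κ τ) ^ q) (f := fun _ => (0:ℝ))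
    (fun s => κ s ^ q) (fun m => by
      have : Measurable (fun τ => (Real.exp (-(m * τ)) * κ τ) ^ q) := by fun_prop
      exact this.aestronglyMeasurable) i1 ?_ ?_
  · simpa using this
  · intro m
    filter_upwards [ae_restrict_mem measurableSet_Ioc] with s hs
    have h0 := hκ0 s hs.1.le
    have h1 : 0 ≤ Real.exp (-(m * s)) * κ s := by positivity
    rw [Real.norm_of_nonneg (Real.rpow_nonneg h1 _)]
    refine Real.rpow_le_rpow h1 ?_ hq.le
    refine mul_le_of_le_one_left h0 (Real.exp_le_one_iff.2 ?_)
    have := hs.1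
    have : 0 ≤ (m:ℝ) * s := by positivity
    linarith
  · filter_upwards [ae_restrict_mem measurableSet_Ioc] with s hs
    have h1 : Filter.Tendsto (fun m : ℕ => (m:ℝ) * s) Filter.atTop Filter.atTop :=
      tendsto_natCast_atTop_atTop.atTop_mul_const hs.1
    have h2 := (Real.tendsto_exp_neg_atTop_nhds_zero.comp h1).mul_const (κ s)
    have h3 := h2.rpow_const (p := q) (Or.inr hq.le)
    simpa [Function.comp_def, Real.zero_rpow hq.ne'] using h3

theorem volt_main {E : Type*} [NormedAddCommGroup E] [NormedSpace ℝ E] [CompleteSpace E]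
    {T r q : ℝ} (hT : 0 < T) (hrq : r.HolderConjugate q) {κ : ℝ → ℝ} (hκm : Measurable κ)
    (hκc : ContinuousOn κ (Ioi 0)) (hκ0 : ∀ τ, 0 ≤ τ → 0 ≤ κ τ)
    (hκ : MemLp κ (ENNReal.ofReal q) (volume.restrict (Ioc 0 T)))
    {K₀ K : ℝ → ℝ} (hK₀0 : ∀ s, 0 ≤ K₀ s) (hK0 : ∀ s, 0 ≤ K s)
    (hK₀ : MemLp K₀ (ENNReal.ofReal r) (volume.restrict (Ioc 0 T)))
    (hK : MemLp K (ENNReal.ofReal r) (volume.restrict (Ioc 0 T)))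
    {φ₁ φ₂ : ℝ → ℝ → E → E}
    (hm₁ : ∀ t (x : ℝ → E), Continuous x → StronglyMeasurable fun s => φ₁ t s (x s))
    (hm₂ : ∀ t (x : ℝ → E), Continuous x → StronglyMeasurable fun s => φ₂ t s (x s))
    {ω : ℝ → ℝ} (hω0 : ω 0 = 0) (hω_cont : ContinuousWithinAt ω (Set.Ici 0) 0)
    {K' : ℝ}
    (hω₁ : ∀ t t' s, 0 ≤ s → s ≤ t → t ≤ T → s ≤ t' → t' ≤ T → ∀ x,
      ‖φ₁ t s x - φ₁ t' s x‖ ≤ (K' * (1 + ‖x‖)) * ω |t - t'|)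
    (hω₂ : ∀ t t' s, 0 ≤ s → s ≤ t → t ≤ T → s ≤ t' → t' ≤ T → ∀ x,
      ‖φ₂ t s x - φ₂ t' s x‖ ≤ (K' * (1 + ‖x‖)) * ω |t - t'|)
    (hl₁ : ∀ t s, 0 ≤ s → s ≤ t → t ≤ T → ∀ x x', ‖φ₁ t s x - φ₁ t s x'‖ ≤ K s * ‖x - x'‖)
    (hl₂ : ∀ t s, 0 ≤ s → s ≤ t → t ≤ T → ∀ x x', ‖φ₂ t s x - φ₂ t s x'‖ ≤ K s * ‖x - x'‖)
    (hz₁ : ∀ t s, 0 ≤ s → s ≤ t → t ≤ T → ‖φ₁ t s 0‖ ≤ K₀ s)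
    (hz₂ : ∀ t s, 0 ≤ s → s ≤ t → t ≤ T → ‖φ₂ t s 0‖ ≤ K₀ s)
    {x₀ : ℝ → E} (hx₀ : ContinuousOn x₀ (Icc 0 T)) :
    ∃ x : ℝ → E, ContinuousOn x (Icc 0 T) ∧
      (∀ᵐ t ∂(volume.restrict (Ioc 0 T)), x t = voltOp κ φ₁ φ₂ x₀ x t) ∧
      ∀ y : ℝ → E, ContinuousOn y (Icc 0 T) →
        (∀ᵐ t ∂(volume.restrict (Ioc 0 T)), y t = voltOp κ φ₁ φ₂ x₀ y t) →
        EqOn y x (Icc 0 T) := by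
  have h1L : MemLp (fun _ : ℝ => (1:ℝ)) (ENNReal.ofReal q) (volume.restrict (Ioc 0 T)) :=
    memLp_const 1
  -- growth bound
  have hgrow : ∀ x : ℝ → E, Continuous x → ∃ h : ℝ → ℝ, (∀ s, 0 ≤ h s) ∧
      MemLp h (ENNReal.ofReal r) (volume.restrict (Ioc 0 T)) ∧
      (∀ t s, 0 ≤ s → s ≤ t → t ≤ T → ‖φ₁ t s (x s)‖ ≤ h s) ∧
      (∀ t s, 0 ≤ s → s ≤ t → t ≤ T → ‖φ₂ t s (x s)‖ ≤ h s) := by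
    intro x hx
    obtain ⟨M, hM⟩ := (isCompact_Icc (a := (0:ℝ)) (b := T)).exists_bound_of_continuousOn
      hx.continuousOn
    have hM0 : 0 ≤ M := (norm_nonneg _).trans (hM 0 ⟨le_rfl, hT.le⟩)
    refine ⟨fun s => K₀ s + M * K s, fun s => add_nonneg (hK₀0 s) (mul_nonneg hM0 (hK0 s)),
      hK₀.add (hK.const_mul M), ?_, ?_⟩
    · intro t s h1 h2 h3
      have a := hl₁ t s h1 h2 h3 (x s) 0
      have b := hz₁ t s h1 h2 h3
      have c := norm_le_norm_add_norm_sub' (φ₁ t s (x s)) (φ₁ t s 0)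
      have e := mul_le_mul_of_nonneg_left (hM s ⟨h1, h2.trans h3⟩) (hK0 s)
      rw [sub_zero] at a
      linarith
    · intro t s h1 h2 h3
      have a := hl₂ t s h1 h2 h3 (x s) 0
      have b := hz₂ t s h1 h2 h3
      have c := norm_le_norm_add_norm_sub' (φ₂ t s (x s)) (φ₂ t s 0)
      have e := mul_le_mul_of_nonneg_left (hM s ⟨h1, h2.trans h3⟩) (hK0 s)
      rw [sub_zero] at a
      linarith
  -- continuity of the operator
  have hcont : ∀ x : ℝ → E, Continuous x → ContinuousOn (voltOp κ φ₁ φ₂ x₀ x) (Icc 0 T) := by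
    intro x hx
    obtain ⟨h, hh0, hh, hb₁, hb₂⟩ := hgrow x hx
    have c₁ := volt_cont hrq hκm hκc hκ0 hκ hh0 hh (fun t => hm₁ t x hx) hb₁ hω0 hω_cont
      (C := fun s => K' * (1 + ‖x s‖))
      (fun t t' s a b c d e => hω₁ t t' s a b c d e (x s))
    have c₂ := volt_cont hrq measurable_const continuousOn_const (fun _ _ => zero_le_one)
      h1L hh0 hh (fun t => hm₂ t x hx) hb₂ hω0 hω_cont
      (C := fun s => K' * (1 + ‖x s‖))
      (fun t t' s a b c d e => hω₂ t t' s a b c d e (x s))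
    simp only [one_smul] at c₂
    exact (hx₀.add c₁).add c₂
  -- integrability
  have hint₁ : ∀ x : ℝ → E, Continuous x → ∀ t ∈ Icc 0 T,
      IntegrableOn (fun s => κ (t - s) • φ₁ t s (x s)) (Ioc 0 t) := by
    intro x hx t ht
    obtain ⟨h, hh0, hh, hb₁, hb₂⟩ := hgrow x hx
    refine (volt_holder hrq hκ0 hκ hh0 hh ht).1.mono' ?_ ?_
    · exact ((hκm.comp (measurable_const.sub measurable_id)).stronglyMeasurable.smul
        (hm₁ t x hx)).aestronglyMeasurable
    · filter_upwards [ae_restrict_mem measurableSet_Ioc] with s hs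
      rw [norm_smul, Real.norm_of_nonneg (hκ0 _ (by linarith [hs.2]))]
      exact mul_le_mul_of_nonneg_left (hb₁ t s hs.1.le hs.2 ht.2) (hκ0 _ (by linarith [hs.2]))
  have hint₂ : ∀ x : ℝ → E, Continuous x → ∀ t ∈ Icc 0 T,
      IntegrableOn (fun s => φ₂ t s (x s)) (Ioc 0 t) := by
    intro x hx t ht
    obtain ⟨h, hh0, hh, hb₁, hb₂⟩ := hgrow x hx
    refine (volt_holder hrq (κ := fun _ => 1) (fun _ _ => zero_le_one) h1L hh0 hh ht).1.mono'
      (hm₂ t x hx).aestronglyMeasurable ?_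
    filter_upwards [ae_restrict_mem measurableSet_Ioc] with s hs
    rw [one_mul]
    exact hb₂ t s hs.1.le hs.2 ht.2
  -- choice of the weight
  obtain ⟨m, hmA⟩ : ∃ m : ℕ, (∫ τ in Ioc 0 T, (Real.exp (-(m * τ)) * (κ τ + 1)) ^ q) ^ (1 / q) *
      (∫ s in Ioc 0 T, K s ^ r) ^ (1 / r) < 1 / 2 := by
    have h1 := (volt_exp hrq (κ := fun τ => κ τ + 1) (hκm.add_const 1)
      (fun τ hτ => add_nonneg (hκ0 τ hτ) zero_le_one) (hκ.add h1L)).rpow_const (p := 1 / q)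
        (Or.inr (by have := hrq.symm.pos; positivity))
    rw [Real.zero_rpow (by have := hrq.symm.pos; positivity)] at h1
    have h2 := h1.mul_const ((∫ s in Ioc 0 T, K s ^ r) ^ (1 / r))
    rw [zero_mul] at h2
    exact (h2.eventually (gt_mem_nhds (by norm_num : (0:ℝ) < 1 / 2))).exists
  have hκe0 : ∀ τ, 0 ≤ τ → 0 ≤ Real.exp (-(m * τ)) * (κ τ + 1) := fun τ hτ =>
    mul_nonneg (Real.exp_nonneg _) (add_nonneg (hκ0 τ hτ) zero_le_one)
  have hκeL : MemLp (fun τ => Real.exp (-(m * τ)) * (κ τ + 1)) (ENNReal.ofReal q)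
      (volume.restrict (Ioc 0 T)) := by
    refine (hκ.add h1L).mono (Measurable.aestronglyMeasurable (by fun_prop)) ?_
    filter_upwards [ae_restrict_mem measurableSet_Ioc] with s hs
    have h0 := hκ0 s hs.1.le
    have h1 : 0 ≤ κ s + 1 := by linarith
    rw [Real.norm_of_nonneg (hκe0 _ hs.1.le), Pi.add_apply, Real.norm_of_nonneg h1]
    refine mul_le_of_le_one_left h1 (Real.exp_le_one_iff.2 ?_)
    have := hs.1
    have : 0 ≤ (m:ℝ) * s := by positivity
    linarith
  -- contraction estimate
  have hcontr : ∀ x y : ℝ → E, Continuous x → Continuous y → ∀ M : ℝ, 0 ≤ M →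
      (∀ s ∈ Icc 0 T, ‖x s - y s‖ ≤ Real.exp (m * s) * M) →
      ∀ t ∈ Icc 0 T, ‖voltOp κ φ₁ φ₂ x₀ x t - voltOp κ φ₁ φ₂ x₀ y t‖ ≤
        Real.exp (m * t) * (1 / 2 * M) := by
    intro x y hx hy M hM hxy t ht
    have e : voltOp κ φ₁ φ₂ x₀ x t - voltOp κ φ₁ φ₂ x₀ y t =
        ∫ s in Ioc 0 t, ((κ (t - s) • φ₁ t s (x s) - κ (t - s) • φ₁ t s (y s)) +
          (φ₂ t s (x s) - φ₂ t s (y s))) := by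
      have d₁ : Integrable (fun s => κ (t - s) • φ₁ t s (x s) - κ (t - s) • φ₁ t s (y s))
          (volume.restrict (Ioc 0 t)) := (hint₁ x hx t ht).sub (hint₁ y hy t ht)
      have d₂ : Integrable (fun s => φ₂ t s (x s) - φ₂ t s (y s))
          (volume.restrict (Ioc 0 t)) := (hint₂ x hx t ht).sub (hint₂ y hy t ht)
      rw [integral_add d₁ d₂,
        integral_sub (hint₁ x hx t ht) (hint₁ y hy t ht),
        integral_sub (hint₂ x hx t ht) (hint₂ y hy t ht)]
      unfold voltOp
      abel
    rw [e]
    obtain ⟨j1, j2⟩ := volt_holder hrq hκe0 hκeL hK0 hK ht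
    have h1 : ‖∫ s in Ioc 0 t, ((κ (t - s) • φ₁ t s (x s) - κ (t - s) • φ₁ t s (y s)) +
          (φ₂ t s (x s) - φ₂ t s (y s)))‖ ≤
        ∫ s in Ioc 0 t, (Real.exp (m * t) * M) *
          (Real.exp (-(m * (t - s))) * (κ (t - s) + 1) * K s) := by
      refine norm_integral_le_of_norm_le (j1.const_mul _) ?_
      filter_upwards [ae_restrict_mem measurableSet_Ioc] with s hs
      have h0 : 0 ≤ κ (t - s) := hκ0 _ (by linarith [hs.2])
      have hs' : s ∈ Icc 0 T := ⟨hs.1.le, hs.2.trans ht.2⟩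
      have a := hl₁ t s hs.1.le hs.2 ht.2 (x s) (y s)
      have b := hl₂ t s hs.1.le hs.2 ht.2 (x s) (y s)
      have c : K s * ‖x s - y s‖ ≤ K s * (Real.exp (m * s) * M) :=
        mul_le_mul_of_nonneg_left (hxy s hs') (hK0 s)
      have ee : Real.exp (m * s) = Real.exp (m * t) * Real.exp (-(m * (t - s))) := by
        rw [← Real.exp_add]; congr 1; ring
      calc _ ≤ ‖κ (t - s) • φ₁ t s (x s) - κ (t - s) • φ₁ t s (y s)‖ +
            ‖φ₂ t s (x s) - φ₂ t s (y s)‖ := norm_add_le _ _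
        _ = κ (t - s) * ‖φ₁ t s (x s) - φ₁ t s (y s)‖ + ‖φ₂ t s (x s) - φ₂ t s (y s)‖ := by
            rw [← smul_sub, norm_smul, Real.norm_of_nonneg h0]
        _ ≤ κ (t - s) * (K s * (Real.exp (m * s) * M)) + K s * (Real.exp (m * s) * M) := by
            gcongr
            · exact a.trans c
            · exact b.trans c
        _ = _ := by rw [ee]; ring
    refine h1.trans ?_
    rw [integral_const_mul]
    calc _ ≤ (Real.exp (m * t) * M) * (1 / 2) :=
          mul_le_mul_of_nonneg_left (j2.trans hmA.le) (by positivity)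
      _ = _ := by ring
  -- the fixed point argument
  let ext : C(Icc (0:ℝ) T, E) → ℝ → E := fun z s => Real.exp (m * s) • IccExtend hT.le z s
  have hext : ∀ z, Continuous (ext z) := fun z => by
    have := z.continuous.Icc_extend' (h := hT.le)
    fun_prop
  let Ψ : C(Icc (0:ℝ) T, E) → C(Icc (0:ℝ) T, E) := fun z =>
    ⟨fun t => Real.exp (-(m * (t:ℝ))) • voltOp κ φ₁ φ₂ x₀ (ext z) t, by
      have := continuousOn_iff_continuous_domRestrict.1 (hcont _ (hext z))
      have h2 : Continuous fun t : Icc (0:ℝ) T => voltOp κ φ₁ φ₂ x₀ (ext z) t := this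
      fun_prop⟩
  have hΨ : ContractingWith (1 / 2) Ψ := by
    refine ⟨by rw [← NNReal.coe_lt_coe]; norm_num, LipschitzWith.of_dist_le_mul fun z w => ?_⟩
    rw [ContinuousMap.dist_le (by positivity)]
    intro t
    have h1 := hcontr (ext z) (ext w) (hext z) (hext w) (dist z w) dist_nonneg (by
      intro s hs
      simp only [ext]
      rw [← smul_sub, norm_smul, Real.norm_of_nonneg (Real.exp_nonneg _),
        IccExtend_of_mem hT.le _ hs, IccExtend_of_mem hT.le _ hs, ← dist_eq_norm]
      exact mul_le_mul_of_nonneg_left (ContinuousMap.dist_apply_le_dist _) (Real.exp_nonneg _))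
      t t.2
    change dist (Real.exp (-(m * (t:ℝ))) • voltOp κ φ₁ φ₂ x₀ (ext z) t)
      (Real.exp (-(m * (t:ℝ))) • voltOp κ φ₁ φ₂ x₀ (ext w) t) ≤ _
    rw [dist_eq_norm, ← smul_sub, norm_smul, Real.norm_of_nonneg (Real.exp_nonneg _)]
    calc _ ≤ Real.exp (-(m * (t:ℝ))) * (Real.exp (m * t) * (1 / 2 * dist z w)) :=
          mul_le_mul_of_nonneg_left h1 (Real.exp_nonneg _)
      _ = _ := by
        rw [← mul_assoc, ← Real.exp_add]; simp
  have hcongr : ∀ x y : ℝ → E, EqOn x y (Icc 0 T) → ∀ t ∈ Icc 0 T,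
      voltOp κ φ₁ φ₂ x₀ x t = voltOp κ φ₁ φ₂ x₀ y t := by
    intro x y hxy t ht
    have hs : ∀ s ∈ Ioc 0 t, x s = y s := fun s hs => hxy ⟨hs.1.le, hs.2.trans ht.2⟩
    unfold voltOp
    congr 1
    · congr 1
      exact setIntegral_congr_fun measurableSet_Ioc fun s h => by simp only [hs s h]
    · exact setIntegral_congr_fun measurableSet_Ioc fun s h => by simp only [hs s h]
  have : Nonempty C(Icc (0:ℝ) T, E) := ⟨0⟩
  let z := hΨ.fixedPoint Ψ
  have hz : Ψ z = z := hΨ.fixedPoint_isFixedPt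
  refine ⟨ext z, (hext z).continuousOn, ?_, ?_⟩
  · filter_upwards [ae_restrict_mem measurableSet_Ioc] with t ht
    have ht' : t ∈ Icc 0 T := ⟨ht.1.le, ht.2⟩
    have h1 := congrArg (fun w : C(Icc (0:ℝ) T, E) => w ⟨t, ht'⟩) hz
    have h2 : Real.exp (-(m * t)) • voltOp κ φ₁ φ₂ x₀ (ext z) t = z ⟨t, ht'⟩ := h1
    have h3 : ext z t = Real.exp (m * t) • z ⟨t, ht'⟩ := by
      simp only [ext]; rw [IccExtend_of_mem hT.le _ ht']
    rw [h3, ← h2, smul_smul, ← Real.exp_add]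
    simp
  · intro y hy hsol
    let w : C(Icc (0:ℝ) T, E) := ⟨fun t => Real.exp (-(m * (t:ℝ))) • y t, by
      have h2 : Continuous fun t : Icc (0:ℝ) T => y t := continuousOn_iff_continuous_domRestrict.1 hy
      have h3 : Continuous fun t : Icc (0:ℝ) T => Real.exp (-(m * (t:ℝ))) := by fun_prop
      exact h3.smul h2⟩
    have hwy : EqOn y (ext w) (Icc 0 T) := by
      intro t ht
      simp only [ext]; rw [IccExtend_of_mem hT.le _ ht]
      change y t = Real.exp (m * t) • (Real.exp (-(m * t)) • y t)
      rw [smul_smul, ← Real.exp_add]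
      simp
    have hyc : ContinuousOn (voltOp κ φ₁ φ₂ x₀ y) (Icc 0 T) :=
      (hcont _ (hext w)).congr (hcongr _ _ hwy)
    have heq : EqOn y (voltOp κ φ₁ φ₂ x₀ y) (Icc 0 T) := by
      have hae : y =ᵐ[volume.restrict (Icc 0 T)] voltOp κ φ₁ φ₂ x₀ y := by
        rw [← Measure.restrict_congr_set Ioc_ae_eq_Icc]
        exact hsol
      exact Measure.eqOn_Icc_of_ae_eq volume hT.ne hae hy hyc
    have hw : Ψ w = w := by
      ext1 t
      change Real.exp (-(m * (t:ℝ))) • voltOp κ φ₁ φ₂ x₀ (ext w) t =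
        Real.exp (-(m * (t:ℝ))) • y t
      rw [← hcongr _ _ hwy t t.2, ← heq t.2]
    have hwz : w = z := hΨ.fixedPoint_unique hw
    rw [← hwz]
    exact hwy

/-- Lemma B.2: under Assumption A, if the (time-dependent) initial condition
`x₀` is continuous, then for every admissible control the generalized Volterra equation admits a
unique solution in `C([0,T];ℝⁿ)`. -/
theorem generalized_volterra_continuity
    {n d : ℕ} (T : ℝ) (hT : 0 < T) (α : ℝ) (hα : α ∈ Set.Ioo (0:ℝ) 1)
    (p : ℝ) (hp1 : 1 ≤ p) (hp : 1 / α < p)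
    (U : Set (Euc d)) (u₀ : Euc d) (hu₀U : u₀ ∈ U)
    (f g : ℝ → ℝ → Euc n → Euc d → Euc n)
    (hf_meas : Measurable fun q : ℝ × ℝ × Euc n × Euc d => f q.1 q.2.1 q.2.2.1 q.2.2.2)
    (hg_meas : Measurable fun q : ℝ × ℝ × Euc n × Euc d => g q.1 q.2.1 q.2.2.1 q.2.2.2)
    -- Assumption A: continuity in the outer time variable
    (K' : ℝ) (hK'0 : 0 ≤ K')
    (ω : ℝ → ℝ) (hω_incr : MonotoneOn ω (Set.Ici 0)) (hω_nonneg : ∀ r, 0 ≤ ω r)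
    (hω0 : ω 0 = 0) (hω_cont : ContinuousWithinAt ω (Set.Ici 0) 0)
    (hA_t : ∀ t t' s : ℝ, 0 ≤ s → s ≤ t → t ≤ T → s ≤ t' → t' ≤ T →
      ∀ (x : Euc n) (u : Euc d), u ∈ U →
        ‖f t s x u - f t' s x u‖ + ‖g t s x u - g t' s x u‖ ≤ K' * ω |t - t'| * (1 + ‖x‖))
    -- Assumption A: Lipschitz-type conditions
    (K₀ K : ℝ → ℝ) (hK₀_nonneg : ∀ s, 0 ≤ K₀ s) (hK_nonneg : ∀ s, 0 ≤ K s)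
    (hK₀_meas : Measurable K₀) (hK_meas : Measurable K)
    (r₀ : ℝ) (hr₀ : 1 / α < r₀) (hK₀_L : IntegrableOn (fun s => K₀ s ^ r₀) (Set.Ioc 0 T))
    (r₁ : ℝ) (hr₁ : p / (α * p - 1) < r₁) (hK_L : IntegrableOn (fun s => K s ^ r₁) (Set.Ioc 0 T))
    (hA_lip : ∀ t s : ℝ, 0 ≤ s → s ≤ t → t ≤ T →
      ∀ (x x' : Euc n) (u u' : Euc d), u ∈ U → u' ∈ U →
        ‖f t s x u - f t s x' u'‖ + ‖g t s x u - g t s x' u'‖ ≤ K s * (‖x - x'‖ + ‖u - u'‖))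
    (hA_zero : ∀ t s : ℝ, 0 ≤ s → s ≤ t → t ≤ T → ∀ u : Euc d, u ∈ U →
      ‖f t s 0 u‖ + ‖g t s 0 u‖ ≤ K₀ s) :
    ∀ x₀ : ℝ → Euc n, ContinuousOn x₀ (Set.Icc 0 T) →
      ∀ u : ℝ → Euc d, Admissible T p U u₀ u →
        ∃ x : ℝ → Euc n,
          ContinuousOn x (Set.Icc 0 T) ∧
          IsSolutionGen T α f g x₀ u x ∧
          (∀ y : ℝ → Euc n, ContinuousOn y (Set.Icc 0 T) → IsSolutionGen T α f g x₀ u y →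
            Set.EqOn y x (Set.Icc 0 T)) := by
  intro x₀ hx₀ u hu
  obtain ⟨hum, huU, -⟩ := hu
  obtain ⟨hα0, hα1⟩ := hα
  have hinv : 1 < 1 / α := by rw [lt_div_iff₀ hα0]; linarith
  have hαp : 1 < α * p := by rw [div_lt_iff₀ hα0] at hp; linarith
  have hr₁' : 1 / α < r₁ := by
    refine lt_trans ?_ hr₁
    rw [div_lt_div_iff₀ hα0 (by linarith)]
    linarith
  obtain ⟨r, hr, hrr₀, hrr₁⟩ : ∃ r, 1 / α < r ∧ r ≤ r₀ ∧ r ≤ r₁ :=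
    ⟨min r₀ r₁, lt_min hr₀ hr₁', min_le_left _ _, min_le_right _ _⟩
  have hr1 : 1 < r := hinv.trans hr
  have hrq : r.HolderConjugate (r.conjExponent) := Real.HolderConjugate.conjExponent hr1
  have hLp : ∀ (k : ℝ → ℝ) (ρ : ℝ), Measurable k → (∀ s, 0 ≤ k s) → r ≤ ρ →
      IntegrableOn (fun s => k s ^ ρ) (Ioc 0 T) →
      MemLp k (ENNReal.ofReal r) (volume.restrict (Ioc 0 T)) := by
    intro k ρ hk hk0 hρ hi
    have hρ0 : 0 < ρ := by linarith
    have : MemLp k (ENNReal.ofReal ρ) (volume.restrict (Ioc 0 T)) := by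
      rw [← integrable_norm_rpow_iff hk.aestronglyMeasurable (by simpa using hρ0) (by simp),
        ENNReal.toReal_ofReal hρ0.le]
      refine hi.congr ?_
      filter_upwards with s
      rw [Real.norm_of_nonneg (hk0 s)]
    exact this.mono_exponent (ENNReal.ofReal_le_ofReal hρ)
  have hκm : Measurable fun τ : ℝ => τ ^ (α - 1) := by fun_prop
  have hκ : MemLp (fun τ : ℝ => τ ^ (α - 1)) (ENNReal.ofReal r.conjExponent)
      (volume.restrict (Ioc 0 T)) := by
    have hq0 := hrq.symm.pos
    rw [← integrable_norm_rpow_iff hκm.aestronglyMeasurable (by simpa using hq0) (by simp),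
        ENNReal.toReal_ofReal hq0.le]
    have hexp : -1 < (α - 1) * r.conjExponent := by
      unfold Real.conjExponent
      rw [div_lt_iff₀ hα0] at hr
      rw [mul_div_assoc', lt_div_iff₀ (by linarith)]
      nlinarith
    have h1 := (intervalIntegral.intervalIntegrable_rpow' (a := 0) (b := T) hexp)
    rw [intervalIntegrable_iff_integrableOn_Ioc_of_le hT.le] at h1
    refine h1.congr ?_
    filter_upwards [ae_restrict_mem measurableSet_Ioc] with s hs
    rw [Real.norm_of_nonneg (Real.rpow_nonneg hs.1.le _), ← Real.rpow_mul hs.1.le]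
  have hmeas : ∀ φ : ℝ → ℝ → Euc n → Euc d → Euc n,
      (Measurable fun q : ℝ × ℝ × Euc n × Euc d => φ q.1 q.2.1 q.2.2.1 q.2.2.2) →
      ∀ t (x : ℝ → Euc n), Continuous x → StronglyMeasurable fun s => φ t s (x s) (u s) := by
    intro φ hφ t x hx
    have h1 : Measurable fun s => (t, s, x s, u s) :=
      measurable_const.prodMk (measurable_id.prodMk (hx.measurable.prodMk hum))
    exact (hφ.comp h1).stronglyMeasurable
  have hmain := volt_main (E := Euc n) hT hrq (κ := fun τ => τ ^ (α - 1)) hκm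
    (fun τ hτ => (Real.continuousAt_rpow_const _ _ (Or.inl (ne_of_gt hτ))).continuousWithinAt)
    (fun τ hτ => Real.rpow_nonneg hτ _) hκ hK₀_nonneg hK_nonneg
    (hLp K₀ r₀ hK₀_meas hK₀_nonneg hrr₀ hK₀_L) (hLp K r₁ hK_meas hK_nonneg hrr₁ hK_L)
    (φ₁ := fun t s x => f t s x (u s)) (φ₂ := fun t s x => g t s x (u s))
    (hmeas f hf_meas) (hmeas g hg_meas) hω0 hω_cont (K' := K')
    (fun t t' s a b c e k x => by
      have := hA_t t t' s a b c e k x (u s) (huU s)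
      have := norm_nonneg (g t s x (u s) - g t' s x (u s))
      linarith)
    (fun t t' s a b c e k x => by
      have := hA_t t t' s a b c e k x (u s) (huU s)
      have := norm_nonneg (f t s x (u s) - f t' s x (u s))
      linarith)
    (fun t s a b c x x' => by
      have := hA_lip t s a b c x x' (u s) (u s) (huU s) (huU s)
      rw [sub_self, norm_zero, add_zero] at this
      have := norm_nonneg (g t s x (u s) - g t s x' (u s))
      linarith)
    (fun t s a b c x x' => by
      have := hA_lip t s a b c x x' (u s) (u s) (huU s) (huU s)
      rw [sub_self, norm_zero, add_zero] at this
      have := norm_nonneg (f t s x (u s) - f t s x' (u s))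
      linarith)
    (fun t s a b c => by
      have := hA_zero t s a b c (u s) (huU s)
      have := norm_nonneg (g t s 0 (u s))
      linarith)
    (fun t s a b c => by
      have := hA_zero t s a b c (u s) (huU s)
      have := norm_nonneg (f t s 0 (u s))
      linarith)
    hx₀
  exact hmain
end
end

section
/- (Spike-variation set lemma, singular version.) Let T > 0, α ∈ (0,1) and p > 1/α. Suppose ψ : Δ → ℝ satisfies |ψ(0,s)| ≤ ψ̄(s) for all s ∈ [0,T] and |ψ(t,s) − ψ(t′,s)| ≤ ω(|t−t′|)ψ̄(s) for all (t,s),(t′,s) ∈ Δ, where ψ̄ ∈ Lᵖ([0,T];ℝ) is nonnegative and ω is a modulus of continuity. Then for every δ ∈ (0,1) there exists a measurable set E_δ ⊆ [0,T] with Lebesgue measure |E_δ| = δT such that sup_{t∈[0,T]} |∫₀ᵗ ((1/δ)·1_{E_δ}(s) − 1) ψ(t,s)/(t−s)^{1−α} ds| ≤ δ. -/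
open MeasureTheory Set

noncomputable section

lemma exists_frac (T : ℝ) (hT : 0 < T) (δ : ℝ) (hδ : δ ∈ Set.Ioo (0:ℝ) 1) (B : Set ℝ)
    (hB : MeasurableSet B) (hBT : B ⊆ Ioc 0 T) :
    ∃ E, MeasurableSet E ∧ E ⊆ B ∧ volume.real E = δ * volume.real B := by
  have hint : Integrable (B.indicator (fun _ => (1:ℝ))) := by
    rw [integrable_indicator_iff hB]
    exact integrableOn_const (ne_of_lt (lt_of_le_of_lt (measure_mono hBT) (by simp)))
  have hF : ∀ x, 0 ≤ x → ∫ s in (0:ℝ)..x, B.indicator (fun _ => (1:ℝ)) s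
      = volume.real (B ∩ Ioc 0 x) := by
    intro x hx
    rw [intervalIntegral.integral_of_le hx, setIntegral_indicator hB, inter_comm]
    simp
  have hc : Continuous fun x => ∫ s in (0:ℝ)..x, B.indicator (fun _ => (1:ℝ)) s :=
    intervalIntegral.continuous_primitive (fun a b => hint.intervalIntegrable) 0
  have hBB : B ∩ Ioc 0 T = B := inter_eq_left.mpr hBT
  have hmem : δ * volume.real B ∈ Icc (∫ s in (0:ℝ)..0, B.indicator (fun _ => (1:ℝ)) s)
      (∫ s in (0:ℝ)..T, B.indicator (fun _ => (1:ℝ)) s) := by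
    rw [hF T hT.le, hBB]
    have : 0 ≤ volume.real B := measureReal_nonneg
    simp only [intervalIntegral.integral_same]
    exact ⟨mul_nonneg hδ.1.le this, by nlinarith [hδ.2]⟩
  obtain ⟨x, hx, hxe⟩ := intermediate_value_Icc hT.le hc.continuousOn hmem
  exact ⟨B ∩ Ioc 0 x, hB.inter measurableSet_Ioc, inter_subset_left, by rw [← hF x hx.1]; exact hxe⟩

/-- the oscillating weight -/
def hh (δ : ℝ) (E : Set ℝ) (s : ℝ) : ℝ := (1 / δ) * Set.indicator E (fun _ => (1:ℝ)) s - 1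

lemma hh_meas (δ : ℝ) {E : Set ℝ} (hE : MeasurableSet E) : Measurable (hh δ E) := by
  unfold hh
  exact ((measurable_const.indicator hE).const_mul _).sub_const _

lemma hh_bound {δ : ℝ} (hδ : δ ∈ Set.Ioo (0:ℝ) 1) (E : Set ℝ) (s : ℝ) : |hh δ E s| ≤ 1 / δ := by
  have h1 : 1 ≤ 1 / δ := by rw [le_div_iff₀ hδ.1]; linarith [hδ.2]
  unfold hh
  by_cases h : s ∈ E
  · simp only [h, indicator_of_mem]; rw [abs_le]; constructor <;> linarith
  · simp only [h, not_false_eq_true, indicator_of_notMem]; rw [abs_le]; constructor <;> linarith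

lemma hh_congr {δ : ℝ} {E E' : Set ℝ} {s : ℝ} (h : s ∈ E ↔ s ∈ E') : hh δ E s = hh δ E' s := by
  unfold hh
  by_cases h' : s ∈ E
  · simp [h', h.1 h']
  · have h'' : s ∉ E' := fun h'' => h' (h.2 h'')
    simp [h', h'']

lemma hh_mul_int {δ : ℝ} (hδ : δ ∈ Set.Ioo (0:ℝ) 1) {E : Set ℝ} (hE : MeasurableSet E)
    {f : ℝ → ℝ} {μ : Measure ℝ} (hf : Integrable f μ) :
    Integrable (fun s => hh δ E s * f s) μ :=
  hf.bdd_mul (c := 1 / δ) (hh_meas δ hE).aestronglyMeasurable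
    (Filter.Eventually.of_forall fun s => by simpa using hh_bound hδ E s)

lemma glue (T : ℝ) (δ : ℝ) (hδ : δ ∈ Set.Ioo (0:ℝ) 1) {ι : Type*} [Countable ι]
    (A : Set ℝ) (hAT : A ⊆ Ioc 0 T) (B E : ι → Set ℝ) (hB : ∀ i, MeasurableSet (B i))
    (hdisj : Pairwise (fun i j => Disjoint (B i) (B j)))
    (hA : ⋃ i, B i = A) (hE : ∀ i, MeasurableSet (E i)) (hEB : ∀ i, E i ⊆ B i)
    (hv : ∀ i, volume.real (E i) = δ * volume.real (B i)) :
    MeasurableSet (⋃ i, E i) ∧ (⋃ i, E i) ⊆ A ∧ volume.real (⋃ i, E i) = δ * volume.real A ∧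
    ∀ i, ∀ s ∈ B i, (s ∈ (⋃ i, E i) ↔ s ∈ E i) := by
  refine ⟨MeasurableSet.iUnion hE, by rw [← hA]; exact iUnion_mono hEB, ?_, ?_⟩
  · have hd' : Pairwise (fun i j => Disjoint (E i) (E j)) :=
      fun i j hij => (hdisj hij).mono (hEB i) (hEB j)
    have hfin : volume A ≠ ⊤ := ne_of_lt (lt_of_le_of_lt (measure_mono hAT) (by simp))
    have hBfin : ∀ i, volume (B i) ≠ ⊤ := fun i =>
      ne_top_of_le_ne_top hfin (measure_mono (by rw [← hA]; exact subset_iUnion B i))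
    have hv' : ∀ i, volume (E i) = ENNReal.ofReal δ * volume (B i) := by
      intro i
      have hEfin : volume (E i) ≠ ⊤ := ne_top_of_le_ne_top (hBfin i) (measure_mono (hEB i))
      rw [← ENNReal.ofReal_toReal hEfin, ← ENNReal.ofReal_toReal (hBfin i),
        ← ENNReal.ofReal_mul hδ.1.le]
      congr 1
      exact hv i
    rw [measureReal_def, measure_iUnion hd' hE]
    simp_rw [hv']
    rw [ENNReal.tsum_mul_left, ← measure_iUnion hdisj hB, hA, ENNReal.toReal_mul,
      ENNReal.toReal_ofReal hδ.1.le]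
    rfl
  · intro i s hs
    refine ⟨fun h => ?_, fun h => mem_iUnion_of_mem i h⟩
    obtain ⟨j, hj⟩ := mem_iUnion.1 h
    by_cases hij : i = j
    · rwa [hij]
    · exact absurd (hEB j hj) (disjoint_left.1 (hdisj hij) hs)

lemma lemB (T : ℝ) (hT : 0 < T) (δ : ℝ) (hδ : δ ∈ Set.Ioo (0:ℝ) 1) (A : Set ℝ)
    (hA : MeasurableSet A) (hAT : A ⊆ Ioc 0 T) (m : ℕ) (f : Fin m → ℝ → ℝ)
    (hf : ∀ i, Measurable (f i)) (hfi : ∀ i, IntegrableOn (f i) A) (ε : ℝ) (hε : 0 < ε) :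
    ∃ E, MeasurableSet E ∧ E ⊆ A ∧ volume.real E = δ * volume.real A ∧
      ∀ i, |∫ s in A, hh δ E s * f i s| ≤ ε := by
  have hV : 0 ≤ volume.real A := measureReal_nonneg
  set e : ℝ := ε * δ / (volume.real A + 1) with he
  have he0 : 0 < e := by have := hδ.1; positivity
  let π : ℝ → (Fin m → ℤ) := fun s i => ⌊f i s / e⌋
  have hπ : Measurable π := measurable_pi_iff.2 fun i => ((hf i).div_const e).floor
  let B : (Fin m → ℤ) → Set ℝ := fun k => A ∩ π ⁻¹' {k}
  have hB : ∀ k, MeasurableSet (B k) := fun k => hA.inter (hπ (measurableSet_singleton k))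
  have hBA : ∀ k, B k ⊆ A := fun k => inter_subset_left
  have hdisj : Pairwise (fun i j => Disjoint (B i) (B j)) := by
    intro i j hij
    refine disjoint_left.2 fun s hs hs' => hij ?_
    exact hs.2.symm.trans hs'.2
  have hU : ⋃ i, B i = A := by
    ext s; simp [B]
  choose E hE hEB hEv using fun k => exists_frac T hT δ hδ (B k) (hB k) ((hBA k).trans hAT)
  obtain ⟨h1, h2, h3, h4⟩ := glue T δ hδ A hAT B E hB hdisj hU hE hEB hEv
  refine ⟨_, h1, h2, h3, fun i => ?_⟩
  set F := ⋃ i, E i with hF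
  have hfin : volume A ≠ ⊤ := ne_of_lt (lt_of_le_of_lt (measure_mono hAT) (by simp))
  have hBfin : ∀ i, volume (B i) ≠ ⊤ := fun i =>
    ne_top_of_le_ne_top hfin (measure_mono (hBA i))
  have hint : IntegrableOn (fun s => hh δ F s * f i s) A := hh_mul_int hδ h1 (hfi i)
  have hsum := hasSum_integral_iUnion hB hdisj (μ := volume) (f := fun s => hh δ F s * f i s)
    (by rw [hU]; exact hint)
  have hsumV := hasSum_integral_iUnion hB hdisj (μ := volume) (f := fun s => 1 / δ * e)
    (by rw [hU]; exact integrableOn_const hfin)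
  rw [hU] at hsum hsumV
  have hzero : ∀ k, ∫ s in B k, hh δ F s = 0 := by
    intro k
    have : ∫ s in B k, hh δ F s = ∫ s in B k, hh δ (E k) s :=
      setIntegral_congr_fun (hB k) fun s hs => hh_congr (h4 k s hs)
    rw [this]
    unfold hh
    rw [integral_sub, integral_const_mul, setIntegral_indicator (hE k),
      inter_eq_right.2 (hEB k)]
    · simp only [integral_const, MeasurableSet.univ, measureReal_restrict_apply, univ_inter,
        smul_eq_mul, mul_one, hEv]
      have := hδ.1.ne'
      field_simp
      ring
    · refine Integrable.const_mul ?_ _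
      refine IntegrableOn.indicator (integrableOn_const (hBfin k)) (hE k)
    · exact integrableOn_const (hBfin k)
  have hbd : ∀ k, ‖∫ s in B k, hh δ F s * f i s‖ ≤ ∫ s in B k, 1 / δ * e := by
    intro k
    have hc : IntegrableOn (hh δ F) (B k) := by
      have := hh_mul_int hδ h1 (f := fun _ => 1) (μ := volume.restrict (B k))
        (integrableOn_const (hBfin k))
      simp only [mul_one] at this
      exact this
    have : ∫ s in B k, hh δ F s * f i s = ∫ s in B k, hh δ F s * (f i s - e * k i) := by
      have h5 : ∀ s, hh δ F s * (f i s - e * k i) = hh δ F s * f i s - hh δ F s * (e * k i) :=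
        fun s => by ring
      simp_rw [h5]
      rw [integral_sub (hint.mono_set (hBA k)) (hc.mul_const _), integral_mul_const, hzero]
      simp
    rw [this]
    refine (norm_setIntegral_le_of_norm_le_const (hBfin k).lt_top (C := 1 / δ * e) ?_).trans_eq ?_
    · intro s hs
      have hk : ⌊f i s / e⌋ = k i := congrFun hs.2 i
      rw [norm_mul]
      refine mul_le_mul (hh_bound hδ F s) ?_ (norm_nonneg _) (by have := hδ.1; positivity)
      have a1 := Int.floor_le (f i s / e)
      have a2 := Int.lt_floor_add_one (f i s / e)
      rw [hk] at a1 a2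
      rw [le_div_iff₀ he0] at a1
      rw [div_lt_iff₀ he0] at a2
      rw [Real.norm_eq_abs, abs_le]
      constructor <;> nlinarith
    · simp [mul_comm]
  have hfinal := tsum_of_norm_bounded hsumV hbd
  rw [hsum.tsum_eq] at hfinal
  refine hfinal.trans ?_
  simp only [integral_const, MeasurableSet.univ, measureReal_restrict_apply, univ_inter,
        smul_eq_mul]
  rw [he]
  have := hδ.1
  have h6 : volume.real A * (1 / δ * (ε * δ / (volume.real A + 1)))
    = ε * (volume.real A / (volume.real A + 1)) := by field_simp
  rw [h6]
  have : volume.real A / (volume.real A + 1) ≤ 1 := by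
    rw [div_le_one (by positivity)]; linarith
  nlinarith

lemma ker_int (α : ℝ) (hα : α ∈ Set.Ioo (0:ℝ) 1) (u t : ℝ) (hu : 0 ≤ u) (hut : u ≤ t) :
    Integrable ((Ioo 0 u).indicator (fun s : ℝ => (t - s) ^ (α - 1))) ∧
    ∫ s, (Ioo 0 u).indicator (fun s : ℝ => (t - s) ^ (α - 1)) s = (t ^ α - (t - u) ^ α) / α := by
  have hi : IntervalIntegrable (fun s : ℝ => (t - s) ^ (α - 1)) volume 0 u := by
    have := (intervalIntegral.intervalIntegrable_rpow' (a := t - 0) (b := t - u) (r := α - 1)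
      (by linarith [hα.1])).comp_sub_left t
    simpa using this
  constructor
  · rw [integrable_indicator_iff measurableSet_Ioo, ← integrableOn_Ioc_iff_integrableOn_Ioo]
    exact (intervalIntegrable_iff_integrableOn_Ioc_of_le hu).1 hi
  · rw [integral_indicator measurableSet_Ioo, ← integral_Ioc_eq_integral_Ioo,
      ← intervalIntegral.integral_of_le hu,
      intervalIntegral.integral_comp_sub_left (fun x => x ^ (α - 1)) t,
      integral_rpow (Or.inl (by linarith [hα.1]))]
    simp

/-- the cut-off kernel -/
def phi (α : ℝ) (ψ : ℝ → ℝ → ℝ) (t : ℝ) : ℝ → ℝ :=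
  (Ioo 0 t).indicator (fun s => ψ t s * (t - s) ^ (α - 1))

lemma phi_meas (α : ℝ) (ψ : ℝ → ℝ → ℝ) (hψ : Measurable (Function.uncurry ψ)) (t : ℝ) :
    Measurable (phi α ψ t) := by
  unfold phi
  refine Measurable.indicator ?_ measurableSet_Ioo
  have h1 : Measurable (fun s => ψ t s) := hψ.comp measurable_prodMk_left
  exact h1.mul ((measurable_const.sub measurable_id).pow_const _)

lemma phi_int (T α K : ℝ) (hα : α ∈ Set.Ioo (0:ℝ) 1) (ψ : ℝ → ℝ → ℝ)
    (hψ : Measurable (Function.uncurry ψ)) (A : Set ℝ) (hA : MeasurableSet A)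
    (hK : ∀ s ∈ A, ∀ t, s ≤ t → t ≤ T → |ψ t s| ≤ K)
    (t : ℝ) (ht : t ∈ Icc 0 T) : IntegrableOn (phi α ψ t) A := by
  refine Integrable.mono' (g := fun s => K * (Ioo 0 t).indicator (fun s : ℝ => (t - s) ^ (α - 1)) s)
    (((ker_int α hα t t ht.1 le_rfl).1.const_mul K).integrableOn)
    (phi_meas α ψ hψ t).aestronglyMeasurable ?_
  filter_upwards [ae_restrict_mem hA] with s hs
  unfold phi
  by_cases h : s ∈ Ioo 0 t
  · simp only [h, indicator_of_mem, norm_mul]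
    have h1 : 0 ≤ (t - s) ^ (α - 1) := Real.rpow_nonneg (by linarith [h.2]) _
    rw [Real.norm_of_nonneg h1]
    exact mul_le_mul_of_nonneg_right (hK s hs t h.2.le ht.2) h1
  · simp [h]

lemma phi_diff (T δ α K : ℝ) (hδ : δ ∈ Set.Ioo (0:ℝ) 1) (hα : α ∈ Set.Ioo (0:ℝ) 1) (hK0 : 0 ≤ K)
    (ψ : ℝ → ℝ → ℝ)
    (hψ : Measurable (Function.uncurry ψ)) (A : Set ℝ) (hA : MeasurableSet A)
    (hK : ∀ s ∈ A, ∀ t, s ≤ t → t ≤ T → |ψ t s| ≤ K) (ω : ℝ → ℝ) (hω_nonneg : ∀ r, 0 ≤ ω r)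
    (hlip : ∀ s ∈ A, ∀ t t', s ≤ t → t ≤ T → s ≤ t' → t' ≤ T →
      |ψ t s - ψ t' s| ≤ ω |t - t'| * K) (E : Set ℝ) (hE : MeasurableSet E)
    (u t : ℝ) (hu : 0 ≤ u) (hut : u ≤ t) (ht : t ≤ T) :
    |(∫ s in A, hh δ E s * phi α ψ t s) - ∫ s in A, hh δ E s * phi α ψ u s| ≤
      1 / δ * (K / α * (ω (t - u) * T ^ α + 2 * (t - u) ^ α)) := by
  have hα0 := hα.1
  have hδ0 := hδ.1
  obtain ⟨i1, e1⟩ := ker_int α hα t t (hu.trans hut) le_rfl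
  obtain ⟨i2, e2⟩ := ker_int α hα u t hu hut
  obtain ⟨i3, e3⟩ := ker_int α hα u u hu le_rfl
  set k1 := (Ioo 0 t).indicator (fun s : ℝ => (t - s) ^ (α - 1)) with hk1
  set k2 := (Ioo 0 u).indicator (fun s : ℝ => (t - s) ^ (α - 1)) with hk2
  set k3 := (Ioo 0 u).indicator (fun s : ℝ => (u - s) ^ (α - 1)) with hk3
  have h21 : ∀ s, k2 s ≤ k1 s := by
    intro s
    simp only [hk1, hk2]
    by_cases h : s ∈ Ioo 0 u
    · have hst : s ∈ Ioo 0 t := ⟨h.1, h.2.trans_le hut⟩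
      simp only [h, hst, indicator_of_mem, le_refl]
    · simp only [h, not_false_eq_true, indicator_of_notMem]
      exact indicator_nonneg (fun s hs => Real.rpow_nonneg (by linarith [hs.2]) _) s
  have h23 : ∀ s, k2 s ≤ k3 s := by
    intro s
    simp only [hk2, hk3]
    by_cases h : s ∈ Ioo 0 u
    · simp only [h, indicator_of_mem]
      exact Real.rpow_le_rpow_of_nonpos (by linarith [h.2]) (by linarith) (by linarith [hα.2])
    · simp [h]
  have h1 : ∀ s, 0 ≤ k1 s := by
    intro s
    refine indicator_nonneg (fun s hs => Real.rpow_nonneg (by linarith [hs.2]) _) s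
  let G : ℝ → ℝ := fun s => 1 / δ * (ω (t - u) * K * k1 s + K * (k3 s - k2 s) + K * (k1 s - k2 s))
  have hGi : Integrable G :=
    ((((i1.const_mul _).add ((i3.sub i2).const_mul _)).add ((i1.sub i2).const_mul _)).const_mul _)
  have hG0 : ∀ s, 0 ≤ G s := by
    intro s
    have := h21 s
    have := h23 s
    have := h1 s
    have := hω_nonneg (t - u)
    have a1 : 0 ≤ k3 s - k2 s := by linarith
    have a2 : 0 ≤ k1 s - k2 s := by linarith
    simp only [G]
    positivity
  have ji : ∀ v ∈ Icc 0 T, IntegrableOn (fun s => hh δ E s * phi α ψ v s) A := fun v hv =>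
    hh_mul_int hδ hE (phi_int T α K hα ψ hψ A hA hK v hv)
  rw [← integral_sub (ji t ⟨hu.trans hut, ht⟩) (ji u ⟨hu, hut.trans ht⟩)]
  have hGe : ∫ s, G s = 1 / δ * (ω (t - u) * K * (t ^ α / α)
      + K * (u ^ α / α - (t ^ α - (t - u) ^ α) / α) + K * (t ^ α / α - (t ^ α - (t - u) ^ α) / α)) := by
    simp only [G]
    have z : (0:ℝ) ^ α = 0 := Real.zero_rpow hα0.ne'
    simp only [sub_self, z, sub_zero] at e1 e3
    rw [integral_const_mul, integral_add, integral_add, integral_const_mul, integral_const_mul,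
      integral_const_mul, integral_sub i3 i2, integral_sub i1 i2, e1, e2, e3]
    · exact i1.const_mul _
    · exact (i3.sub i2).const_mul _
    · exact (i1.const_mul _).add ((i3.sub i2).const_mul _)
    · exact (i1.sub i2).const_mul _
  have step1 : |∫ s in A, (hh δ E s * phi α ψ t s - hh δ E s * phi α ψ u s)| ≤ ∫ s in A, G s := by
    rw [← Real.norm_eq_abs]
    refine norm_integral_le_of_norm_le hGi.integrableOn ?_
    filter_upwards [ae_restrict_mem hA] with s hs
    rw [← mul_sub, norm_mul]
    refine mul_le_mul (hh_bound hδ E s) ?_ (norm_nonneg _) (by positivity)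
    have b2 := h23 s
    simp only [phi, hk1, hk2, hk3] at b2 ⊢
    by_cases hsu : s ∈ Ioo 0 u
    · have hst : s ∈ Ioo 0 t := ⟨hsu.1, hsu.2.trans_le hut⟩
      simp only [hsu, hst, indicator_of_mem] at b2 ⊢
      have c1 := hlip s hs t u hst.2.le ht hsu.2.le (hut.trans ht)
      rw [abs_of_nonneg (sub_nonneg.2 hut)] at c1
      have c2 := hK s hs u hsu.2.le (hut.trans ht)
      have c3 : 0 ≤ (t - s) ^ (α - 1) := Real.rpow_nonneg (by linarith [hst.2]) _
      have c4 : ψ t s * (t - s) ^ (α - 1) - ψ u s * (u - s) ^ (α - 1)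
        = (ψ t s - ψ u s) * (t - s) ^ (α - 1) - ψ u s * ((u - s) ^ (α - 1) - (t - s) ^ (α - 1)) := by
        ring
      rw [c4]
      refine (norm_sub_le _ _).trans ?_
      rw [norm_mul, norm_mul, Real.norm_of_nonneg c3, Real.norm_of_nonneg (sub_nonneg.2 b2)]
      have d1 := mul_le_mul_of_nonneg_right c1 c3
      have d2 := mul_le_mul_of_nonneg_right c2 (sub_nonneg.2 b2)
      simp only [Real.norm_eq_abs]
      linarith
    · by_cases hst : s ∈ Ioo 0 t
      · simp only [hsu, hst, indicator_of_mem, not_false_eq_true, indicator_of_notMem, sub_zero]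
        have c3 : 0 ≤ (t - s) ^ (α - 1) := Real.rpow_nonneg (by linarith [hst.2]) _
        have c2 := hK s hs t hst.2.le ht
        rw [norm_mul, Real.norm_of_nonneg c3]
        have d2 := mul_le_mul_of_nonneg_right c2 c3
        have d3 := mul_nonneg (mul_nonneg (hω_nonneg (t - u)) hK0) c3
        simp only [Real.norm_eq_abs]
        linarith
      · simp [hsu, hst]
  have step2 : ∫ s in A, G s ≤ ∫ s, G s :=
    setIntegral_le_integral hGi (Filter.Eventually.of_forall hG0)
  refine step1.trans (step2.trans ?_)
  rw [hGe]
  refine mul_le_mul_of_nonneg_left ?_ (by positivity)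
  have f1 : u ^ α ≤ t ^ α := Real.rpow_le_rpow hu hut hα0.le
  have f2 : t ^ α ≤ T ^ α := Real.rpow_le_rpow (hu.trans hut) ht hα0.le
  have f3 : ω (t - u) * K * (t ^ α / α)
      + K * (u ^ α / α - (t ^ α - (t - u) ^ α) / α) + K * (t ^ α / α - (t ^ α - (t - u) ^ α) / α)
      = K / α * (ω (t - u) * t ^ α + (u ^ α - t ^ α) + 2 * (t - u) ^ α) := by
    field_simp
    ring
  rw [f3]
  refine mul_le_mul_of_nonneg_left ?_ (by positivity)
  have := mul_le_mul_of_nonneg_left f2 (hω_nonneg (t - u))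
  linarith

lemma lemA (T : ℝ) (hT : 0 < T) (δ α K : ℝ) (hδ : δ ∈ Set.Ioo (0:ℝ) 1) (hα : α ∈ Set.Ioo (0:ℝ) 1)
    (hK0 : 0 ≤ K) (ψ : ℝ → ℝ → ℝ)
    (hψ : Measurable (Function.uncurry ψ)) (A : Set ℝ) (hA : MeasurableSet A) (hAT : A ⊆ Ioc 0 T)
    (hK : ∀ s ∈ A, ∀ t, s ≤ t → t ≤ T → |ψ t s| ≤ K) (ω : ℝ → ℝ) (hω_nonneg : ∀ r, 0 ≤ ω r)
    (hω0 : ω 0 = 0) (hω_cont : ContinuousWithinAt ω (Set.Ici 0) 0)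
    (hlip : ∀ s ∈ A, ∀ t t', s ≤ t → t ≤ T → s ≤ t' → t' ≤ T →
      |ψ t s - ψ t' s| ≤ ω |t - t'| * K) (ε : ℝ) (hε : 0 < ε) :
    ∃ E, MeasurableSet E ∧ E ⊆ A ∧ volume.real E = δ * volume.real A ∧
      ∀ t ∈ Icc 0 T, |∫ s in A, hh δ E s * phi α ψ t s| ≤ ε := by
  have hα0 := hα.1
  have hc : ContinuousWithinAt
      (fun r : ℝ => 1 / δ * (K / α * (ω r * T ^ α + 2 * r ^ α))) (Ici 0) 0 := by
    have : ContinuousWithinAt (fun r : ℝ => r ^ α) (Ici 0) 0 :=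
      (Real.continuousAt_rpow_const 0 α (Or.inr hα0.le)).continuousWithinAt
    exact continuousWithinAt_const.mul (continuousWithinAt_const.mul
      ((hω_cont.mul continuousWithinAt_const).add (continuousWithinAt_const.mul this)))
  rw [Metric.continuousWithinAt_iff] at hc
  obtain ⟨η, hη, hc⟩ := hc (ε / 2) (by positivity)
  have hc' : ∀ r, 0 ≤ r → r < η → 1 / δ * (K / α * (ω r * T ^ α + 2 * r ^ α)) ≤ ε / 2 := by
    intro r hr hr'
    have := hc (x := r) hr (by simpa [abs_of_nonneg hr] using hr')
    simp only [hω0, Real.zero_rpow hα0.ne', mul_zero, zero_mul, add_zero, Real.dist_eq,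
      sub_zero] at this
    exact (le_abs_self _).trans this.le
  obtain ⟨N, hN⟩ := exists_nat_gt (T / η)
  have hN0 : (0:ℝ) < N := lt_trans (by positivity) hN
  have hNη : T / N < η := by
    rw [div_lt_iff₀ hη] at hN
    rw [div_lt_iff₀ hN0]; linarith
  have hgrid : ∀ n : ℕ, n ≤ N → (n * (T / N) : ℝ) ∈ Icc 0 T := by
    intro n hn
    refine ⟨by positivity, ?_⟩
    have : (n:ℝ) ≤ N := by exact_mod_cast hn
    calc (n * (T / N) : ℝ) ≤ N * (T / N) := by gcongr
      _ = T := by field_simp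
  obtain ⟨E, h1, h2, h3, h4⟩ := lemB T hT δ hδ A hA hAT (N + 1)
    (fun i => phi α ψ ((i : ℕ) * (T / N))) (fun i => phi_meas α ψ hψ _)
    (fun i => phi_int T α K hα ψ hψ A hA hK _ (hgrid _ (by omega))) (ε / 2) (by positivity)
  refine ⟨E, h1, h2, h3, fun t ht => ?_⟩
  have hd : 0 < T / N := by positivity
  set n := ⌊t / (T / N)⌋₊ with hn
  have g1 : n * (T / N) ≤ t := by
    rw [← le_div_iff₀ hd]; exact Nat.floor_le (div_nonneg ht.1 hd.le)
  have g2 : t < (n + 1) * (T / N) := by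
    rw [← div_lt_iff₀ hd]; exact Nat.lt_floor_add_one _
  have hnN : n ≤ N := by
    have : (n : ℝ) * (T / N) ≤ N * (T / N) := by
      rw [mul_div_cancel₀ _ hN0.ne']; exact g1.trans ht.2
    exact_mod_cast le_of_mul_le_mul_right this hd
  have k1 := h4 ⟨n, by omega⟩
  simp only at k1
  have k2 := phi_diff T δ α K hδ hα hK0 ψ hψ A hA hK ω hω_nonneg hlip E h1 (n * (T / N)) t
    (hgrid n hnN).1 g1 ht.2
  have k3 := hc' (t - n * (T / N)) (by linarith) (by linarith)
  have k4 := abs_sub_abs_le_abs_sub (∫ s in A, hh δ E s * phi α ψ t s)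
    (∫ s in A, hh δ E s * phi α ψ (n * (T / N)) s)
  linarith

/-- spike-variation set lemma, singular version, Lemma 4.2 of Lin–Yong: for a
real kernel `ψ` on `Δ` satisfying `|ψ(0,s)| ≤ ψ̄(s)` and `|ψ(t,s) − ψ(t',s)| ≤ ω(|t−t'|)ψ̄(s)`
with `ψ̄ ∈ Lᵖ`, `p > 1/α`, and any `δ ∈ (0,1)`, there is a measurable `E_δ ⊆ [0,T]` of measure
`δT` with `sup_{t∈[0,T]} |∫₀ᵗ ((1/δ)1_{E_δ}(s) − 1) ψ(t,s)/(t−s)^{1−α} ds| ≤ δ`. -/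
theorem spike_variation_singular
    (T : ℝ) (hT : 0 < T) (α : ℝ) (hα : α ∈ Set.Ioo (0:ℝ) 1) (p : ℝ) (hp : 1 / α < p)
    (ψ : ℝ → ℝ → ℝ) (ψbar : ℝ → ℝ)
    (hψ_meas : Measurable (Function.uncurry ψ)) (hψbar_meas : Measurable ψbar)
    (hψbar_nonneg : ∀ s, 0 ≤ ψbar s)
    (hψbar_Lp : IntegrableOn (fun s => ψbar s ^ p) (Set.Ioc 0 T))
    (h0 : ∀ s ∈ Set.Icc (0:ℝ) T, |ψ 0 s| ≤ ψbar s)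
    (ω : ℝ → ℝ) (hω_incr : MonotoneOn ω (Set.Ici 0)) (hω_nonneg : ∀ r, 0 ≤ ω r)
    (hω0 : ω 0 = 0) (hω_cont : ContinuousWithinAt ω (Set.Ici 0) 0)
    (hlip : ∀ t t' s : ℝ, 0 ≤ s → s ≤ t → t ≤ T → s ≤ t' → t' ≤ T →
      |ψ t s - ψ t' s| ≤ ω |t - t'| * ψbar s)
    (δ : ℝ) (hδ : δ ∈ Set.Ioo (0:ℝ) 1) :
    ∃ E : Set ℝ, MeasurableSet E ∧ E ⊆ Set.Icc 0 T ∧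
      volume E = ENNReal.ofReal (δ * T) ∧
      ∀ t ∈ Set.Icc (0:ℝ) T,
        |∫ s in Set.Ioc 0 t,
            ((1 / δ) * Set.indicator E (fun _ => (1:ℝ)) s - 1) * ψ t s * (t - s) ^ (α - 1)| ≤ δ := by
  -- the dominating function; only its finiteness is used
  let G : ℝ → ℝ := fun s => |ψ T s| + (1 + ω T) * ψbar s
  have hψT : Measurable (fun s => ψ T s) := hψ_meas.comp measurable_prodMk_left
  have hGm : Measurable G := (hψT.abs).add (hψbar_meas.const_mul _)
  have hψbarG : ∀ s, ψbar s ≤ G s := by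
    intro s
    have := mul_nonneg (hω_nonneg T) (hψbar_nonneg s)
    have := abs_nonneg (ψ T s)
    simp only [G]; linarith
  have hG0 : ∀ s, 0 ≤ G s := fun s => (hψbar_nonneg s).trans (hψbarG s)
  have hψG : ∀ s t, 0 ≤ s → s ≤ t → t ≤ T → |ψ t s| ≤ G s := by
    intro s t hs hst htT
    have a1 := hlip t T s hs hst htT (hst.trans htT) le_rfl
    have a2 : ω |t - T| ≤ ω T := by
      refine hω_incr (mem_Ici.2 (abs_nonneg _)) (mem_Ici.2 hT.le) ?_
      rw [abs_le]; constructor <;> linarith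
    have a3 := mul_le_mul_of_nonneg_right a2 (hψbar_nonneg s)
    have a4 := abs_sub_abs_le_abs_sub (ψ t s) (ψ T s)
    have := hψbar_nonneg s
    simp only [G]; linarith
  let π : ℝ → ℕ := fun s => ⌊G s⌋₊
  have hπ : Measurable π := Nat.measurable_floor.comp hGm
  let A : ℕ → Set ℝ := fun j => Ioc 0 T ∩ π ⁻¹' {j}
  have hA : ∀ j, MeasurableSet (A j) := fun j =>
    measurableSet_Ioc.inter (hπ (measurableSet_singleton j))
  have hAT : ∀ j, A j ⊆ Ioc 0 T := fun j => inter_subset_left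
  have hdisj : Pairwise (fun i j => Disjoint (A i) (A j)) := by
    intro i j hij
    refine disjoint_left.2 fun s hs hs' => hij ?_
    exact hs.2.symm.trans hs'.2
  have hU : ⋃ i, A i = Ioc 0 T := by
    ext s; simp [A]
  have hAG : ∀ j, ∀ s ∈ A j, G s ≤ j + 1 := by
    intro j s hs
    have h := Nat.lt_floor_add_one (G s)
    have h' : ⌊G s⌋₊ = j := hs.2
    rw [h'] at h
    exact h.le
  choose E hE hEA hEv hEb using fun j : ℕ => lemA T hT δ α (j + 1) hδ hα (by positivity) ψ hψ_meas
    (A j) (hA j) (hAT j)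
    (fun s hs t hst htT => (hψG s t (hAT j hs).1.le hst htT).trans (hAG j s hs)) ω hω_nonneg
    hω0 hω_cont
    (fun s hs t t' h1 h2 h3 h4 => (hlip t t' s (hAT j hs).1.le h1 h2 h3 h4).trans
      (mul_le_mul_of_nonneg_left ((hψbarG s).trans (hAG j s hs)) (hω_nonneg _)))
    (δ / 2 / 2 ^ j) (by have := hδ.1; positivity)
  obtain ⟨h1, h2, h3, h4⟩ := glue T δ hδ (Ioc 0 T) subset_rfl A E hA hdisj hU hE hEA hEv
  set F := ⋃ i, E i with hF
  refine ⟨F, h1, h2.trans Ioc_subset_Icc_self, ?_, ?_⟩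
  · have hfin : volume F ≠ ⊤ := ne_top_of_le_ne_top (by simp) (measure_mono h2)
    rw [← ENNReal.ofReal_toReal hfin]
    congr 1
    rw [← measureReal_def, h3]
    simp [hT.le]
  · intro t ht
    have key : ∫ s in Set.Ioc 0 t,
            ((1 / δ) * Set.indicator F (fun _ => (1:ℝ)) s - 1) * ψ t s * (t - s) ^ (α - 1)
        = ∫ s in Ioc 0 T, hh δ F s * phi α ψ t s := by
      have e1 : (fun s => hh δ F s * phi α ψ t s) = (Ioo 0 t).indicator
          (fun s => ((1 / δ) * Set.indicator F (fun _ => (1:ℝ)) s - 1) * ψ t s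
            * (t - s) ^ (α - 1)) := by
        funext s
        unfold phi hh
        by_cases h : s ∈ Ioo 0 t
        · simp only [h, indicator_of_mem]; ring
        · simp [h]
      rw [e1, setIntegral_indicator measurableSet_Ioo, integral_Ioc_eq_integral_Ioo,
        inter_eq_right.2 ((Ioo_subset_Ioc_self).trans (Ioc_subset_Ioc_right ht.2))]
    rw [key]
    by_cases hint : IntegrableOn (fun s => hh δ F s * phi α ψ t s) (Ioc 0 T)
    · have hsum := hasSum_integral_iUnion hA hdisj (μ := volume)
        (f := fun s => hh δ F s * phi α ψ t s) (by rw [hU]; exact hint)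
      rw [hU] at hsum
      have hb := tsum_of_norm_bounded (hasSum_geometric_two' δ)
        (f := fun j => ∫ s in A j, hh δ F s * phi α ψ t s) (fun j => by
          have : ∫ s in A j, hh δ F s * phi α ψ t s = ∫ s in A j, hh δ (E j) s * phi α ψ t s :=
            setIntegral_congr_fun (hA j) fun s hs => by
              simp only [hh_congr (δ := δ) (h4 j s hs)]
          rw [this]
          exact hEb j t ht)
      rw [hsum.tsum_eq] at hb
      exact hb
    · rw [integral_undef hint]
      simpa using hδ.1.le
end
end
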